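/- arXiv:2210.02384 — 2 statements merged into one kernel-verified Lean document; each statement's English description precedes it below -/
import Mathlib

section
/- Let n ∈ ℕ⁺ and let F be a field of characteristic different from 2. Suppose there exists a nonempty finite set V of valuations on F such that the intersection H_V of their valuation rings characterises sums of 2ⁿ squares in F, and such that the residue field Fv is n-effective for every v ∈ V. Then F is n-effective. -/
open scoped Pointwise

universe u

namespace SosPaper

/-- The set of sums of `k` squares in a commutative ring. -/
def sumSq (A : Type*) [CommRing A] (k : ℕ) : Set A :=
  {x | ∃ f : Fin k → A, x = ∑ i, f i ^ 2}

/-- The set of sums of squares in a commutative ring. -/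
def sums (A : Type*) [CommRing A] : Set A := ⋃ k, sumSq A k

/-- The Pythagoras number of a commutative ring, as an extended natural number:
the least `k` such that every sum of squares is a sum of `k` squares. -/
noncomputable def pyth (A : Type*) [CommRing A] : ℕ∞ :=
  sInf ((fun k : ℕ => (k : ℕ∞)) '' {k : ℕ | sums A ⊆ sumSq A k})

/-- The level of a commutative ring: the least `k` such that `-1` is a sum of
`k` squares. -/
noncomputable def level (A : Type*) [CommRing A] : ℕ∞ :=
  sInf ((fun k : ℕ => (k : ℕ∞)) '' {k : ℕ | (-1 : A) ∈ sumSq A k})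

/-- A subring `H` of a field (or commutative ring) `A` has `A` as its field of
fractions: every element of `A` is a quotient of two elements of `H`. -/
def IsFractionSubring {A : Type*} [CommRing A] (H : Subring A) : Prop :=
  ∀ x : A, ∃ a b : H, b ≠ 0 ∧ x * b = a

/-- The invariant `p*(H)`: the least `k` such that every unit of `H` that is a
sum of squares in the ambient ring is a sum of `k` squares in the ambient ring. -/
noncomputable def pstar {A : Type*} [CommRing A] (H : Subring A) : ℕ∞ :=
  sInf ((fun k : ℕ => (k : ℕ∞)) '' {k : ℕ | ∀ h : H, IsUnit h → (h : A) ∈ sums A → (h : A) ∈ sumSq A k})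

/-- A commutative ring is semilocal if it has only finitely many maximal ideals. -/
def Semilocal (A : Type*) [CommRing A] : Prop := {I : Ideal A | I.IsMaximal}.Finite

/-- The `H`-submodule `f·H` of the ambient ring, as a set. -/
def mulSet {A : Type*} [CommRing A] (H : Subring A) (f : A) : Set A :=
  {x | ∃ h ∈ H, x = f * h}

/-- A subring `H` of a field `F` (with fraction field `F`) is square-effective if
every sum of two squares of elements of `F` can be rewritten as `g₁² + g₂²` with
`f₁H + f₂H = g₁H ⊇ g₂H`. -/
def SquareEffective {A : Type*} [CommRing A] (H : Subring A) : Prop :=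
  ∀ f₁ f₂ : A, ∃ g₁ g₂ : A, f₁ ^ 2 + f₂ ^ 2 = g₁ ^ 2 + g₂ ^ 2 ∧
    mulSet H f₁ + mulSet H f₂ = mulSet H g₁ ∧ mulSet H g₂ ⊆ mulSet H g₁

/-- The two defining conditions for a (semilocal Bézout) domain `H` to be
square-effective of order `n`:
`1 + Σ_{2ⁿ−1} H² ⊆ H^×` and `(1 + Σ_{2ⁿ} H²) ∩ Jac(H) ≠ ∅`. -/
def SqEffOrder {A : Type*} [CommRing A] (H : Subring A) (n : ℕ) : Prop :=
  (∀ x : H, x ∈ sumSq H (2 ^ n - 1) → IsUnit (1 + x)) ∧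
  ∃ x : H, x ∈ sumSq H (2 ^ n) ∧ 1 + x ∈ Ideal.jacobson (⊥ : Ideal H)

/-- A field `F` is `n`-effective if it has a semilocal Bézout subring `H` with
fraction field `F` which is square-effective of order `n` and with `p*(H) ≤ 2ⁿ`. -/
def IsNEffective (n : ℕ) (F : Type*) [Field F] : Prop :=
  ∃ H : Subring F, IsFractionSubring H ∧ Semilocal H ∧ IsBezout H ∧
    SqEffOrder H n ∧ pstar H ≤ ((2 ^ n : ℕ) : ℕ∞)

/-- A subring `H` of `F` characterises sums of `k` squares in `F` if every unit
of `H` which is a sum of squares in `F` and whose residue modulo every maximal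
ideal of `H` is a sum of `k` squares is itself a sum of `k` squares in `F`. -/
def Characterises {A : Type*} [CommRing A] (H : Subring A) (k : ℕ) : Prop :=
  ∀ h : H, IsUnit h → (h : A) ∈ sums A →
    (∀ m : Ideal H, m.IsMaximal → Ideal.Quotient.mk m h ∈ sumSq (H ⧸ m) k) →
    (h : A) ∈ sumSq A k

/-- A function field in one variable over `K`: a finitely generated field
extension of transcendence degree 1, equivalently a finite extension of a
subfield `K(x)` with `x` transcendental over `K`. -/
def IsFunctionFieldOneVar (K F : Type*) [Field K] [Field F] [Algebra K F] : Prop :=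
  ∃ x : F, Transcendental K x ∧ FiniteDimensional (IntermediateField.adjoin K {x}) F

/-- A `𝒫ₙ`-field: `p(K(X)) ≤ 2^{n+1}` and every function field in one variable
over `K` with Pythagoras number `> 2^{n+1}` is `(n+1)`-effective. -/
def IsPnField (n : ℕ) (K : Type u) [Field K] : Prop :=
  pyth (RatFunc K) ≤ ((2 ^ (n + 1) : ℕ) : ℕ∞) ∧
  ∀ (F : Type u) [Field F] [Algebra K F], IsFunctionFieldOneVar K F →
    ((2 ^ (n + 1) : ℕ) : ℕ∞) < pyth F → IsNEffective (n + 1) F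


/-- The subring `H` is the intersection of the valuation rings in `W`. -/
def IsIntersection {F : Type*} [Field F] (H : Subring F) (W : Finset (ValuationSubring F)) :
    Prop :=
  ∀ x : F, x ∈ H ↔ ∀ w ∈ W, x ∈ w

/-- Geometric sums of suitably divisible length do not vanish at a given point of a field. -/
lemma exists_geom_sum_ne_zero {k : Type*} [Field k] (y : k) :
    ∃ M : ℕ, 0 < M ∧ ∀ N : ℕ, M ∣ N → ∑ i ∈ Finset.range (N + 1), y ^ i ≠ 0 := by
  by_cases hy : y = 1
  · subst hy
    by_cases hp : ringChar k = 0
    · refine ⟨1, one_pos, fun N _ => ?_⟩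
      have := (CharP.cast_eq_zero_iff k (ringChar k) (N + 1)).not
      simp only [one_pow, Finset.sum_const, Finset.card_range, nsmul_eq_mul, mul_one]
      rw [ne_eq, this, hp]
      simp
    · refine ⟨ringChar k, Nat.pos_of_ne_zero hp, fun N hN => ?_⟩
      have := (CharP.cast_eq_zero_iff k (ringChar k) N).2 hN
      simp [this]
  · have key : ∀ N : ℕ, y ^ (N + 1) ≠ 1 → ∑ i ∈ Finset.range (N + 1), y ^ i ≠ 0 := by
      intro N h h0
      have := geom_sum_mul y (N + 1)
      rw [h0, zero_mul] at this
      exact h (sub_eq_zero.1 this.symm)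
    by_cases ho : orderOf y = 0
    · refine ⟨1, one_pos, fun N _ => key N fun h => ?_⟩
      exact (orderOf_eq_zero_iff'.1 ho) (N + 1) (Nat.succ_pos N) h
    · refine ⟨orderOf y, Nat.pos_of_ne_zero ho, fun N hN => key N fun h => hy ?_⟩
      rwa [pow_succ, orderOf_dvd_iff_pow_eq_one.1 hN, one_mul] at h

/-- For every `x` there is a common denominator `f` of `1` and `x` with respect to finitely many
valuation rings, which is a unit in each of these rings that contains `x`. -/
lemma exists_denominator {F : Type*} [Field F] (W : Finset (ValuationSubring F)) (x : F) :
    ∃ f : F, f ≠ 0 ∧ ∀ w ∈ W, f⁻¹ ∈ w ∧ x * f⁻¹ ∈ w ∧ (x ∈ w → f ∈ w) := by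
  by_cases hx0 : x = 0
  · exact ⟨1, one_ne_zero, fun w _ => by simp [hx0, w.one_mem, w.zero_mem]⟩
  have h1 : ∀ w : ValuationSubring F, ∃ M : ℕ, 0 < M ∧ ∀ N : ℕ, M ∣ N → x ∈ w →
      w.valuation (∑ i ∈ Finset.range (N + 1), x ^ i) = 1 := by
    intro w
    by_cases hx : x ∈ w
    · obtain ⟨M, hM, h⟩ := exists_geom_sum_ne_zero (IsLocalRing.residue w ⟨x, hx⟩)
      refine ⟨M, hM, fun N hN _ => ?_⟩
      have h2 := h N hN
      simp only [← map_pow, ← map_sum] at h2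
      rw [IsLocalRing.residue_ne_zero_iff_isUnit, w.valuation_eq_one_iff] at h2
      simpa using h2
    · exact ⟨1, one_pos, fun _ _ h => absurd h hx⟩
  choose M hM hMN using h1
  set N := ∏ w ∈ W, M w with hN
  have hNpos : 0 < N := Finset.prod_pos fun w _ => hM w
  set f := ∑ i ∈ Finset.range (N + 1), x ^ i with hf
  have h2 : ∀ w ∈ W, x ∈ w → w.valuation f = 1 := fun w hw hx =>
    hMN w N (Finset.dvd_prod_of_mem _ hw) hx
  have h3 : ∀ w : ValuationSubring F, x ∉ w → w.valuation f = w.valuation x ^ N := by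
    intro w hx
    have hx1 : 1 < w.valuation x := by
      rw [← not_le, w.valuation_le_one_iff]; exact hx
    have e := congrArg w.valuation (geom_sum_mul x (N + 1))
    have a1 : w.valuation (x - 1) = w.valuation x :=
      Valuation.map_sub_eq_of_lt_left _ (by simpa using hx1)
    have a2 : w.valuation (x ^ (N + 1) - 1) = w.valuation (x ^ (N + 1)) :=
      Valuation.map_sub_eq_of_lt_left _ (by
        rw [map_one, map_pow]; exact one_lt_pow₀ hx1 (Nat.succ_ne_zero N))
    rw [map_mul, a1, a2, map_pow, pow_succ] at e
    exact mul_right_cancel₀ (by simpa using hx0) e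
  by_cases hf0 : f = 0
  · refine ⟨1, one_ne_zero, fun w hw => ?_⟩
    exfalso
    by_cases hx : x ∈ w
    · have := h2 w hw hx
      simp [hf0] at this
    · have := h3 w hx
      rw [hf0, map_zero] at this
      exact pow_ne_zero N ((Valuation.ne_zero_iff _).2 hx0) this.symm
  refine ⟨f, hf0, fun w hw => ?_⟩
  by_cases hx : x ∈ w
  · have h4 := h2 w hw hx
    have h5 : f⁻¹ ∈ w := by rw [← w.valuation_le_one_iff, map_inv₀, h4, inv_one]
    exact ⟨h5, w.mul_mem _ _ hx h5, fun _ => by rw [← w.valuation_le_one_iff, h4]⟩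
  · have hx1 : 1 < w.valuation x := by
      rw [← not_le, w.valuation_le_one_iff]; exact hx
    have h4 := h3 w hx
    have hle : w.valuation x ≤ w.valuation f := by
      rw [h4]; exact le_self_pow₀ hx1.le hNpos.ne'
    have hpos : 0 < w.valuation f := zero_lt_iff.2 ((Valuation.ne_zero_iff _).2 hf0)
    refine ⟨?_, ?_, fun h => absurd h hx⟩
    · rw [← w.valuation_le_one_iff, map_inv₀]
      exact inv_le_one_of_one_le₀ (hx1.le.trans hle)
    · rw [← w.valuation_le_one_iff, map_mul, map_inv₀, ← div_eq_mul_inv]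
      exact (div_le_one₀ hpos).2 hle

namespace IsIntersection

variable {F : Type*} [Field F] {H : Subring F} {W : Finset (ValuationSubring F)}

lemma le (hH : IsIntersection H W) {w : ValuationSubring F} (hw : w ∈ W) : H ≤ w.toSubring :=
  fun x hx => (hH x).1 hx w hw

lemma isFractionSubring (hH : IsIntersection H W) : IsFractionSubring H := by
  intro x
  obtain ⟨f, hf, h⟩ := exists_denominator W x
  refine ⟨⟨x * f⁻¹, (hH _).2 fun w hw => (h w hw).2.1⟩,
    ⟨f⁻¹, (hH _).2 fun w hw => (h w hw).1⟩, ?_, rfl⟩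
  rw [ne_eq, ← Subtype.coe_inj]
  simpa using hf

/-- The center on `H` of a valuation ring containing `H`. -/
def center (hH : IsIntersection H W) (w : W) : Ideal H :=
  (IsLocalRing.maximalIdeal w.1).comap (Subring.inclusion (hH.le w.2))

lemma mem_center (hH : IsIntersection H W) (w : W) (h : H) :
    h ∈ hH.center w ↔ w.1.valuation (h : F) < 1 := by
  rw [center, Ideal.mem_comap, ValuationSubring.valuation_lt_one_iff]
  rfl

instance (hH : IsIntersection H W) (w : W) : (hH.center w).IsPrime :=
  Ideal.comap_isPrime _ _

lemma isUnit_of_forall_notMem_center (hH : IsIntersection H W) {h : H} (h0 : (h : F) ≠ 0)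
    (hh : ∀ w, h ∉ hH.center w) : IsUnit h := by
  have hinv : (h : F)⁻¹ ∈ H := by
    rw [hH]
    intro w hw
    have h1 := hh ⟨w, hw⟩
    rw [hH.mem_center, not_lt] at h1
    rw [← w.valuation_le_one_iff, map_inv₀]
    exact inv_le_one_of_one_le₀ h1
  exact IsUnit.of_mul_eq_one ⟨_, hinv⟩ (Subtype.ext (mul_inv_cancel₀ h0))

lemma exists_le_center (hH : IsIntersection H W) (hW : W.Nonempty) {I : Ideal H}
    (hI : I ≠ ⊤) : ∃ w, I ≤ hH.center w := by
  obtain ⟨w₀, hw₀⟩ := hW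
  by_contra! hcon
  have h1 : ¬ ((I : Set H) ⊆ ⋃ w ∈ ((Finset.univ : Finset W) : Set W), hH.center w) := by
    rw [Ideal.subset_union_prime ⟨w₀, hw₀⟩ ⟨w₀, hw₀⟩ fun w _ _ _ => inferInstance]
    rintro ⟨w, -, h⟩
    exact hcon w h
  rw [Set.not_subset] at h1
  obtain ⟨c, hc, hc'⟩ := h1
  simp only [Finset.coe_univ, Set.mem_univ, Set.iUnion_true, Set.mem_iUnion, SetLike.mem_coe,
    not_exists] at hc'
  refine hI (Ideal.eq_top_of_isUnit_mem I hc (hH.isUnit_of_forall_notMem_center ?_ hc'))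
  intro h0
  have h2 := hc' ⟨w₀, hw₀⟩
  rw [hH.mem_center, h0, map_zero] at h2
  exact h2 zero_lt_one

lemma exists_eq_center (hH : IsIntersection H W) (hW : W.Nonempty) {I : Ideal H}
    (hI : I.IsMaximal) : ∃ w, I = hH.center w := by
  obtain ⟨w, hw⟩ := hH.exists_le_center hW hI.ne_top
  exact ⟨w, hI.eq_of_le (Ideal.IsPrime.ne_top inferInstance) hw⟩

lemma semilocal (hH : IsIntersection H W) (hW : W.Nonempty) : Semilocal H := by
  refine (Set.finite_range hH.center).subset fun I hI => ?_
  obtain ⟨w, hw⟩ := hH.exists_eq_center hW hI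
  exact ⟨w, hw.symm⟩

lemma le_of_center_le (hH : IsIntersection H W) {w w' : W} (h : hH.center w ≤ hH.center w') :
    w'.1 ≤ w.1 := by
  intro x hx
  obtain ⟨f, hf, hfW⟩ := exists_denominator W x
  let b : H := ⟨f⁻¹, (hH _).2 fun w hw => (hfW w hw).1⟩
  have hb : b ∉ hH.center w' := by
    rw [hH.mem_center, not_lt, map_inv₀]
    have := (w'.1.valuation_le_one_iff f).2 ((hfW _ w'.2).2.2 hx)
    exact (one_le_inv₀ (zero_lt_iff.2 ((Valuation.ne_zero_iff _).2 hf))).2 this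
  have hb' : b ∉ hH.center w := fun h' => hb (h h')
  have hfw : f ∈ w.1 := by
    rw [hH.mem_center, not_lt, map_inv₀,
      one_le_inv₀ (zero_lt_iff.2 ((Valuation.ne_zero_iff _).2 hf))] at hb'
    exact (w.1.valuation_le_one_iff f).1 hb'
  have := w.1.mul_mem _ _ (hfW _ w.2).2.1 hfw
  rwa [inv_mul_cancel_right₀ hf] at this

lemma center_le_center (hH : IsIntersection H W)
    (hanti : IsAntichain (· ≤ ·) (W : Set (ValuationSubring F))) {w w' : W}
    (h : hH.center w ≤ hH.center w') : w = w' :=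
  (Subtype.ext (hanti.eq w'.2 w.2 (hH.le_of_center_le h))).symm

lemma isMaximal_center (hH : IsIntersection H W)
    (hanti : IsAntichain (· ≤ ·) (W : Set (ValuationSubring F))) (w : W) :
    (hH.center w).IsMaximal := by
  obtain ⟨m, hm, hle⟩ := Ideal.exists_le_maximal (hH.center w) (Ideal.IsPrime.ne_top inferInstance)
  obtain ⟨w', rfl⟩ := hH.exists_eq_center ⟨w.1, w.2⟩ hm
  rw [hH.center_le_center hanti hle]
  exact hm

/-- Elements of `H` approximate the residues of an element of one of the valuation rings. -/
lemma exists_valuation_sub_lt_one (hH : IsIntersection H W)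
    (hanti : IsAntichain (· ≤ ·) (W : Set (ValuationSubring F))) (w : W) {a : F}
    (ha : a ∈ w.1) : ∃ h : H, w.1.valuation (h - a) < 1 := by
  obtain ⟨f, hf, hfW⟩ := exists_denominator W a
  let b : H := ⟨f⁻¹, (hH _).2 fun w hw => (hfW w hw).1⟩
  let c : H := ⟨a * f⁻¹, (hH _).2 fun w hw => (hfW w hw).2.1⟩
  have hb : b ∉ hH.center w := by
    rw [hH.mem_center, not_lt, map_inv₀]
    have := (w.1.valuation_le_one_iff f).2 ((hfW _ w.2).2.2 ha)
    exact (one_le_inv₀ (zero_lt_iff.2 ((Valuation.ne_zero_iff _).2 hf))).2 this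
  obtain ⟨g, i, hi, hg⟩ := (hH.isMaximal_center hanti w).exists_inv hb
  refine ⟨g * c, ?_⟩
  have e : ((g * c : H) : F) - a = -(a * i) := by
    have hg' : (g : F) * f⁻¹ + i = 1 := congrArg Subtype.val hg
    have : ((g * c : H) : F) = g * (a * f⁻¹) := rfl
    rw [this]
    linear_combination a * hg'
  rw [e, Valuation.map_neg, map_mul]
  rw [hH.mem_center] at hi
  exact mul_lt_one_of_nonneg_of_lt_one_right ((w.1.valuation_le_one_iff a).2 ha) zero_le hi

/-- Weak approximation of residues for pairwise incomparable valuation rings. -/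
lemma exists_forall_valuation_sub_lt_one (hH : IsIntersection H W)
    (hanti : IsAntichain (· ≤ ·) (W : Set (ValuationSubring F))) (a : W → F)
    (ha : ∀ w : W, a w ∈ w.1) : ∃ h : H, ∀ w : W, w.1.valuation (h - a w) < 1 := by
  choose g hg using fun w : W => hH.exists_valuation_sub_lt_one hanti w (ha w)
  have hco : Pairwise (Function.onFun IsCoprime hH.center) := by
    intro w w' hne
    have := hH.isMaximal_center hanti w
    have := hH.isMaximal_center hanti w'
    refine (Ideal.isCoprime_iff_sup_eq).2 (Ideal.IsMaximal.coprime_of_ne ‹_› ‹_› fun h => hne ?_)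
    exact hH.center_le_center hanti h.le
  obtain ⟨h, hh⟩ := Ideal.exists_forall_sub_mem_ideal hco g
  refine ⟨h, fun w => ?_⟩
  have h1 := hh w
  rw [hH.mem_center] at h1
  have h2 : ((h : F) - a w) = ((h - g w : H) : F) + (g w - a w) := by push_cast; ring
  rw [h2]
  exact Valuation.map_add_lt _ h1 (hg w)

lemma isBezout_of_isAntichain (hH : IsIntersection H W) (hW : W.Nonempty)
    (hanti : IsAntichain (· ≤ ·) (W : Set (ValuationSubring F))) : IsBezout H := by
  classical
  rw [IsBezout.iff_span_pair_isPrincipal]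
  intro a b
  by_cases hab : a = 0 ∧ b = 0
  · obtain ⟨rfl, rfl⟩ := hab
    exact ⟨0, by simp⟩
  let P : W → Prop := fun w => w.1.valuation (b : F) ≤ w.1.valuation (a : F)
  have one_val {w : ValuationSubring F} {y : F} (hy : w.valuation (y - 1) < 1) :
      w.valuation y = 1 := by
    have := Valuation.map_add_eq_of_lt_right w.valuation (x := y - 1) (y := 1) (by simpa using hy)
    simpa using this
  obtain ⟨s, hs⟩ := hH.exists_forall_valuation_sub_lt_one hanti
    (fun w => if P w then 1 else 0) fun w => by
      split_ifs; exacts [w.1.one_mem, w.1.zero_mem]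
  obtain ⟨t, ht⟩ := hH.exists_forall_valuation_sub_lt_one hanti
    (fun w => if P w then 0 else 1) fun w => by
      split_ifs; exacts [w.1.zero_mem, w.1.one_mem]
  have aux {w : ValuationSubring F} {p q x y : F} (hxy : w.valuation y ≤ w.valuation x)
      (hx : x ≠ 0) (hp : w.valuation p = 1) (hq : w.valuation q < 1) :
      w.valuation (p * x + q * y) = w.valuation x := by
    have hx' : 0 < w.valuation x := zero_lt_iff.2 ((Valuation.ne_zero_iff _).2 hx)
    have h1 : w.valuation (q * y) < w.valuation (p * x) := by
      rw [map_mul, map_mul, hp, one_mul]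
      calc _ ≤ w.valuation q * w.valuation x := mul_le_mul_right hxy _
        _ < 1 * w.valuation x := mul_lt_mul_of_pos_right hq hx'
        _ = _ := one_mul _
    rw [Valuation.map_add_eq_of_lt_left _ h1, map_mul, hp, one_mul]
  set c : H := s * a + t * b with hc
  have hcF : (c : F) = s * a + t * b := rfl
  have hcv : ∀ w : W, w.1.valuation (c : F) = max (w.1.valuation (a : F)) (w.1.valuation (b : F)) := by
    intro w
    have hs := hs w
    have ht := ht w
    by_cases hP : P w
    · simp only [hP, if_true, sub_zero] at hs ht
      have ha : (a : F) ≠ 0 := by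
        intro ha
        refine hab ⟨Subtype.ext ha, Subtype.ext ?_⟩
        have hP' : w.1.valuation (b : F) ≤ w.1.valuation (a : F) := hP
        rw [ha, map_zero] at hP'
        exact (Valuation.zero_iff _).1 (le_zero_iff.1 hP')
      rw [hcF, aux hP ha (one_val hs) ht, max_eq_left hP]
    · simp only [hP, if_false, sub_zero] at hs ht
      have hP' : w.1.valuation (a : F) < w.1.valuation (b : F) := not_le.1 hP
      have hb : (b : F) ≠ 0 := by
        intro hb
        rw [hb, map_zero] at hP'
        exact not_lt_zero hP'
      rw [hcF, add_comm, aux hP'.le hb (one_val ht) hs, max_eq_right hP'.le]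
  have hdvd : ∀ d : H, (∀ w : W, w.1.valuation (d : F) ≤ w.1.valuation (c : F)) → c ∣ d := by
    intro d hd
    by_cases hc0 : (c : F) = 0
    · obtain ⟨w, hw⟩ := hW
      have h := hd ⟨w, hw⟩
      rw [hc0, map_zero, le_zero_iff, Valuation.zero_iff] at h
      exact ⟨0, Subtype.ext (by simpa using h)⟩
    refine ⟨⟨d / c, (hH _).2 fun w hw => ?_⟩, Subtype.ext (mul_div_cancel₀ _ hc0).symm⟩
    rw [← w.valuation_le_one_iff, map_div₀]
    exact (div_le_one₀ (zero_lt_iff.2 ((Valuation.ne_zero_iff _).2 hc0))).2 (hd ⟨w, hw⟩)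
  refine ⟨c, le_antisymm ?_ ?_⟩
  · rw [Ideal.span_le]
    rintro x (rfl | rfl)
    · exact Ideal.mem_span_singleton.2 (hdvd _ fun w => (hcv w).symm ▸ le_max_left _ _)
    · exact Ideal.mem_span_singleton.2 (hdvd _ fun w => (hcv w).symm ▸ le_max_right _ _)
  · rw [Submodule.span_singleton_le_iff_mem]
    exact Ideal.mem_span_pair.2 ⟨s, t, rfl⟩

/-- The minimal elements of `W` have the same intersection as `W`. -/
lemma exists_isAntichain (hH : IsIntersection H W) (hW : W.Nonempty) :
    ∃ W' ⊆ W, W'.Nonempty ∧ IsAntichain (· ≤ ·) (W' : Set (ValuationSubring F)) ∧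
      IsIntersection H W' := by
  classical
  refine ⟨W.filter (Minimal (· ∈ W)), Finset.filter_subset _ _, ?_, ?_, ?_⟩
  · obtain ⟨w, hw⟩ := hW
    obtain ⟨w', -, h⟩ := W.exists_le_minimal hw
    exact ⟨w', Finset.mem_filter.2 ⟨h.1, h⟩⟩
  · intro w hw w' hw' hne hle
    simp only [Finset.coe_filter, Set.mem_ofPred_eq] at hw hw'
    exact hne (le_antisymm hle (hw'.2.2 hw.1 hle))
  · intro x
    rw [hH]
    refine ⟨fun h w hw => h w (Finset.mem_filter.1 hw).1, fun h w hw => ?_⟩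
    obtain ⟨w', hle, h'⟩ := W.exists_le_minimal hw
    exact hle (h w' (Finset.mem_filter.2 ⟨h'.1, h'⟩))

lemma isBezout (hH : IsIntersection H W) (hW : W.Nonempty) : IsBezout H := by
  obtain ⟨W', -, hW', hanti, hH'⟩ := hH.exists_isAntichain hW
  exact hH'.isBezout_of_isAntichain hW' hanti

end IsIntersection

/-- The localization of a Bézout subring at a prime ideal is a valuation ring. -/
lemma exists_valuationSubring_of_isPrime {K : Type*} [Field K] {H : Subring K}
    (hfrac : IsFractionSubring H) (hbez : IsBezout H) (m : Ideal H) [hm : m.IsPrime] :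
    ∃ v : ValuationSubring K, ∀ x, x ∈ v ↔ ∃ a b : H, b ∉ m ∧ x * b = a := by
  have h1 : (1 : H) ∉ m := fun h => hm.ne_top ((Ideal.eq_top_iff_one m).2 h)
  refine ⟨{ carrier := {x | ∃ a b : H, b ∉ m ∧ x * b = a}
            mul_mem' := ?_, one_mem' := ?_, add_mem' := ?_, zero_mem' := ?_, neg_mem' := ?_
            mem_or_inv_mem' := ?_ }, fun x => Iff.rfl⟩
  · rintro x y ⟨a, b, hb, hx⟩ ⟨c, d, hd, hy⟩
    refine ⟨a * c, b * d, fun h => (hm.mem_or_mem h).elim hb hd, ?_⟩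
    push_cast
    rw [← hx, ← hy]
    ring
  · exact ⟨1, 1, h1, by simp⟩
  · rintro x y ⟨a, b, hb, hx⟩ ⟨c, d, hd, hy⟩
    refine ⟨a * d + c * b, b * d, fun h => (hm.mem_or_mem h).elim hb hd, ?_⟩
    push_cast
    rw [← hx, ← hy]
    ring
  · exact ⟨0, 1, h1, by simp⟩
  · rintro x ⟨a, b, hb, hx⟩
    refine ⟨-a, b, hb, ?_⟩
    push_cast
    rw [← hx]
    ring
  · intro x
    obtain ⟨a, b, hb, hx⟩ := hfrac x
    obtain ⟨c, hc⟩ := IsBezout.iff_span_pair_isPrincipal.1 hbez a b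
    have ha' : a ∈ Ideal.span {c} := by
      rw [Ideal.span, ← hc]; exact Ideal.subset_span (by simp)
    have hb' : b ∈ Ideal.span {c} := by
      rw [Ideal.span, ← hc]; exact Ideal.subset_span (by simp)
    have hc' : c ∈ Ideal.span {a, b} := by
      rw [hc]; exact Submodule.mem_span_singleton_self c
    obtain ⟨a', rfl⟩ := Ideal.mem_span_singleton.1 ha'
    obtain ⟨b', rfl⟩ := Ideal.mem_span_singleton.1 hb'
    obtain ⟨s, t, hst⟩ := Ideal.mem_span_pair.1 hc'
    have hc0 : c ≠ 0 := by
      rintro rfl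
      simp at hb
    have hst' : s * a' + t * b' = 1 :=
      mul_left_cancel₀ hc0 (by linear_combination hst)
    have hcF : (c : K) ≠ 0 := by simpa using hc0
    have hx' : x * b' = a' := by
      push_cast at hx
      exact mul_left_cancel₀ hcF (by rw [← hx]; ring)
    by_cases hbm : b' ∈ m
    · right
      have ham : a' ∉ m := fun h =>
        h1 (hst' ▸ m.add_mem (m.mul_mem_left _ h) (m.mul_mem_left _ hbm))
      refine ⟨b', a', ham, ?_⟩
      have hx0 : x ≠ 0 := by
        rintro rfl
        rw [zero_mul] at hx'
        have : a' = 0 := Subtype.ext hx'.symm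
        exact ham (this ▸ m.zero_mem)
      rw [← hx', inv_mul_cancel_left₀ hx0]
    · exact Or.inl ⟨a', b', hbm, hx'⟩

/-- A semilocal Bézout subring with fraction field `K` is a finite intersection of valuation
rings of `K`. -/
lemma exists_isIntersection {K : Type*} [Field K] {H : Subring K}
    (hfrac : IsFractionSubring H) (hsemi : Semilocal H) (hbez : IsBezout H) :
    ∃ W : Finset (ValuationSubring K), W.Nonempty ∧ IsIntersection H W := by
  classical
  have h : ∀ m : Ideal H, ∃ v : ValuationSubring K, m.IsMaximal →
      ∀ x, x ∈ v ↔ ∃ a b : H, b ∉ m ∧ x * b = a := by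
    intro m
    by_cases hm : m.IsMaximal
    · obtain ⟨v, hv⟩ := exists_valuationSubring_of_isPrime hfrac hbez m
      exact ⟨v, fun _ => hv⟩
    · exact ⟨⊤, fun h => absurd h hm⟩
  choose v hv using h
  refine ⟨hsemi.toFinset.image v, ?_, fun x => ?_⟩
  · obtain ⟨m, hm⟩ := Ideal.exists_maximal H
    exact ⟨v m, Finset.mem_image_of_mem _ (hsemi.mem_toFinset.2 hm)⟩
  · have hmem : ∀ m : Ideal H, m ∈ hsemi.toFinset ↔ m.IsMaximal := fun m => hsemi.mem_toFinset
    simp only [Finset.mem_image, hmem, forall_exists_index, and_imp]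
    constructor
    · rintro hx _ m hm rfl
      exact (hv m hm x).2 ⟨⟨x, hx⟩, 1, fun h => hm.ne_top ((Ideal.eq_top_iff_one m).2 h),
        by simp⟩
    · intro hx
      let I : Ideal H :=
        { carrier := {r | x * r ∈ H}
          add_mem' := fun {r s} hr hs => by
            have := H.add_mem hr hs
            rwa [← mul_add] at this
          zero_mem' := by simp [H.zero_mem]
          smul_mem' := fun r s hs => by
            have := H.mul_mem r.2 hs
            rwa [mul_left_comm] at this }
      by_cases hI : I = ⊤
      · have : (1 : H) ∈ I := hI ▸ Submodule.mem_top
        simpa [I] using this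
      · obtain ⟨m, hm, hle⟩ := Ideal.exists_le_maximal I hI
        obtain ⟨a, b, hb, hab⟩ := (hv m hm x).1 (hx _ m hm rfl)
        refine absurd (hle ?_) hb
        change x * b ∈ H
        rw [hab]
        exact a.2

/-- The preimage in `F` of a subring of the residue field of a valuation ring. -/
def residuePreimage {F : Type*} [Field F] (v : ValuationSubring F)
    (D : Subring (IsLocalRing.ResidueField v)) : Subring F :=
  (D.comap (IsLocalRing.residue v)).map v.subtype

lemma mem_residuePreimage {F : Type*} [Field F] {v : ValuationSubring F}
    {D : Subring (IsLocalRing.ResidueField v)} {x : F} :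
    x ∈ residuePreimage v D ↔ ∃ hx : x ∈ v, IsLocalRing.residue v ⟨x, hx⟩ ∈ D := by
  simp only [residuePreimage, Subring.mem_map, Subring.mem_comap]
  constructor
  · rintro ⟨y, hy, rfl⟩
    exact ⟨y.2, hy⟩
  · rintro ⟨hx, h⟩
    exact ⟨⟨x, hx⟩, h, rfl⟩

/-- The composite of a valuation ring with a valuation ring of its residue field. -/
def composite {F : Type*} [Field F] (v : ValuationSubring F)
    (w : ValuationSubring (IsLocalRing.ResidueField v)) : ValuationSubring F where
  toSubring := residuePreimage v w.toSubring
  mem_or_inv_mem' x := by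
    change x ∈ residuePreimage v w.toSubring ∨ x⁻¹ ∈ residuePreimage v w.toSubring
    simp only [mem_residuePreimage, ValuationSubring.mem_toSubring]
    have key : ∀ y : F, (hy : y ∈ v) → v.valuation y < 1 →
        IsLocalRing.residue v ⟨y, hy⟩ ∈ w := by
      intro y hy h
      have h0 : IsLocalRing.residue v ⟨y, hy⟩ = 0 := by
        rw [IsLocalRing.residue_eq_zero_iff]
        exact (v.valuation_lt_one_iff ⟨y, hy⟩).2 h
      rw [h0]
      exact w.zero_mem
    rcases lt_trichotomy (v.valuation x) 1 with h | h | h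
    · have hx : x ∈ v := (v.valuation_le_one_iff x).1 h.le
      exact Or.inl ⟨hx, key x hx h⟩
    · have hx : x ∈ v := (v.valuation_le_one_iff x).1 h.le
      have hx' : x⁻¹ ∈ v := by rw [← v.valuation_le_one_iff, map_inv₀, h, inv_one]
      have hx0 : x ≠ 0 := by
        rintro rfl
        simp at h
      have e : IsLocalRing.residue v ⟨x⁻¹, hx'⟩ = (IsLocalRing.residue v ⟨x, hx⟩)⁻¹ := by
        refine eq_inv_of_mul_eq_one_left ?_
        rw [← map_mul, ← map_one (IsLocalRing.residue v)]
        exact congrArg _ (Subtype.ext (inv_mul_cancel₀ hx0))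
      rcases w.mem_or_inv_mem (IsLocalRing.residue v ⟨x, hx⟩) with h' | h'
      · exact Or.inl ⟨hx, h'⟩
      · exact Or.inr ⟨hx', e ▸ h'⟩
    · have h1 : v.valuation x⁻¹ < 1 := by
        rw [map_inv₀]; exact inv_lt_one_of_one_lt₀ h
      have hx' : x⁻¹ ∈ v := (v.valuation_le_one_iff _).1 h1.le
      exact Or.inr ⟨hx', key _ hx' h1⟩

lemma mem_composite {F : Type*} [Field F] {v : ValuationSubring F}
    {w : ValuationSubring (IsLocalRing.ResidueField v)} {x : F} :
    x ∈ composite v w ↔ ∃ hx : x ∈ v, IsLocalRing.residue v ⟨x, hx⟩ ∈ w :=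
  mem_residuePreimage (D := w.toSubring)

/-- The residue map from a subring of `residuePreimage v D` to `D`. -/
noncomputable def residueMap {F : Type*} [Field F] {v : ValuationSubring F}
    {D : Subring (IsLocalRing.ResidueField v)} {H : Subring F} (h : H ≤ residuePreimage v D) :
    H →+* D :=
  RingHom.codRestrict
    ((IsLocalRing.residue v).comp
      (Subring.inclusion (fun _ hx => (mem_residuePreimage.1 (h hx)).1 : H ≤ v.toSubring))) D
    fun y => (mem_residuePreimage.1 (h y.2)).2

lemma inv_mem_residuePreimage {F : Type*} [Field F] {v : ValuationSubring F}
    {D : Subring (IsLocalRing.ResidueField v)} {H : Subring F} (h : H ≤ residuePreimage v D)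
    {x : H} (hx : IsUnit (residueMap h x)) :
    v.valuation (x : F) = 1 ∧ (x : F)⁻¹ ∈ residuePreimage v D := by
  have hxv := (mem_residuePreimage.1 (h x.2)).1
  obtain ⟨g, hg⟩ := hx.exists_right_inv
  have hg' : IsLocalRing.residue v ⟨x, hxv⟩ * g = 1 := congrArg Subtype.val hg
  have hval : v.valuation (x : F) = 1 := by
    have h0 : IsLocalRing.residue v ⟨x, hxv⟩ ≠ 0 := left_ne_zero_of_mul_eq_one hg'
    rw [IsLocalRing.residue_ne_zero_iff_isUnit] at h0
    exact (v.valuation_eq_one_iff ⟨x, hxv⟩).1 h0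
  have hinv : (x : F)⁻¹ ∈ v := by rw [← v.valuation_le_one_iff, map_inv₀, hval, inv_one]
  have hx0 : (x : F) ≠ 0 := fun h0 => by simp [h0] at hval
  refine ⟨hval, mem_residuePreimage.2 ⟨hinv, ?_⟩⟩
  have e : IsLocalRing.residue v ⟨x, hxv⟩ * IsLocalRing.residue v ⟨(x : F)⁻¹, hinv⟩ = 1 := by
    rw [← map_mul, ← map_one (IsLocalRing.residue v)]
    exact congrArg _ (Subtype.ext (mul_inv_cancel₀ hx0))
  rw [mul_left_cancel₀ (left_ne_zero_of_mul_eq_one hg') (e.trans hg'.symm)]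
  exact g.2

lemma sumSq_mono {A : Type*} [CommRing A] {k l : ℕ} (h : k ≤ l) : sumSq A k ⊆ sumSq A l := by
  obtain ⟨d, rfl⟩ := Nat.exists_eq_add_of_le h
  rintro x ⟨f, rfl⟩
  exact ⟨Fin.append f 0, by simp [Fin.sum_univ_add]⟩

lemma map_mem_sumSq {A B : Type*} [CommRing A] [CommRing B] (φ : A →+* B) {k : ℕ} {x : A}
    (hx : x ∈ sumSq A k) : φ x ∈ sumSq B k := by
  obtain ⟨f, rfl⟩ := hx
  exact ⟨fun i => φ (f i), by simp⟩

lemma mem_sums_iff {A : Type*} [CommRing A] {x : A} : x ∈ sums A ↔ IsSumSq x := by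
  constructor
  · intro h
    obtain ⟨k, f, rfl⟩ := Set.mem_iUnion.1 h
    exact IsSumSq.sum_sq _ _
  · intro h
    induction h with
    | zero => exact Set.mem_iUnion.2 ⟨0, Fin.elim0, by simp⟩
    | sq_add a hs ih =>
      obtain ⟨k, f, rfl⟩ := Set.mem_iUnion.1 ih
      exact Set.mem_iUnion.2 ⟨k + 1, Fin.cons a f, by simp [Fin.sum_univ_succ, sq]⟩

lemma pstar_le_iff {A : Type*} [CommRing A] {H : Subring A} {k : ℕ} :
    pstar H ≤ (k : ℕ∞) ↔
      ∀ h : H, IsUnit h → (h : A) ∈ sums A → (h : A) ∈ sumSq A k := by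
  constructor
  · intro h
    set S := {k : ℕ | ∀ h : H, IsUnit h → (h : A) ∈ sums A → (h : A) ∈ sumSq A k} with hS
    have hne : ((fun k : ℕ => (k : ℕ∞)) '' S).Nonempty := by
      by_contra hne
      rw [Set.not_nonempty_iff_eq_empty] at hne
      rw [pstar, ← hS, hne, sInf_empty, top_le_iff] at h
      exact ENat.natCast_ne_top k h
    obtain ⟨l, hl, hl'⟩ := csInf_mem hne
    rw [pstar, ← hS, ← hl', Nat.cast_le] at h
    exact fun x hx hx' => sumSq_mono h (hl x hx hx')
  · exact fun h => sInf_le ⟨k, h, rfl⟩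

/-- The residue of a valuation unit which is a sum of squares is a sum of squares. -/
lemma isSumSq_residue {F : Type*} [Field F] (v : ValuationSubring F)
    (h2 : (2 : IsLocalRing.ResidueField v) ≠ 0) {x : F} (hx : x ∈ v) (hs : x ∈ sums F) :
    IsSumSq (IsLocalRing.residue v ⟨x, hx⟩) := by
  obtain ⟨k, f, hf⟩ := Set.mem_iUnion.1 hs
  by_cases hfv : ∀ i, f i ∈ v
  · have e : (⟨x, hx⟩ : v) = ∑ i, (⟨f i, hfv i⟩ : v) ^ 2 := by
      apply Subtype.ext
      push_cast
      exact hf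
    rw [e, map_sum]
    simp only [map_pow]
    exact IsSumSq.sum_sq _ _
  · push Not at hfv
    obtain ⟨i₀, hi₀⟩ := hfv
    obtain ⟨i, -, hi⟩ := Finset.exists_max_image Finset.univ (fun i => v.valuation (f i))
      ⟨i₀, Finset.mem_univ _⟩
    have hval : 1 < v.valuation (f i) := by
      rw [← v.valuation_le_one_iff, not_le] at hi₀
      exact hi₀.trans_le (hi i₀ (Finset.mem_univ _))
    have hpos : 0 < v.valuation (f i) := zero_lt_one.trans hval
    have hfi : f i ≠ 0 := (Valuation.ne_zero_iff _).1 hpos.ne'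
    have hdiv : ∀ j, f j / f i ∈ v := fun j => by
      rw [← v.valuation_le_one_iff, map_div₀]
      exact (div_le_one₀ hpos).2 (hi j (Finset.mem_univ _))
    have hinv : v.valuation (f i)⁻¹ < 1 := by
      rw [map_inv₀]; exact inv_lt_one_of_one_lt₀ hval
    have hinv' : (f i)⁻¹ ∈ v := (v.valuation_le_one_iff _).1 hinv.le
    have hsum : (⟨x, hx⟩ : v) * ⟨(f i)⁻¹, hinv'⟩ ^ 2 = ∑ j, (⟨f j / f i, hdiv j⟩ : v) ^ 2 := by
      apply Subtype.ext
      push_cast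
      rw [hf, Finset.sum_mul]
      exact Finset.sum_congr rfl fun j _ => by rw [div_eq_mul_inv, mul_pow]
    have hzero : IsLocalRing.residue v ⟨(f i)⁻¹, hinv'⟩ = 0 := by
      rw [IsLocalRing.residue_eq_zero_iff]
      exact (v.valuation_lt_one_iff ⟨_, hinv'⟩).2 hinv
    have hone : (⟨f i / f i, hdiv i⟩ : v) = 1 := Subtype.ext (div_self hfi)
    have hr := congrArg (IsLocalRing.residue v) hsum
    rw [map_mul, map_pow, hzero, map_sum, ← Finset.add_sum_erase _ _ (Finset.mem_univ i), hone]
      at hr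
    simp only [map_pow, map_one] at hr
    set s := ∑ j ∈ Finset.univ.erase i, IsLocalRing.residue v ⟨f j / f i, hdiv j⟩ ^ 2 with hsdef
    have hneg : s = -1 := by linear_combination -hr
    have hs' : IsSumSq s := IsSumSq.sum_sq _ _
    generalize IsLocalRing.residue v ⟨x, hx⟩ = a
    have e : a = ((a + 1) / 2) * ((a + 1) / 2) + s * (((a - 1) / 2) * ((a - 1) / 2)) := by
      rw [hneg]
      field_simp
      ring
    rw [e]
    exact (IsSumSq.mul_self _).add (hs'.mul (IsSumSq.mul_self _))

lemma SqEffOrder.two_ne_zero {K : Type*} [Field K] {H : Subring K} {n : ℕ} (hn : 0 < n)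
    (h : SqEffOrder H n) : (2 : K) ≠ 0 := by
  have h1 : (1 : H) ∈ sumSq H (2 ^ n - 1) := by
    have : 1 ≤ 2 ^ n - 1 := by
      have := Nat.pow_le_pow_right (n := 2) (by norm_num) hn
      omega
    exact sumSq_mono this ⟨fun _ => 1, by simp⟩
  have h2 := (h.1 1 h1).map H.subtype
  rw [map_add, map_one, one_add_one_eq_two] at h2
  exact h2.ne_zero

lemma residue_eq_residue {F : Type*} [Field F] {v : ValuationSubring F} {x : F} {a : v}
    (hx : x ∈ v) (h : v.valuation (x - a) < 1) :
    IsLocalRing.residue v ⟨x, hx⟩ = IsLocalRing.residue v a := by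
  rw [← sub_eq_zero, ← map_sub, IsLocalRing.residue_eq_zero_iff,
    ValuationSubring.valuation_lt_one_iff]
  exact h

/-- If the residue of `h` is a sum of `k` squares, so is its class modulo the center. -/
lemma IsIntersection.mk_mem_sumSq {F : Type*} [Field F] {H : Subring F}
    {W : Finset (ValuationSubring F)} (hH : IsIntersection H W)
    (hanti : IsAntichain (· ≤ ·) (W : Set (ValuationSubring F))) (w : W) {k : ℕ} (h : H)
    (hw : (h : F) ∈ w.1)
    (hs : IsLocalRing.residue w.1 ⟨h, hw⟩ ∈ sumSq (IsLocalRing.ResidueField w.1) k) :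
    Ideal.Quotient.mk (hH.center w) h ∈ sumSq (H ⧸ hH.center w) k := by
  obtain ⟨f, hf⟩ := hs
  choose a ha using fun i => IsLocalRing.residue_surjective (R := w.1) (f i)
  choose x hx using fun i => hH.exists_valuation_sub_lt_one hanti w (a i).2
  refine ⟨fun i => Ideal.Quotient.mk _ (x i), ?_⟩
  simp only [← map_pow, ← map_sum]
  rw [Ideal.Quotient.eq, hH.mem_center]
  have hxw : ∀ i, (x i : F) ∈ w.1 := fun i => (hH _).1 (x i).2 _ w.2
  have hxa : ∀ i, IsLocalRing.residue w.1 ⟨x i, hxw i⟩ = f i := fun i =>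
    (residue_eq_residue (hxw i) (hx i)).trans (ha i)
  simp only [← hxa, ← map_pow, ← map_sum] at hf
  rw [← sub_eq_zero, ← map_sub, IsLocalRing.residue_eq_zero_iff,
    ValuationSubring.valuation_lt_one_iff] at hf
  simpa using hf

/-- Simultaneous lifting of residues to the intersection of the preimages of subrings of the
residue fields of pairwise incomparable valuation rings. -/
lemma IsIntersection.exists_residueMap_eq {F : Type*} [Field F] {R H : Subring F}
    {W : Finset (ValuationSubring F)} (hR : IsIntersection R W)
    (hanti : IsAntichain (· ≤ ·) (W : Set (ValuationSubring F)))
    {D : ∀ v : ValuationSubring F, Subring (IsLocalRing.ResidueField v)}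
    (hH : ∀ x, x ∈ H ↔ ∀ v ∈ W, x ∈ residuePreimage v (D v))
    (hle : ∀ v : W, H ≤ residuePreimage v.1 (D v.1)) (g : ∀ v : W, D v.1) :
    ∃ x : H, ∀ v : W, residueMap (hle v) x = g v := by
  choose a ha using fun v : W => IsLocalRing.residue_surjective (R := v.1)
    (g v : IsLocalRing.ResidueField v.1)
  obtain ⟨x, hx⟩ := hR.exists_forall_valuation_sub_lt_one hanti
    (fun v => (a v : F)) fun v => (a v).2
  have hres : ∀ v : W, ∀ hxv : (x : F) ∈ v.1,
      IsLocalRing.residue v.1 ⟨x, hxv⟩ = g v := fun v hxv =>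
    (residue_eq_residue hxv (hx v)).trans (ha v)
  refine ⟨⟨x, (hH _).2 fun v hv => ?_⟩, fun v => Subtype.ext (hres v _)⟩
  have hxv := (hR x).1 x.2 v hv
  exact mem_residuePreimage.2 ⟨hxv, hres ⟨v, hv⟩ hxv ▸ (g ⟨v, hv⟩).2⟩

theorem statement15 (n : ℕ) (hn : 0 < n) {F : Type*} [Field F]
    (hchar : ringChar F ≠ 2)
    (V : Finset (ValuationSubring F)) (hV : V.Nonempty)
    (hcharV : Characterises (⨅ v ∈ V, ValuationSubring.toSubring v) (2 ^ n))
    (heff : ∀ v ∈ V, IsNEffective n (IsLocalRing.ResidueField v)) :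
    IsNEffective n F := by
  classical
  have hR₀ : IsIntersection (⨅ v ∈ V, ValuationSubring.toSubring v) V := fun x => by
    simp [Subring.mem_iInf]
  obtain ⟨V', hsub, hV', hanti, hR⟩ := hR₀.exists_isAntichain hV
  generalize (⨅ v ∈ V, ValuationSubring.toSubring v : Subring F) = R at hcharV hR
  have hD : ∀ v : ValuationSubring F, ∃ (D : Subring (IsLocalRing.ResidueField v))
      (W : Finset (ValuationSubring (IsLocalRing.ResidueField v))), v ∈ V' →
        W.Nonempty ∧ IsIntersection D W ∧ SqEffOrder D n ∧ pstar D ≤ ((2 ^ n : ℕ) : ℕ∞) := by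
    intro v
    by_cases hv : v ∈ V'
    · obtain ⟨D, hfrac, hsemi, hbez, hsq, hp⟩ := heff v (hsub hv)
      obtain ⟨W, hW, hDW⟩ := exists_isIntersection hfrac hsemi hbez
      exact ⟨D, W, fun _ => ⟨hW, hDW, hsq, hp⟩⟩
    · exact ⟨⊤, ∅, fun h => absurd h hv⟩
  choose D W hDW using hD
  obtain ⟨H, mem_H⟩ : ∃ H : Subring F, ∀ x, x ∈ H ↔ ∀ v ∈ V', x ∈ residuePreimage v (D v) :=
    ⟨⨅ v ∈ V', residuePreimage v (D v), fun x => by simp [Subring.mem_iInf]⟩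
  have hle : ∀ v : V', H ≤ residuePreimage v.1 (D v.1) := fun v x hx => (mem_H x).1 hx _ v.2
  have hHR : H ≤ R := fun x hx =>
    (hR x).2 fun v hv => (mem_residuePreimage.1 (hle ⟨v, hv⟩ hx)).1
  have hHU : IsIntersection H (V'.biUnion fun v => (W v).image (composite v)) := by
    intro x
    simp only [mem_H, Finset.mem_biUnion, Finset.mem_image, forall_exists_index, and_imp]
    constructor
    · rintro h _ v hv w hw rfl
      obtain ⟨hx, hx'⟩ := mem_residuePreimage.1 (h v hv)
      exact mem_composite.2 ⟨hx, ((hDW v hv).2.1 _).1 hx' w hw⟩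
    · intro h v hv
      obtain ⟨w₀, hw₀⟩ := (hDW v hv).1
      obtain ⟨hx, -⟩ := mem_composite.1 (h _ v hv w₀ hw₀ rfl)
      refine mem_residuePreimage.2 ⟨hx, ((hDW v hv).2.1 _).2 fun w hw => ?_⟩
      exact (mem_composite.1 (h _ v hv w hw rfl)).2
  have hU : (V'.biUnion fun v => (W v).image (composite v)).Nonempty := by
    obtain ⟨v, hv⟩ := hV'
    obtain ⟨w, hw⟩ := (hDW v hv).1
    exact ⟨_, Finset.mem_biUnion.2 ⟨v, hv, Finset.mem_image_of_mem _ hw⟩⟩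
  have hunit : ∀ x : H, (∀ v : V', IsUnit (residueMap (hle v) x)) → IsUnit x := by
    intro x hx
    obtain ⟨v₀, hv₀⟩ := hV'
    have hx0 : (x : F) ≠ 0 := fun h0 => by
      have := (inv_mem_residuePreimage (hle ⟨v₀, hv₀⟩) (hx ⟨v₀, hv₀⟩)).1
      simp [h0] at this
    have hinv : (x : F)⁻¹ ∈ H :=
      (mem_H _).2 fun v hv => (inv_mem_residuePreimage (hle ⟨v, hv⟩) (hx ⟨v, hv⟩)).2
    exact IsUnit.of_mul_eq_one ⟨_, hinv⟩ (Subtype.ext (mul_inv_cancel₀ hx0))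
  refine ⟨H, hHU.isFractionSubring, hHU.semilocal hU, hHU.isBezout hU, ⟨?_, ?_⟩, ?_⟩
  · intro x hx
    refine hunit _ fun v => ?_
    rw [map_add, map_one]
    exact (hDW v.1 v.2).2.2.1.1 _ (map_mem_sumSq _ hx)
  · have hjac : ∀ v : V', ∃ g : Fin (2 ^ n) → D v.1,
        1 + ∑ i, g i ^ 2 ∈ Ideal.jacobson (⊥ : Ideal (D v.1)) := by
      intro v
      obtain ⟨_, ⟨g, rfl⟩, h⟩ := (hDW v.1 v.2).2.2.1.2
      exact ⟨g, h⟩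
    choose g hg using hjac
    choose x hx using fun i : Fin (2 ^ n) =>
      hR.exists_residueMap_eq hanti mem_H hle fun v => g v i
    refine ⟨_, ⟨x, rfl⟩, Ideal.mem_jacobson_bot.2 fun y => hunit _ fun v => ?_⟩
    have := Ideal.mem_jacobson_bot.1 (hg v) (residueMap (hle v) y)
    simpa [hx] using this
  · rw [pstar_le_iff]
    intro h hh hs
    refine hcharV (Subring.inclusion hHR h) (hh.map _) hs fun m hm => ?_
    obtain ⟨v, rfl⟩ := hR.exists_eq_center hV' hm
    have hhv := (mem_residuePreimage.1 (hle v h.2)).1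
    have hv := (hDW v.1 v.2).2.2
    refine hR.mk_mem_sumSq hanti v _ hhv ?_
    exact pstar_le_iff.1 hv.2 (residueMap (hle v) h) (hh.map _)
      (mem_sums_iff.2 (isSumSq_residue v.1 (hv.1.two_ne_zero hn) hhv hs))

end SosPaper
end

section
/- Let n ∈ ℕ and let k be a real field such that p(L) ≤ 2ⁿ for every finite field extension L of k. Let h ∈ k[X] be an irreducible polynomial such that h is a sum of squares in the rational function field k(X) but not a sum of 2^{n+1} − 1 squares in k(X). Let F be the quadratic extension of the rational function field k((t))(X) obtained by adjoining a square root of (tX − 1)·h. Then p(F) = 2^{n+1} + 1. -/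
open scoped Pointwise

universe u

namespace SosPaper

/-! ### Sums of squares -/

section Basic

variable {A B : Type*} [CommRing A] [CommRing B]

theorem sum_sq_mem_sumSq {ι : Type*} [Fintype ι] (f : ι → A) {m : ℕ}
    (hm : Fintype.card ι ≤ m) : ∑ i, f i ^ 2 ∈ sumSq A m := by
  classical
  obtain ⟨e⟩ : Nonempty (ι ↪ Fin m) :=
    Function.Embedding.nonempty_of_card_le (by simpa using hm)
  refine ⟨fun j => if hj : ∃ i, e i = j then f hj.choose else 0, ?_⟩
  have h1 : ∀ i, (if hj : ∃ i', e i' = e i then f hj.choose else 0) = f i := by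
    intro i
    have hj : ∃ i', e i' = e i := ⟨i, rfl⟩
    rw [dif_pos hj, e.injective hj.choose_spec]
  rw [← Finset.sum_subset (Finset.subset_univ (Finset.univ.map e))]
  · rw [Finset.sum_map]
    exact Finset.sum_congr rfl fun i _ => (congrArg (· ^ 2) (h1 i)).symm
  · intro j _ hj
    have : ¬ ∃ i, e i = j := by
      rintro ⟨i, rfl⟩
      exact hj (by simp)
    simp [this]

theorem sumSq_mono_s18 {m n : ℕ} (hmn : m ≤ n) : sumSq A m ⊆ sumSq A n := by
  rintro x ⟨f, rfl⟩
  exact sum_sq_mem_sumSq f (by simpa using hmn)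

theorem add_mem_sumSq {m n l : ℕ} {a b : A} (ha : a ∈ sumSq A m) (hb : b ∈ sumSq A n)
    (hl : m + n ≤ l) : a + b ∈ sumSq A l := by
  obtain ⟨f, rfl⟩ := ha
  obtain ⟨g, rfl⟩ := hb
  have := sum_sq_mem_sumSq (Sum.elim f g) (m := l) (by simpa using hl)
  simpa using this

theorem sq_mem_sumSq (a : A) {m : ℕ} (hm : 1 ≤ m) : a ^ 2 ∈ sumSq A m :=
  sumSq_mono_s18 hm ⟨fun _ => a, by simp⟩

theorem zero_mem_sumSq (m : ℕ) : (0 : A) ∈ sumSq A m := ⟨fun _ => 0, by simp⟩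

theorem sq_mul_mem_sumSq (a : A) {m : ℕ} {x : A} (hx : x ∈ sumSq A m) :
    a ^ 2 * x ∈ sumSq A m := by
  obtain ⟨f, rfl⟩ := hx
  exact ⟨fun i => a * f i, by simp [Finset.mul_sum, mul_pow]⟩

theorem map_mem_sumSq_s18 {G : Type*} [FunLike G A B] [RingHomClass G A B] (g : G) {m : ℕ} {x : A}
    (hx : x ∈ sumSq A m) : g x ∈ sumSq B m := by
  obtain ⟨f, rfl⟩ := hx
  exact ⟨fun i => g (f i), by simp⟩

theorem mem_sums {x : A} : x ∈ sums A ↔ ∃ m, x ∈ sumSq A m := by simp [sums]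

theorem sumSq_subset_sums (m : ℕ) : sumSq A m ⊆ sums A := fun _ hx => mem_sums.2 ⟨m, hx⟩

theorem mem_sums_iff_isSumSq {x : A} : x ∈ sums A ↔ IsSumSq x := by
  rw [mem_sums]
  constructor
  · rintro ⟨m, f, rfl⟩
    exact IsSumSq.sum fun i _ => by rw [pow_two]; exact IsSumSq.mul_self _
  · intro hx
    induction hx with
    | zero => exact ⟨0, zero_mem_sumSq 0⟩
    | sq_add a hs ih =>
      obtain ⟨m, hm⟩ := ih
      exact ⟨1 + m, add_mem_sumSq (by rw [← pow_two]; exact sq_mem_sumSq a le_rfl) hm le_rfl⟩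

theorem add_mem_sums {a b : A} (ha : a ∈ sums A) (hb : b ∈ sums A) : a + b ∈ sums A := by
  rw [mem_sums_iff_isSumSq] at *
  exact ha.add hb

theorem mul_mem_sums {a b : A} (ha : a ∈ sums A) (hb : b ∈ sums A) : a * b ∈ sums A := by
  rw [mem_sums_iff_isSumSq] at *
  exact ha.mul hb

theorem sq_mem_sums (a : A) : a ^ 2 ∈ sums A := sumSq_subset_sums 1 (sq_mem_sumSq a le_rfl)

theorem sum_mem_sums {ι : Type*} {s : Finset ι} {f : ι → A} (hf : ∀ i ∈ s, f i ∈ sums A) :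
    ∑ i ∈ s, f i ∈ sums A := by
  rw [mem_sums_iff_isSumSq]
  exact IsSumSq.sum fun i hi => mem_sums_iff_isSumSq.1 (hf i hi)

theorem zero_mem_sums : (0 : A) ∈ sums A := sumSq_subset_sums 0 (zero_mem_sumSq 0)

theorem map_mem_sums {G : Type*} [FunLike G A B] [RingHomClass G A B] (g : G) {x : A}
    (hx : x ∈ sums A) : g x ∈ sums B := by
  obtain ⟨m, hm⟩ := mem_sums.1 hx
  exact sumSq_subset_sums m (map_mem_sumSq_s18 g hm)

theorem mem_sumSq_iff_dotProduct {m : ℕ} {x : A} :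
    x ∈ sumSq A m ↔ ∃ v : Fin m → A, x = dotProduct v v := by
  simp [sumSq, dotProduct, pow_two]

theorem pyth_le_iff {m : ℕ} : pyth A ≤ (m : ℕ∞) ↔ sums A ⊆ sumSq A m := by
  constructor
  · intro h
    have hne : ((fun k : ℕ => (k : ℕ∞)) '' {k : ℕ | sums A ⊆ sumSq A k}).Nonempty := by
      by_contra hne
      rw [Set.not_nonempty_iff_eq_empty] at hne
      rw [pyth, hne, sInf_empty] at h
      simp at h
    obtain ⟨l, hl, hle⟩ := csInf_mem hne
    have : (l : ℕ∞) ≤ m := by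
      have : (l : ℕ∞) = pyth A := hle
      rw [this]; exact h
    exact hl.trans (sumSq_mono_s18 (by exact_mod_cast this))
  · intro h
    exact sInf_le ⟨m, h, rfl⟩

theorem pyth_eq_of_subset {m : ℕ} (h1 : sums A ⊆ sumSq A (m + 1)) {x : A} (hx : x ∈ sums A)
    (h2 : x ∉ sumSq A m) : pyth A = ((m + 1 : ℕ) : ℕ∞) := by
  refine le_antisymm (pyth_le_iff.2 h1) (le_sInf ?_)
  rintro _ ⟨l, hl, rfl⟩
  have : ¬ l ≤ m := fun hlm => h2 (sumSq_mono_s18 hlm (hl hx))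
  exact Nat.cast_le.2 (by omega : m + 1 ≤ l)

end Basic

section Field

variable {R : Type*} [Field R]

theorem inv_mem_sums {x : R} (hx : x ∈ sums R) : x⁻¹ ∈ sums R := by
  by_cases h0 : x = 0
  · simpa [h0] using zero_mem_sums
  · have : x⁻¹ = x * x⁻¹ ^ 2 := by field_simp
    rw [this]
    exact mul_mem_sums hx (sq_mem_sums _)

theorem div_mem_sums {x y : R} (hx : x ∈ sums R) (hy : y ∈ sums R) : x / y ∈ sums R := by
  rw [div_eq_mul_inv]
  exact mul_mem_sums hx (inv_mem_sums hy)

theorem eq_zero_of_sum_sq_eq_zero (hr : (-1 : R) ∉ sums R) {ι : Type*} {s : Finset ι} {f : ι → R}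
    (h : ∑ i ∈ s, f i ^ 2 = 0) : ∀ i ∈ s, f i = 0 := by
  classical
  intro j hj
  by_contra hne
  apply hr
  rw [← Finset.add_sum_erase _ _ hj] at h
  have : (-1 : R) = ∑ i ∈ s.erase j, (f i / f j) ^ 2 := by
    simp_rw [div_pow]
    rw [← Finset.sum_div, eq_neg_of_add_eq_zero_right h]
    field_simp
  rw [this]
  exact sum_mem_sums fun i _ => sq_mem_sums _

theorem charZero_of_real (hr : (-1 : R) ∉ sums R) : CharZero R := by
  have : IsSemireal R := by
    rw [isSemireal_iff_not_isSumSq_neg_one, ← mem_sums_iff_isSumSq]; exact hr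
  infer_instance

theorem eq_zero_of_add_eq_zero (hr : (-1 : R) ∉ sums R) {a b : R} (ha : a ∈ sums R)
    (hb : b ∈ sums R) (hab : a + b = 0) : a = 0 := by
  by_contra h0
  apply hr
  have : (-1 : R) = b / a := by
    rw [eq_div_iff h0]; linear_combination -hab
  rw [this]
  exact div_mem_sums hb ha

/-- Over a nonreal field of characteristic not two, everything is a sum of squares. -/
theorem mem_sums_of_nonreal (h2 : (2 : R) ≠ 0) (hr : (-1 : R) ∈ sums R) (x : R) : x ∈ sums R := by
  have : x = ((x + 1) / 2) ^ 2 + (-1) * ((x - 1) / 2) ^ 2 := by field_simp; ring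
  rw [this]
  exact add_mem_sums (sq_mem_sums _) (mul_mem_sums hr (sq_mem_sums _))

end Field

/-! ### Multiplicativity of sums of `2 ^ m` squares -/

section Pfister

variable {R : Type*} [Field R]

open Matrix

theorem exists_similarity (m : ℕ) {σ : R} (hσ : σ ∈ sumSq R (2 ^ m)) :
    ∃ M : Matrix (Fin (2 ^ m)) (Fin (2 ^ m)) R, Mᵀ * M = σ • 1 ∧ M * Mᵀ = σ • 1 := by
  induction m generalizing σ with
  | zero =>
    obtain ⟨f, rfl⟩ := hσ
    refine ⟨f 0 • 1, ?_⟩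
    simp [pow_two, smul_smul]
  | succ m ih =>
    by_cases h0 : σ = 0
    · exact ⟨0, by simp [h0]⟩
    have e : Fin (2 ^ m) ⊕ Fin (2 ^ m) ≃ Fin (2 ^ (m + 1)) :=
      finSumFinEquiv.trans (finCongr (by ring))
    have key : ∀ a b : R, a ∈ sumSq R (2 ^ m) → b ∈ sumSq R (2 ^ m) → a ≠ 0 → σ = a + b →
        ∃ M : Matrix (Fin (2 ^ (m + 1))) (Fin (2 ^ (m + 1))) R,
          Mᵀ * M = σ • 1 ∧ M * Mᵀ = σ • 1 := by
      intro a b ha hb ha0 hab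
      obtain ⟨A, hA1, hA2⟩ := ih ha
      obtain ⟨B, hB1, hB2⟩ := ih hb
      let M := fromBlocks A B (-(a⁻¹ • (Aᵀ * Bᵀ * A))) Aᵀ
      have hM : M * Mᵀ = σ • 1 := by
        simp only [M, fromBlocks_transpose, fromBlocks_multiply]
        rw [← fromBlocks_one, fromBlocks_smul]
        have e1 : A * (Aᵀ * Bᵀ * A)ᵀ = a • (B * A) := by
          simp only [transpose_mul, transpose_transpose]
          rw [← Matrix.mul_assoc, hA2]; simp
        have e2 : (Aᵀ * Bᵀ * A) * Aᵀ = a • (Aᵀ * Bᵀ) := by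
          rw [Matrix.mul_assoc, hA2]; simp
        have e3 : (Aᵀ * Bᵀ * A) * (Aᵀ * Bᵀ * A)ᵀ = (a ^ 2 * b) • 1 := by
          simp only [transpose_mul, transpose_transpose]
          calc Aᵀ * Bᵀ * A * (Aᵀ * (B * A)) = Aᵀ * Bᵀ * (A * Aᵀ) * (B * A) := by
                simp only [Matrix.mul_assoc]
            _ = a • (Aᵀ * (Bᵀ * B) * A) := by
                rw [hA2]; simp [Matrix.mul_assoc]
            _ = _ := by
                rw [hB1, Matrix.mul_smul, Matrix.smul_mul, Matrix.mul_one, hA1, smul_smul, smul_smul]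
                congr 1; ring
        congr 1
        · rw [hA2, hB2, hab, add_smul]
        · rw [transpose_neg, transpose_smul, Matrix.mul_neg, Matrix.mul_smul, e1, smul_smul,
            inv_mul_cancel₀ ha0]; simp
        · rw [Matrix.neg_mul, Matrix.smul_mul, e2, smul_smul, inv_mul_cancel₀ ha0]; simp
        · rw [transpose_neg, transpose_smul, neg_mul_neg, Matrix.smul_mul, Matrix.mul_smul, e3,
            transpose_transpose, hA1, hab, smul_smul, smul_smul, ← add_smul]
          congr 1
          field_simp
          ring
      have hM2 : Mᵀ * M = σ • 1 := by
        have h1 : M * (σ⁻¹ • Mᵀ) = 1 := by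
          rw [Matrix.mul_smul, hM, smul_smul, inv_mul_cancel₀ h0, one_smul]
        rw [mul_eq_one_comm] at h1
        rw [← h1, Matrix.smul_mul, smul_smul, mul_inv_cancel₀ h0, one_smul]
      refine ⟨reindex e e M, ?_, ?_⟩
      · rw [transpose_reindex, reindex_apply, reindex_apply, submatrix_mul_equiv, hM2]
        simp [submatrix_smul, submatrix_one_equiv]
      · rw [transpose_reindex, reindex_apply, reindex_apply, submatrix_mul_equiv, hM]
        simp [submatrix_smul, submatrix_one_equiv]
    obtain ⟨f, hf⟩ := hσ
    rw [← e.sum_comp, Fintype.sum_sum_type] at hf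
    have ha : ∑ i, f (e (Sum.inl i)) ^ 2 ∈ sumSq R (2 ^ m) := ⟨_, rfl⟩
    have hb : ∑ i, f (e (Sum.inr i)) ^ 2 ∈ sumSq R (2 ^ m) := ⟨_, rfl⟩
    by_cases ha0 : ∑ i, f (e (Sum.inl i)) ^ 2 = 0
    · refine key _ _ hb ha ?_ (by rw [hf, add_comm])
      rintro hb0
      exact h0 (by rw [hf, ha0, hb0, add_zero])
    · exact key _ _ ha hb ha0 hf

theorem mulVec_dotProduct_mulVec {m : ℕ} {S : Type*} [CommRing S] {M : Matrix (Fin m) (Fin m) S}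
    {σ : S} (hM : Mᵀ * M = σ • 1) (v w : Fin m → S) :
    (M *ᵥ v) ⬝ᵥ (M *ᵥ w) = σ * (v ⬝ᵥ w) := by
  rw [dotProduct_mulVec, ← mulVec_transpose, mulVec_mulVec, hM]
  simp [smul_mulVec]

theorem mul_mem_sumSq (m : ℕ) {x y : R} (hx : x ∈ sumSq R (2 ^ m)) (hy : y ∈ sumSq R (2 ^ m)) :
    x * y ∈ sumSq R (2 ^ m) := by
  obtain ⟨M, hM, -⟩ := exists_similarity m hx
  obtain ⟨v, rfl⟩ := mem_sumSq_iff_dotProduct.1 hy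
  exact mem_sumSq_iff_dotProduct.2 ⟨M *ᵥ v, (mulVec_dotProduct_mulVec hM v v).symm⟩

theorem inv_mem_sumSq {m : ℕ} {x : R} (hx : x ∈ sumSq R m) : x⁻¹ ∈ sumSq R m := by
  by_cases h0 : x = 0
  · simpa [h0] using zero_mem_sumSq m
  · have : x⁻¹ = x⁻¹ ^ 2 * x := by field_simp
    rw [this]
    exact sq_mul_mem_sumSq _ hx

theorem div_mem_sumSq (m : ℕ) {x y : R} (hx : x ∈ sumSq R (2 ^ m)) (hy : y ∈ sumSq R (2 ^ m)) :
    x / y ∈ sumSq R (2 ^ m) := by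
  rw [div_eq_mul_inv]
  exact mul_mem_sumSq m hx (inv_mem_sumSq hy)

theorem mem_sumSq_of_sq_mul {m : ℕ} {a x : R} (ha : a ≠ 0) (h : a ^ 2 * x ∈ sumSq R m) :
    x ∈ sumSq R m := by
  have := sq_mul_mem_sumSq a⁻¹ h
  rwa [← mul_assoc, ← mul_pow, inv_mul_cancel₀ ha, one_pow, one_mul] at this

theorem dotProduct_self_eq_zero_of_real (hr : (-1 : R) ∉ sums R) {ι : Type*} [Fintype ι]
    {v : ι → R} (hv : v ⬝ᵥ v = 0) : v = 0 := by
  funext i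
  refine eq_zero_of_sum_sq_eq_zero hr (s := Finset.univ) (f := v) ?_ i (Finset.mem_univ i)
  simpa [dotProduct, pow_two] using hv

/-- The ratio of the lengths of two orthogonal vectors lies in the pure part of a Pfister form. -/
theorem dotProduct_div_mem_sumSq (hr : (-1 : R) ∉ sums R) (m : ℕ) {a b : Fin (2 ^ m) → R}
    (hab : a ⬝ᵥ b = 0) (hb : b ≠ 0) : (a ⬝ᵥ a) / (b ⬝ᵥ b) ∈ sumSq R (2 ^ m - 1) := by
  have hτ0 : b ⬝ᵥ b ≠ 0 := fun h => hb (dotProduct_self_eq_zero_of_real hr h)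
  obtain ⟨M, hM, -⟩ := exists_similarity m (mem_sumSq_iff_dotProduct.2 ⟨b, rfl⟩)
  set τ := b ⬝ᵥ b with hτ
  set a' := M *ᵥ a with ha'
  set b' := M *ᵥ b with hb'
  have haa : a' ⬝ᵥ a' = τ * (a ⬝ᵥ a) := mulVec_dotProduct_mulVec hM a a
  have hbb : b' ⬝ᵥ b' = τ * τ := mulVec_dotProduct_mulVec hM b b
  have hab' : a' ⬝ᵥ b' = 0 := by rw [mulVec_dotProduct_mulVec hM, hab, mul_zero]
  have h2 : (2 : R) ≠ 0 := by
    have := charZero_of_real hr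
    exact two_ne_zero
  let z : Fin (2 ^ m) := ⟨0, by positivity⟩
  suffices H : ∃ a'' : Fin (2 ^ m) → R, a'' ⬝ᵥ a'' = a' ⬝ᵥ a' ∧ a'' z = 0 by
    obtain ⟨a'', h1, h3⟩ := H
    have h4 : (a ⬝ᵥ a) / τ = ∑ i : {i // i ≠ z}, (a'' i / τ) ^ 2 := by
      have : a ⬝ᵥ a = (a'' ⬝ᵥ a'') / τ := by rw [h1, haa]; field_simp
      rw [this, dotProduct, ← Fintype.sum_subtype_add_sum_subtype (fun i => i ≠ z)]
      have : ∑ i : {i // ¬ i ≠ z}, a'' i * a'' i = 0 := by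
        refine Finset.sum_eq_zero ?_
        rintro ⟨i, hi⟩ -
        rw [not_not] at hi
        simp [hi, h3]
      rw [this, add_zero, Finset.sum_div, Finset.sum_div]
      exact Finset.sum_congr rfl fun i _ => by field_simp
    rw [h4]
    exact sum_sq_mem_sumSq _ (by simp [Fintype.card_subtype_compl])
  set w : Fin (2 ^ m) → R := b' - τ • Pi.single z 1 with hw
  have haw : a' ⬝ᵥ w = -τ * a' z := by
    rw [hw, dotProduct_sub, hab', dotProduct_smul, dotProduct_single]; simp
  have hww : w ⬝ᵥ w = 2 * τ * (τ - b' z) := by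
    rw [hw]
    simp only [dotProduct_sub, sub_dotProduct, hbb, dotProduct_smul, smul_dotProduct,
      dotProduct_single, single_dotProduct, smul_eq_mul]
    simp; ring
  by_cases hw0 : w = 0
  · refine ⟨a', rfl, ?_⟩
    rw [hw0, dotProduct_zero] at haw
    have := mul_eq_zero.1 haw.symm
    simpa [hτ0] using this
  · have hww0 : w ⬝ᵥ w ≠ 0 := fun h => hw0 (dotProduct_self_eq_zero_of_real hr h)
    refine ⟨a' - (2 * (a' ⬝ᵥ w) / (w ⬝ᵥ w)) • w, ?_, ?_⟩
    · simp only [dotProduct_sub, sub_dotProduct, dotProduct_smul, smul_dotProduct, smul_eq_mul,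
        dotProduct_comm w a']
      field_simp
      ring
    · have hwz : w z = b' z - τ := by simp [hw]
      have h5 : τ - b' z ≠ 0 := by
        intro h
        rw [hww, h, mul_zero] at hww0
        exact hww0 rfl
      simp only [Pi.sub_apply, Pi.smul_apply, smul_eq_mul, haw, hww, hwz]
      field_simp
      ring

end Pfister

/-! ### Sums of squares of polynomials over a real field -/

section Poly

open Polynomial

variable {K : Type*} [Field K]

theorem coeff_sum_sq {ι : Type*} (s : Finset ι) (q : ι → K[X]) (d : ℕ)
    (hd : ∀ i ∈ s, (q i).natDegree ≤ d) :
    (∑ i ∈ s, q i ^ 2).coeff (2 * d) = ∑ i ∈ s, (q i).coeff d ^ 2 := by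
  rw [finsetSum_coeff]
  refine Finset.sum_congr rfl fun i hi => ?_
  rw [coeff_pow_of_natDegree_le (hd i hi)]

theorem natDegree_sum_sq (hr : (-1 : K) ∉ sums K) {ι : Type*} (s : Finset ι) (q : ι → K[X])
    (hq : ∃ i ∈ s, q i ≠ 0) :
    ∃ d, (∑ i ∈ s, q i ^ 2).natDegree = 2 * d ∧ ∑ i ∈ s, q i ^ 2 ≠ 0 ∧
      ∀ i ∈ s, (q i).natDegree ≤ d := by
  classical
  obtain ⟨i₀, hi₀, hne⟩ := hq
  set s' := s.filter fun i => q i ≠ 0 with hs'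
  have hne' : s'.Nonempty := ⟨i₀, by simp [hs', hi₀, hne]⟩
  obtain ⟨j, hj, hmax⟩ := Finset.exists_max_image s' (fun i => (q i).natDegree) hne'
  rw [hs', Finset.mem_filter] at hj
  have hle : ∀ i ∈ s, (q i).natDegree ≤ (q j).natDegree := by
    intro i hi
    by_cases h0 : q i = 0
    · simp [h0]
    · exact hmax i (by simp [hs', hi, h0])
  have hc := coeff_sum_sq s q _ hle
  have hcne : (∑ i ∈ s, q i ^ 2).coeff (2 * (q j).natDegree) ≠ 0 := by
    intro h0
    rw [hc] at h0
    have := eq_zero_of_sum_sq_eq_zero hr h0 j hj.1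
    exact hj.2 (leadingCoeff_eq_zero.1 this)
  refine ⟨(q j).natDegree, ?_, ?_, hle⟩
  · refine le_antisymm ?_ (le_natDegree_of_ne_zero hcne)
    refine natDegree_sum_le_of_forall_le _ _ fun i hi => ?_
    exact natDegree_pow_le.trans (Nat.mul_le_mul_left 2 (hle i hi))
  · intro h0
    rw [h0] at hcne
    simp at hcne

theorem poly_eq_zero_of_sum_sq_eq_zero (hr : (-1 : K) ∉ sums K) {ι : Type*} {s : Finset ι}
    {q : ι → K[X]} (h : ∑ i ∈ s, q i ^ 2 = 0) : ∀ i ∈ s, q i = 0 := by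
  by_contra! hne
  obtain ⟨-, -, h0, -⟩ := natDegree_sum_sq hr s q hne
  exact h0 h

theorem ratFunc_exists_sq_mul {x : RatFunc K} (hx : x ∈ sums (RatFunc K)) :
    ∃ w : K[X], w ≠ 0 ∧ ∃ α ∈ sums K[X],
      algebraMap K[X] (RatFunc K) w ^ 2 * x = algebraMap K[X] (RatFunc K) α := by
  rw [mem_sums_iff_isSumSq] at hx
  induction hx with
  | zero => exact ⟨1, one_ne_zero, 0, zero_mem_sums, by simp⟩
  | sq_add a hs ih =>
    obtain ⟨w, hw, α, hα, h⟩ := ih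
    refine ⟨w * a.denom, mul_ne_zero hw a.denom_ne_zero, (w * a.num) ^ 2 + a.denom ^ 2 * α,
      add_mem_sums (sq_mem_sums _) (mul_mem_sums (sq_mem_sums _) hα), ?_⟩
    have ha : algebraMap K[X] (RatFunc K) a.denom * a = algebraMap K[X] (RatFunc K) a.num := by
      have h0 : algebraMap K[X] (RatFunc K) a.denom ≠ 0 :=
        RatFunc.algebraMap_ne_zero a.denom_ne_zero
      rw [mul_comm, ← eq_div_iff h0, RatFunc.num_div_denom]
    simp only [map_add, map_mul, map_pow]
    rw [← ha, ← h]
    ring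

theorem real_ratFunc (hr : (-1 : K) ∉ sums K) : (-1 : RatFunc K) ∉ sums (RatFunc K) := by
  intro h
  obtain ⟨w, hw, α, hα, h⟩ := ratFunc_exists_sq_mul h
  obtain ⟨m, q, rfl⟩ := mem_sums.1 hα
  have h1 : w ^ 2 + ∑ i, q i ^ 2 = 0 := by
    apply RatFunc.algebraMap_injective K
    rw [map_add, ← h, map_pow, map_zero]
    ring
  have h2 : ∑ i : Option (Fin m), (i.elim w q) ^ 2 = 0 := by
    rw [Fintype.sum_option]; exact h1
  exact hw (poly_eq_zero_of_sum_sq_eq_zero hr h2 none (Finset.mem_univ _))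

theorem sums_poly_of_sums_ratFunc_C (hr : (-1 : K) ∉ sums K) {a : K} {w α : K[X]} (hw : w ≠ 0)
    (hα : α ∈ sums K[X]) (h : C a * w ^ 2 = α) : a ∈ sums K := by
  have := charZero_of_real hr
  obtain ⟨x, hx⟩ := Polynomial.exists_eval_ne_zero_of_natDegree_lt_card w hw
    ((Cardinal.natCast_lt_aleph0).trans_le (Cardinal.aleph0_le_mk K))
  have h1 : a = (evalRingHom x α) / (w.eval x) ^ 2 := by
    rw [← h]
    simp
    field_simp
  rw [h1]
  exact div_mem_sums (map_mem_sums _ hα) (sq_mem_sums _)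

section Descent

variable {p : K[X]}

theorem dvd_of_dvd_sum_sq (hp : Irreducible p) (hr : (-1 : AdjoinRoot p) ∉ sums (AdjoinRoot p))
    {ι : Type*} {s : Finset ι} {q : ι → K[X]} (h : p ∣ ∑ i ∈ s, q i ^ 2) : ∀ i ∈ s, p ∣ q i := by
  have : Fact (Irreducible p) := ⟨hp⟩
  intro i hi
  rw [← AdjoinRoot.mk_eq_zero] at h ⊢
  rw [map_sum] at h
  simp only [map_pow] at h
  exact eq_zero_of_sum_sq_eq_zero hr h i hi

theorem natDegree_lt_of_eq_mul (hp : Irreducible p) {w w' : K[X]} (hw : w ≠ 0) (h : w = p * w') :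
    w'.natDegree < w.natDegree := by
  have hw' : w' ≠ 0 := by rintro rfl; simp [h] at hw
  rw [h, natDegree_mul hp.ne_zero hw']
  have := hp.natDegree_pos
  omega

theorem neg_mem_sums_adjoinRoot (hp : Irreducible p)
    (hr : (-1 : AdjoinRoot p) ∉ sums (AdjoinRoot p)) {c f w α β : K[X]} (hpc : p ∣ c)
    (hpc2 : ¬ p ^ 2 ∣ c) (hw : w ≠ 0) (hα : α ∈ sums K[X]) (hβ : β ∈ sums K[X])
    (h : c * w ^ 2 = α + f * β) : -(AdjoinRoot.mk p f) ∈ sums (AdjoinRoot p) := by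
  have : Fact (Irreducible p) := ⟨hp⟩
  have hprime := hp.prime
  obtain ⟨m, a, rfl⟩ := mem_sums.1 hα
  obtain ⟨l, b, rfl⟩ := mem_sums.1 hβ
  clear hα hβ
  induction hd : w.natDegree using Nat.strong_induction_on generalizing w a b with
  | _ d ih =>
  have h1 : AdjoinRoot.mk p (∑ i, a i ^ 2) + AdjoinRoot.mk p f * AdjoinRoot.mk p (∑ i, b i ^ 2)
      = 0 := by
    rw [← map_mul, ← map_add, ← h, AdjoinRoot.mk_eq_zero]
    exact hpc.mul_right _
  by_cases hb : AdjoinRoot.mk p (∑ i, b i ^ 2) = 0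
  · rw [hb, mul_zero, add_zero] at h1
    rw [AdjoinRoot.mk_eq_zero] at h1 hb
    have ha' := dvd_of_dvd_sum_sq hp hr h1
    have hb' := dvd_of_dvd_sum_sq hp hr hb
    choose! a' ha' using ha'
    choose! b' hb' using hb'
    have h2 : c * w ^ 2 = p ^ 2 * (∑ i, a' i ^ 2 + f * ∑ i, b' i ^ 2) := by
      have hsa : ∑ i, a i ^ 2 = p ^ 2 * ∑ i, a' i ^ 2 := by
        rw [Finset.mul_sum]
        exact Finset.sum_congr rfl fun i hi => by rw [ha' i hi]; ring
      have hsb : ∑ i, b i ^ 2 = p ^ 2 * ∑ i, b' i ^ 2 := by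
        rw [Finset.mul_sum]
        exact Finset.sum_congr rfl fun i hi => by rw [hb' i hi]; ring
      linear_combination h + hsa + f * hsb
    have hpw : p ∣ w := by
      by_contra hpw
      exact hpc2 (hprime.pow_dvd_of_dvd_mul_right 2 (fun hh => hpw (hprime.dvd_of_dvd_pow hh))
        ⟨_, h2⟩)
    obtain ⟨w', rfl⟩ := hpw
    refine ih _ ?_ (w := w') (right_ne_zero_of_mul hw) a' b' ?_ rfl
    · rw [← hd]; exact natDegree_lt_of_eq_mul hp hw rfl
    · refine mul_left_cancel₀ (pow_ne_zero 2 hp.ne_zero) ?_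
      rw [← h2]; ring
  · have h3 : -(AdjoinRoot.mk p f) =
        AdjoinRoot.mk p (∑ i, a i ^ 2) / AdjoinRoot.mk p (∑ i, b i ^ 2) := by
      rw [eq_div_iff hb]
      linear_combination -h1
    rw [h3]
    exact div_mem_sums (map_mem_sums _ (sumSq_subset_sums _ ⟨a, rfl⟩))
      (map_mem_sums _ (sumSq_subset_sums _ ⟨b, rfl⟩))

theorem mem_sums_adjoinRoot (hp : Irreducible p)
    (hr : (-1 : AdjoinRoot p) ∉ sums (AdjoinRoot p)) {c f w α β : K[X]} (hpf : p ∣ f)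
    (hpf2 : ¬ p ^ 2 ∣ f) (hw : w ≠ 0) (hα : α ∈ sums K[X]) (hβ : β ∈ sums K[X])
    (h : c * w ^ 2 = α + f * β) : AdjoinRoot.mk p c ∈ sums (AdjoinRoot p) := by
  have : Fact (Irreducible p) := ⟨hp⟩
  have hprime := hp.prime
  obtain ⟨m, a, rfl⟩ := mem_sums.1 hα
  obtain ⟨l, b, rfl⟩ := mem_sums.1 hβ
  clear hα hβ
  induction hd : w.natDegree using Nat.strong_induction_on generalizing w a b with
  | _ d ih =>
  have h1 : AdjoinRoot.mk p c * AdjoinRoot.mk p w ^ 2 = AdjoinRoot.mk p (∑ i, a i ^ 2) := by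
    rw [← map_pow, ← map_mul, h, map_add, (AdjoinRoot.mk_eq_zero (g := f * _)).2 (hpf.mul_right _),
      add_zero]
  by_cases hpw : AdjoinRoot.mk p w = 0
  · rw [hpw, zero_pow two_ne_zero, mul_zero] at h1
    have ha' := dvd_of_dvd_sum_sq hp hr (AdjoinRoot.mk_eq_zero.1 h1.symm)
    choose! a' ha' using ha'
    rw [AdjoinRoot.mk_eq_zero] at hpw
    obtain ⟨w', rfl⟩ := hpw
    have h2 : ∑ i, a i ^ 2 = p ^ 2 * ∑ i, a' i ^ 2 := by
      rw [Finset.mul_sum]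
      exact Finset.sum_congr rfl fun i hi => by rw [ha' i hi]; ring
    have h4 : p ^ 2 ∣ f * ∑ i, b i ^ 2 := by
      refine ⟨c * w' ^ 2 - ∑ i, a' i ^ 2, ?_⟩
      linear_combination -h - h2
    have hpb : p ∣ ∑ i, b i ^ 2 := by
      by_contra hpb
      exact hpf2 (hprime.pow_dvd_of_dvd_mul_right 2 hpb h4)
    have hb' := dvd_of_dvd_sum_sq hp hr hpb
    choose! b' hb' using hb'
    have h3 : ∑ i, b i ^ 2 = p ^ 2 * ∑ i, b' i ^ 2 := by
      rw [Finset.mul_sum]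
      exact Finset.sum_congr rfl fun i hi => by rw [hb' i hi]; ring
    refine ih _ ?_ (w := w') (right_ne_zero_of_mul hw) a' b' ?_ rfl
    · rw [← hd]; exact natDegree_lt_of_eq_mul hp hw rfl
    · refine mul_left_cancel₀ (pow_ne_zero 2 hp.ne_zero) ?_
      linear_combination h + h2 + f * h3
  · have h3 : AdjoinRoot.mk p c = AdjoinRoot.mk p (∑ i, a i ^ 2) / AdjoinRoot.mk p w ^ 2 := by
      rw [eq_div_iff (pow_ne_zero 2 hpw), h1]
    rw [h3]
    exact div_mem_sums (map_mem_sums _ (sumSq_subset_sums _ ⟨a, rfl⟩)) (sq_mem_sums _)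

end Descent

theorem not_sq_dvd_of_squarefree {p c : K[X]} (hp : Irreducible p) (hc : Squarefree c) :
    ¬ p ^ 2 ∣ c := fun h => hp.not_isUnit (hc p (by rwa [← pow_two]))

theorem exists_mul_eq_one_add_sum_sq (hr : (-1 : K) ∉ sums K) {p : K[X]} (hp : Irreducible p)
    {N : ℕ} (h : (-1 : AdjoinRoot p) ∈ sumSq (AdjoinRoot p) N) :
    ∃ (q : Fin N → K[X]) (r : K[X]), 1 + ∑ i, q i ^ 2 = p * r ∧ r ≠ 0 ∧
      r.natDegree < p.natDegree := by
  obtain ⟨v, hv⟩ := h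
  choose q' hq' using fun i => AdjoinRoot.mk_surjective (g := p) (v i)
  have hq : ∀ i, AdjoinRoot.mk p (q' i % p) = v i := by
    intro i
    rw [← hq' i, AdjoinRoot.mk_eq_mk]
    refine ⟨-(q' i / p), ?_⟩
    linear_combination EuclideanDomain.div_add_mod (q' i) p
  have hdvd : p ∣ 1 + ∑ i, (q' i % p) ^ 2 := by
    rw [← AdjoinRoot.mk_eq_zero]
    simp only [map_add, map_one, map_sum, map_pow, hq]
    rw [← hv]; ring
  obtain ⟨r, hr'⟩ := hdvd
  refine ⟨fun i => q' i % p, r, hr', ?_⟩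
  have hpos := hp.natDegree_pos
  have hdeg : ∀ i, (q' i % p).natDegree ≤ p.natDegree - 1 := fun i => by
    have := natDegree_mod_lt (q' i) hpos.ne'
    omega
  have h2 : ∑ i : Option (Fin N), (i.elim 1 fun i => q' i % p) ^ 2 = p * r := by
    rw [Fintype.sum_option]; simpa using hr'
  obtain ⟨-, -, h0, -⟩ := natDegree_sum_sq hr Finset.univ
    (fun i : Option (Fin N) => i.elim (1 : K[X]) fun i => q' i % p) ⟨none, by simp, by simp⟩
  rw [h2] at h0
  have hr0 := right_ne_zero_of_mul h0
  refine ⟨hr0, ?_⟩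
  have h3 : (p * r).natDegree ≤ 2 * (p.natDegree - 1) := by
    rw [← h2]
    refine natDegree_sum_le_of_forall_le _ _ fun i _ => ?_
    refine natDegree_pow_le.trans (Nat.mul_le_mul_left 2 ?_)
    cases i with
    | none => simp
    | some i => exact hdeg i
  rw [natDegree_mul hp.ne_zero hr0] at h3
  omega

/-- Up to a sum of `2 ^ (m + 1)` squares, every polynomial is squarefree with only real prime
factors, provided that the nonreal residue fields have level at most `2 ^ m`. -/
theorem exists_real_squarefree (hr : (-1 : K) ∉ sums K) (m : ℕ)
    (hres : ∀ p : K[X], Irreducible p → (-1 : AdjoinRoot p) ∈ sums (AdjoinRoot p) →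
      (-1 : AdjoinRoot p) ∈ sumSq (AdjoinRoot p) (2 ^ m)) (c : K[X]) (hc : c ≠ 0) :
    ∃ (c' : K[X]) (d : RatFunc K), Squarefree c' ∧
      (∀ p, Irreducible p → p ∣ c' → (-1 : AdjoinRoot p) ∉ sums (AdjoinRoot p)) ∧
      d ∈ sumSq (RatFunc K) (2 ^ (m + 1)) ∧ d ≠ 0 ∧
      algebraMap K[X] (RatFunc K) c = algebraMap K[X] (RatFunc K) c' * d := by
  have h1N : 1 ≤ 2 ^ (m + 1) := Nat.one_le_two_pow
  induction hd : c.natDegree using Nat.strong_induction_on generalizing c with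
  | _ e ih =>
  by_cases hu : IsUnit c
  · refine ⟨c, 1, hu.squarefree, fun p hp hpc => absurd (isUnit_of_dvd_unit hpc hu) hp.not_isUnit,
      ?_, one_ne_zero, by simp⟩
    simpa using sq_mem_sumSq (1 : RatFunc K) h1N
  obtain ⟨p, hp, c₁, rfl⟩ := WfDvdMonoid.exists_irreducible_factor hu hc
  have hp0 := hp.ne_zero
  have hc₁ : c₁ ≠ 0 := right_ne_zero_of_mul hc
  have hpE : algebraMap K[X] (RatFunc K) p ≠ 0 := RatFunc.algebraMap_ne_zero hp0
  rw [natDegree_mul hp0 hc₁] at hd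
  by_cases hpr : (-1 : AdjoinRoot p) ∈ sums (AdjoinRoot p)
  · obtain ⟨q, r, hq, hr0, hrp⟩ := exists_mul_eq_one_add_sum_sq hr hp (hres p hp hpr)
    obtain ⟨c', d, hsf, hreal, hd1, hd0, hcd⟩ := ih (r * c₁).natDegree
      (by rw [natDegree_mul hr0 hc₁]; omega) (r * c₁) (mul_ne_zero hr0 hc₁) rfl
    have hrE : algebraMap K[X] (RatFunc K) r ≠ 0 := RatFunc.algebraMap_ne_zero hr0
    refine ⟨c', d * (algebraMap K[X] (RatFunc K) (p * r) /
      algebraMap K[X] (RatFunc K) r ^ 2), hsf, hreal, ?_, ?_, ?_⟩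
    · refine mul_mem_sumSq _ hd1 (div_mem_sumSq _ ?_ (sq_mem_sumSq _ h1N))
      rw [← hq]
      refine map_mem_sumSq_s18 _ (add_mem_sumSq (m := 1) (n := 2 ^ m) ?_ ⟨q, rfl⟩ ?_)
      · simpa using sq_mem_sumSq (1 : K[X]) le_rfl
      · have : 1 ≤ 2 ^ m := Nat.one_le_two_pow
        rw [pow_succ]; omega
    · rw [map_mul]
      positivity
    · rw [← mul_assoc, ← hcd, map_mul, map_mul, map_mul]
      field_simp
  · obtain ⟨c', d, hsf, hreal, hd1, hd0, hcd⟩ := ih c₁.natDegree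
      (by have := hp.natDegree_pos; omega) c₁ hc₁ rfl
    by_cases hpc : p ∣ c'
    · obtain ⟨c'', rfl⟩ := hpc
      refine ⟨c'', algebraMap K[X] (RatFunc K) p ^ 2 * d, hsf.of_mul_right,
        fun q hq hqc => hreal q hq (hqc.mul_left p), sq_mul_mem_sumSq _ hd1, ?_, ?_⟩
      · exact mul_ne_zero (pow_ne_zero 2 hpE) hd0
      · rw [map_mul, hcd, map_mul]; ring
    · refine ⟨p * c', d, ?_, ?_, hd1, hd0, ?_⟩
      · rw [squarefree_mul_iff]
        exact ⟨(hp.coprime_iff_not_dvd.2 hpc).isRelPrime, hp.squarefree, hsf⟩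
      · intro q hq hqc
        rcases hq.prime.dvd_or_dvd hqc with hqp | hqc'
        · have hass : Associated q p := hq.associated_of_dvd hp hqp
          intro hq1
          apply hpr
          have : AdjoinRoot q →+* AdjoinRoot p :=
            AdjoinRoot.lift (AdjoinRoot.of p) (AdjoinRoot.root p) (by
              have : AdjoinRoot.mk p q = 0 := AdjoinRoot.mk_eq_zero.2 hass.symm.dvd
              rwa [← AdjoinRoot.aeval_eq, aeval_def] at this)
          simpa using map_mem_sums this hq1
        · exact hreal q hq hqc'
      · rw [map_mul, hcd, map_mul]; ring

theorem sums_ratFunc_subset (hr : (-1 : K) ∉ sums K) (m : ℕ)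
    (hres : ∀ p : K[X], Irreducible p → (-1 : AdjoinRoot p) ∈ sums (AdjoinRoot p) →
      (-1 : AdjoinRoot p) ∈ sumSq (AdjoinRoot p) (2 ^ m))
    (hK : sums K ⊆ sumSq K (2 ^ (m + 1))) :
    sums (RatFunc K) ⊆ sumSq (RatFunc K) (2 ^ (m + 1)) := by
  intro x hx
  by_cases hx0 : x = 0
  · rw [hx0]; exact zero_mem_sumSq _
  obtain ⟨w, hw, α, -, h⟩ := ratFunc_exists_sq_mul hx
  have hwE : algebraMap K[X] (RatFunc K) w ≠ 0 := RatFunc.algebraMap_ne_zero hw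
  have hα0 : α ≠ 0 := by
    rintro rfl
    rw [map_zero] at h
    exact (mul_ne_zero (pow_ne_zero 2 hwE) hx0) h
  obtain ⟨c, d, hsf, hreal, hd, hd0, hcd⟩ := exists_real_squarefree hr m hres α hα0
  have hc : algebraMap K[X] (RatFunc K) c ∈ sums (RatFunc K) := by
    have : algebraMap K[X] (RatFunc K) c = algebraMap K[X] (RatFunc K) w ^ 2 * x / d := by
      rw [h, hcd]; field_simp
    rw [this]
    exact div_mem_sums (mul_mem_sums (sq_mem_sums _) hx) (sumSq_subset_sums _ hd)
  obtain ⟨w', hw', β, hβ, h'⟩ := ratFunc_exists_sq_mul hc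
  have h'' : c * w' ^ 2 = β := by
    apply RatFunc.algebraMap_injective K
    rw [← h', map_mul, map_pow]; ring
  have hu : IsUnit c := by
    by_contra hu
    obtain ⟨p, hp, hpc⟩ := WfDvdMonoid.exists_irreducible_factor hu hsf.ne_zero
    apply hreal p hp hpc
    have := neg_mem_sums_adjoinRoot hp (hreal p hp hpc) (f := 1) (β := 0) hpc
      (not_sq_dvd_of_squarefree hp hsf) hw' hβ zero_mem_sums (by rw [h'']; ring)
    simpa using this
  obtain ⟨a, ha, rfl⟩ := Polynomial.isUnit_iff.1 hu
  have haK := hK (sums_poly_of_sums_ratFunc_C hr hw' hβ h'')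
  have : algebraMap K[X] (RatFunc K) (C a) ∈ sumSq (RatFunc K) (2 ^ (m + 1)) :=
    map_mem_sumSq_s18 (algebraMap K[X] (RatFunc K)) (map_mem_sumSq_s18 (C : K →+* K[X]) haK)
  refine mem_sumSq_of_sq_mul hwE ?_
  rw [h, hcd]
  exact mul_mem_sumSq _ this hd

end Poly

/-! ### A Legendre type theorem for sums of `2 ^ m` squares over `K[X]` -/

section Legendre

open Polynomial Matrix

variable {K : Type*} [Field K]

theorem dvd_entries_iff {N : ℕ} {c s : K[X]} {Q : Matrix (Fin N) (Fin N) K[X]} :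
    (∀ i j, c ∣ (Qᵀ * Q) i j - (s • (1 : Matrix (Fin N) (Fin N) K[X])) i j) ↔
      (Q.map (AdjoinRoot.mk c))ᵀ * Q.map (AdjoinRoot.mk c) = (AdjoinRoot.mk c s) • 1 := by
  have h1 : (Q.map (AdjoinRoot.mk c))ᵀ * Q.map (AdjoinRoot.mk c)
      = (Qᵀ * Q).map (AdjoinRoot.mk c) := by
    rw [← transpose_map, ← Matrix.map_mul]
  have h2 : (AdjoinRoot.mk c s) • (1 : Matrix (Fin N) (Fin N) (AdjoinRoot c)) =
      (s • (1 : Matrix (Fin N) (Fin N) K[X])).map (AdjoinRoot.mk c) := by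
    ext i j
    by_cases hij : i = j <;> simp [hij]
  rw [h1, h2, ← Matrix.ext_iff]
  refine forall_congr' fun i => forall_congr' fun j => ?_
  rw [Matrix.map_apply, Matrix.map_apply, AdjoinRoot.mk_eq_mk]

/-- A squarefree modulus admits a similarity matrix as soon as each of its primes does. -/
theorem exists_similarity_mod (m : ℕ) (s c : K[X]) (hc : Squarefree c)
    (h : ∀ p, Irreducible p → p ∣ c → AdjoinRoot.mk p s ∈ sumSq (AdjoinRoot p) (2 ^ m)) :
    ∃ Q : Matrix (Fin (2 ^ m)) (Fin (2 ^ m)) K[X],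
      (Q.map (AdjoinRoot.mk c))ᵀ * Q.map (AdjoinRoot.mk c) = (AdjoinRoot.mk c s) • 1 := by
  suffices H : ∃ Q : Matrix (Fin (2 ^ m)) (Fin (2 ^ m)) K[X],
      ∀ i j, c ∣ (Qᵀ * Q) i j - (s • (1 : Matrix (Fin (2 ^ m)) (Fin (2 ^ m)) K[X])) i j by
    obtain ⟨Q, hQ⟩ := H
    exact ⟨Q, dvd_entries_iff.1 hQ⟩
  induction c using WfDvdMonoid.induction_on_irreducible with
  | zero => exact absurd hc not_squarefree_zero
  | unit u hu => exact ⟨0, fun i j => hu.dvd⟩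
  | mul a p ha0 hp ih =>
    obtain ⟨Qa, hQa⟩ := ih hc.of_mul_right fun q hq hqa => h q hq (hqa.mul_left p)
    have : Fact (Irreducible p) := ⟨hp⟩
    obtain ⟨M, hM, -⟩ := exists_similarity m (h p hp (dvd_mul_right p a))
    choose Qp' hQp' using fun i j => AdjoinRoot.mk_surjective (g := p) (M i j)
    let Qp : Matrix (Fin (2 ^ m)) (Fin (2 ^ m)) K[X] := Matrix.of Qp'
    have hQpM : Qp.map (AdjoinRoot.mk p) = M := by
      ext i j
      exact hQp' i j
    have hcop : IsCoprime p a := by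
      rw [hp.coprime_iff_not_dvd]
      intro hpa
      exact not_sq_dvd_of_squarefree hp hc (by rw [pow_two]; exact mul_dvd_mul_left p hpa)
    obtain ⟨u, v, huv⟩ := hcop
    have e1 : ((u * p) • Qa + (v * a) • Qp).map (AdjoinRoot.mk p) = M := by
      rw [← hQpM]
      ext i j
      rw [Matrix.map_apply, Matrix.map_apply, AdjoinRoot.mk_eq_mk]
      refine ⟨u * (Qa i j - Qp i j), ?_⟩
      simp only [Matrix.add_apply, Matrix.smul_apply, smul_eq_mul]
      linear_combination (Qp i j) * huv
    have e2 : ((u * p) • Qa + (v * a) • Qp).map (AdjoinRoot.mk a)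
        = Qa.map (AdjoinRoot.mk a) := by
      ext i j
      rw [Matrix.map_apply, Matrix.map_apply, AdjoinRoot.mk_eq_mk]
      refine ⟨v * (Qp i j - Qa i j), ?_⟩
      simp only [Matrix.add_apply, Matrix.smul_apply, smul_eq_mul]
      linear_combination (Qa i j) * huv
    refine ⟨(u * p) • Qa + (v * a) • Qp, fun i j => IsCoprime.mul_dvd ⟨u, v, huv⟩ ?_ ?_⟩
    · refine dvd_entries_iff.2 ?_ i j
      rw [e1, hM]
    · refine dvd_entries_iff.2 ?_ i j
      rw [e2]
      exact dvd_entries_iff.1 hQa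

theorem degree_mul_lt_of_lt {p q : K[X]} {a b n : ℕ} (hp : p.degree < a) (hq : q.degree < b)
    (h : a + b ≤ n + 1) : (p * q).degree < n := by
  by_cases hp0 : p = 0
  · simp [hp0, bot_lt_iff_ne_bot]
  by_cases hq0 : q = 0
  · simp [hq0, bot_lt_iff_ne_bot]
  rw [degree_eq_natDegree hp0] at hp
  rw [degree_eq_natDegree hq0] at hq
  rw [degree_mul, degree_eq_natDegree hp0, degree_eq_natDegree hq0]
  norm_cast at *
  omega

theorem degree_dotProduct_lt {N a n : ℕ} {v : Fin N → K[X]} (hv : ∀ i, (v i).degree < a)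
    (h : 2 * a ≤ n + 1) : (v ⬝ᵥ v).degree < n := by
  rw [← mem_degreeLT]
  refine Submodule.sum_mem _ fun i _ => ?_
  rw [mem_degreeLT]
  exact degree_mul_lt_of_lt (hv i) (hv i) (by omega)

theorem natDegree_dotProduct_self (hr : (-1 : K) ∉ sums K) {N : ℕ} {v : Fin N → K[X]}
    (hv : v ≠ 0) : v ⬝ᵥ v ≠ 0 ∧ Even (v ⬝ᵥ v).natDegree := by
  obtain ⟨i, hi⟩ := Function.ne_iff.1 hv
  obtain ⟨d, h1, h2, -⟩ := natDegree_sum_sq hr Finset.univ v ⟨i, Finset.mem_univ i, hi⟩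
  have : v ⬝ᵥ v = ∑ i, v i ^ 2 := by simp [dotProduct, pow_two]
  rw [this]
  exact ⟨h2, by rw [h1]; exact even_two_mul d⟩

theorem finrank_adjoinRoot {c : K[X]} (hc : c ≠ 0) :
    Module.finrank K (AdjoinRoot c) = c.natDegree := by
  rw [(AdjoinRoot.powerBasis hc).finrank, AdjoinRoot.powerBasis_dim]

instance finite_degreeLT (a : ℕ) : Module.Finite K (degreeLT K a) :=
  Module.Finite.equiv (degreeLTEquiv K a).symm

theorem finrank_degreeLT (a : ℕ) : Module.finrank K (degreeLT K a) = a := by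
  rw [(degreeLTEquiv K a).finrank_eq, Module.finrank_fin_fun]

/-- The map sending a pair of vectors of short polynomials `(x, z)` to `x - Q z` modulo `c`. -/
noncomputable def congruenceMap {N : ℕ} (A C : ℕ) (c : K[X]) (Q : Matrix (Fin N) (Fin N) K[X]) :
    (Fin N → degreeLT K A) × (Fin N → degreeLT K C) →ₗ[K] (Fin N → AdjoinRoot c) :=
  LinearMap.pi fun i => (AdjoinRoot.mkₐ c).toLinearMap ∘ₗ
    ((degreeLT K A).subtype ∘ₗ LinearMap.proj i ∘ₗ LinearMap.fst K _ _ -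
      ∑ j, LinearMap.mulLeft K (Q i j) ∘ₗ (degreeLT K C).subtype ∘ₗ LinearMap.proj j ∘ₗ
        LinearMap.snd K _ _)

theorem congruenceMap_apply {N : ℕ} (A C : ℕ) (c : K[X]) (Q : Matrix (Fin N) (Fin N) K[X])
    (v : (Fin N → degreeLT K A) × (Fin N → degreeLT K C)) (i : Fin N) :
    congruenceMap A C c Q v i =
      AdjoinRoot.mk c (v.1 i : K[X]) - AdjoinRoot.mk c ((Q *ᵥ fun j => (v.2 j : K[X])) i) := by
  simp [congruenceMap, mulVec, dotProduct]

/-- Counting dimensions produces short solutions of a system of congruences. -/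
theorem exists_short_solution {N A B C : ℕ} (hN : 0 < N) {c f : K[X]} (hc : c ≠ 0) (hf : f ≠ 0)
    (hABC : c.natDegree + f.natDegree < A + B + C) (Q R : Matrix (Fin N) (Fin N) K[X]) :
    ∃ x y z : Fin N → K[X], (x ≠ 0 ∨ y ≠ 0 ∨ z ≠ 0) ∧
      (∀ i, (x i).degree < A) ∧ (∀ i, (y i).degree < B) ∧ (∀ i, (z i).degree < C) ∧
      (AdjoinRoot.mk c ∘ x = AdjoinRoot.mk c ∘ (Q *ᵥ z)) ∧
      (AdjoinRoot.mk f ∘ x = AdjoinRoot.mk f ∘ (R *ᵥ y)) := by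
  let V := (Fin N → degreeLT K A) × (Fin N → degreeLT K B) × (Fin N → degreeLT K C)
  let W := (Fin N → AdjoinRoot c) × (Fin N → AdjoinRoot f)
  have : Module.Finite K (AdjoinRoot c) := (AdjoinRoot.powerBasis hc).finite
  have : Module.Finite K (AdjoinRoot f) := (AdjoinRoot.powerBasis hf).finite
  let T : V →ₗ[K] W :=
    (congruenceMap A C c Q ∘ₗ ((LinearMap.fst K _ _).prod (LinearMap.snd K _ _ ∘ₗ
      LinearMap.snd K _ _))).prod
    (congruenceMap A B f R ∘ₗ ((LinearMap.fst K _ _).prod (LinearMap.fst K _ _ ∘ₗ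
      LinearMap.snd K _ _)))
  have hlt : Module.finrank K W < Module.finrank K V := by
    simp only [V, W, Module.finrank_prod, Module.finrank_pi_fintype, finrank_degreeLT,
      finrank_adjoinRoot hc, finrank_adjoinRoot hf, Finset.sum_const, Finset.card_univ,
      Fintype.card_fin, smul_eq_mul]
    nlinarith
  obtain ⟨v, hv, hv0⟩ := Submodule.exists_mem_ne_zero_of_ne_bot
    (LinearMap.ker_ne_bot_of_finrank_lt (f := T) hlt)
  rw [LinearMap.mem_ker] at hv
  have hv1 := congrArg Prod.fst hv
  have hv2 := congrArg Prod.snd hv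
  refine ⟨fun i => v.1 i, fun i => v.2.1 i, fun i => v.2.2 i, ?_, fun i => mem_degreeLT.1 (v.1 i).2,
    fun i => mem_degreeLT.1 (v.2.1 i).2, fun i => mem_degreeLT.1 (v.2.2 i).2, ?_, ?_⟩
  · by_contra! h0
    obtain ⟨h1, h2, h3⟩ := h0
    refine hv0 (Prod.ext ?_ (Prod.ext ?_ ?_)) <;> funext i <;> apply Subtype.ext
    · exact congrFun h1 i
    · exact congrFun h2 i
    · exact congrFun h3 i
  · funext i
    have h0 : congruenceMap A C c Q (v.1, v.2.2) i = 0 := congrFun hv1 i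
    rw [congruenceMap_apply, sub_eq_zero] at h0
    exact h0
  · funext i
    have h0 : congruenceMap A B f R (v.1, v.2.1) i = 0 := congrFun hv2 i
    rw [congruenceMap_apply, sub_eq_zero] at h0
    exact h0

theorem map_dotProduct_self {S T : Type*} [CommRing S] [CommRing T] (g : S →+* T) {N : ℕ}
    (v : Fin N → S) : g (v ⬝ᵥ v) = (g ∘ v) ⬝ᵥ (g ∘ v) := by
  simp [dotProduct]

theorem map_mulVec_dotProduct {S T : Type*} [CommRing S] [CommRing T] (g : S →+* T) {N : ℕ}
    {M : Matrix (Fin N) (Fin N) S} {σ : S} (hM : (M.map g)ᵀ * M.map g = g σ • 1)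
    {v w : Fin N → S} (h : g ∘ v = g ∘ (M *ᵥ w)) : g (v ⬝ᵥ v) = g (σ * (w ⬝ᵥ w)) := by
  have h1 : g ∘ (M *ᵥ w) = (M.map g) *ᵥ (g ∘ w) := by
    funext i
    simp [mulVec, dotProduct]
  rw [map_dotProduct_self, h, h1, mulVec_dotProduct_mulVec hM, map_mul, map_dotProduct_self]

theorem legendre (hr : (-1 : K) ∉ sums K) (m : ℕ) {c f : K[X]} (hc : Squarefree c)
    (hf : Squarefree f) (hcf : IsCoprime c f) (hodd : Odd f.natDegree)
    (h1 : ∀ p, Irreducible p → p ∣ c →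
      -(AdjoinRoot.mk p f) ∈ sumSq (AdjoinRoot p) (2 ^ m))
    (h2 : ∀ p, Irreducible p → p ∣ f → AdjoinRoot.mk p c ∈ sumSq (AdjoinRoot p) (2 ^ m)) :
    ∃ α β γ : K[X], α ∈ sumSq K[X] (2 ^ m) ∧ β ∈ sumSq K[X] (2 ^ m) ∧ γ ∈ sumSq K[X] (2 ^ m) ∧
      α + f * β = c * γ ∧ γ ≠ 0 := by
  obtain ⟨Q, hQ⟩ := exists_similarity_mod m (-f) c hc (by simpa using h1)
  obtain ⟨R, hR⟩ := exists_similarity_mod m c f hf h2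
  obtain ⟨e, he⟩ := hodd
  have hc0 := hc.ne_zero
  have hf0 := hf.ne_zero
  obtain ⟨A, B, C, hABC, hA, hB, hC⟩ : ∃ A B C : ℕ, c.natDegree + f.natDegree < A + B + C ∧
      2 * A ≤ c.natDegree + f.natDegree + 1 ∧ 2 * B ≤ f.natDegree + 1 ∧
      2 * C ≤ c.natDegree + 1 := by
    rcases Nat.even_or_odd' c.natDegree with ⟨d, hd | hd⟩
    · exact ⟨d + e + 1, e + 1, d, by omega, by omega, by omega, by omega⟩
    · exact ⟨d + e + 1, e + 1, d + 1, by omega, by omega, by omega, by omega⟩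
  obtain ⟨x, y, z, hne, hx, hy, hz, hxz, hxy⟩ :=
    exists_short_solution (N := 2 ^ m) (by positivity) hc0 hf0 hABC Q R
  have hP1 : c ∣ x ⬝ᵥ x + f * (z ⬝ᵥ z) - c * (y ⬝ᵥ y) := by
    have h3 := map_mulVec_dotProduct (AdjoinRoot.mk c) hQ hxz
    rw [AdjoinRoot.mk_eq_mk] at h3
    refine dvd_sub ?_ (dvd_mul_right _ _)
    simpa using h3
  have hP2 : f ∣ x ⬝ᵥ x + f * (z ⬝ᵥ z) - c * (y ⬝ᵥ y) := by
    have h3 := map_mulVec_dotProduct (AdjoinRoot.mk f) hR hxy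
    rw [AdjoinRoot.mk_eq_mk] at h3
    have h4 := dvd_add h3 (dvd_mul_right f (z ⬝ᵥ z))
    convert h4 using 1
    ring
  have hdeg : (x ⬝ᵥ x + f * (z ⬝ᵥ z) - c * (y ⬝ᵥ y)).degree < (c * f).degree := by
    have hcd : (c * f).degree = ((c.natDegree + f.natDegree : ℕ) : WithBot ℕ) := by
      rw [degree_mul, degree_eq_natDegree hc0, degree_eq_natDegree hf0]; norm_cast
    have hfd : f.degree < ((f.natDegree + 1 : ℕ) : WithBot ℕ) :=
      lt_of_le_of_lt degree_le_natDegree (by exact_mod_cast Nat.lt_succ_self _)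
    have hcd' : c.degree < ((c.natDegree + 1 : ℕ) : WithBot ℕ) :=
      lt_of_le_of_lt degree_le_natDegree (by exact_mod_cast Nat.lt_succ_self _)
    rw [hcd, ← mem_degreeLT]
    refine Submodule.sub_mem _ (Submodule.add_mem _ ?_ ?_) ?_ <;> rw [mem_degreeLT]
    · exact degree_dotProduct_lt hx hA
    · exact degree_mul_lt_of_lt hfd
        (degree_dotProduct_lt (n := c.natDegree) hz hC) (by omega)
    · exact degree_mul_lt_of_lt hcd'
        (degree_dotProduct_lt (n := f.natDegree) hy hB) (by omega)
  have hP0 := Polynomial.eq_zero_of_dvd_of_degree_lt (hcf.mul_dvd hP1 hP2) hdeg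
  refine ⟨x ⬝ᵥ x, z ⬝ᵥ z, y ⬝ᵥ y, mem_sumSq_iff_dotProduct.2 ⟨x, rfl⟩,
    mem_sumSq_iff_dotProduct.2 ⟨z, rfl⟩, mem_sumSq_iff_dotProduct.2 ⟨y, rfl⟩,
    sub_eq_zero.1 hP0, fun hyy => ?_⟩
  have hy0 : y = 0 := by
    by_contra hy0
    exact (natDegree_dotProduct_self hr hy0).1 hyy
  rw [hyy, mul_zero, sub_zero] at hP0
  by_cases hz0 : z = 0
  · have hx0 : x = 0 := by
      by_contra hx0
      refine (natDegree_dotProduct_self hr hx0).1 ?_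
      simpa [hz0] using hP0
    simp [hx0, hy0, hz0] at hne
  · obtain ⟨hzz, hzd⟩ := natDegree_dotProduct_self hr hz0
    have hxx : x ⬝ᵥ x = -(f * (z ⬝ᵥ z)) := eq_neg_of_add_eq_zero_left hP0
    have hx0 : x ≠ 0 := by
      rintro rfl
      rw [zero_dotProduct] at hxx
      exact mul_ne_zero hf0 hzz (neg_eq_zero.1 hxx.symm)
    obtain ⟨-, hxd⟩ := natDegree_dotProduct_self hr hx0
    rw [hxx, natDegree_neg, natDegree_mul hf0 hzz, he] at hxd
    rcases hzd with ⟨a, ha⟩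
    rcases hxd with ⟨b, hb⟩
    omega

end Legendre

/-! ### Sums of squares in henselian valued fields -/

section Residue

variable {L : Type*} [Field L] {Γ : Type*} [LinearOrderedCommGroupWithZero Γ] (v : Valuation L Γ)

theorem residue_eq_zero_iff_lt {x : v.valuationSubring} :
    IsLocalRing.residue v.valuationSubring x = 0 ↔ v (x : L) < 1 := by
  rw [IsLocalRing.residue_eq_zero_iff, Valuation.mem_maximalIdeal_iff]

theorem exists_scaling {ι : Type*} [Finite ι] (x : ι → L) (hx : x ≠ 0) :
    ∃ (j : ι) (e : ι → v.valuationSubring), x j ≠ 0 ∧ e j = 1 ∧ ∀ i, x i = x j * e i := by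
  obtain ⟨i₀, hi₀⟩ := Function.ne_iff.1 hx
  have : Nonempty ι := ⟨i₀⟩
  obtain ⟨j, hj⟩ := Finite.exists_max fun i => v (x i)
  have hj0 : x j ≠ 0 := by
    intro h0
    have := hj i₀
    rw [h0, map_zero, le_zero_iff, map_eq_zero] at this
    exact hi₀ this
  refine ⟨j, fun i => ⟨x i / x j, ?_⟩, hj0, ?_, fun i => ?_⟩
  · rw [Valuation.mem_valuationSubring_iff, map_div₀]
    exact div_le_one_of_le₀ (hj i) zero_le
  · apply Subtype.ext
    simp [hj0]
  · field_simp

variable {v}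

theorem neg_one_mem_sums_residue (h : (-1 : L) ∈ sums L) :
    (-1 : IsLocalRing.ResidueField v.valuationSubring) ∈ sums _ := by
  obtain ⟨m, f, hf⟩ := mem_sums.1 h
  let x : Option (Fin m) → L := fun i => i.elim 1 f
  have hx : ∑ i, x i ^ 2 = 0 := by
    rw [Fintype.sum_option]
    simp only [x, Option.elim_none, Option.elim_some]
    rw [← hf]; ring
  obtain ⟨j, e, hj, hej, he⟩ := exists_scaling v x (fun h0 => by
    have := congrFun h0 none
    simp [x] at this)
  have h1 : ∑ i, e i ^ 2 = 0 := by
    apply Subtype.ext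
    push_cast
    refine (mul_right_injective₀ (pow_ne_zero 2 hj)) ?_
    simp only [mul_zero, Finset.mul_sum, ← mul_pow, ← he, hx]
  have h2 : ∑ i, (IsLocalRing.residue v.valuationSubring (e i)) ^ 2 = 0 := by
    have := congrArg (IsLocalRing.residue v.valuationSubring) h1
    simpa using this
  by_contra hr
  have := eq_zero_of_sum_sq_eq_zero hr h2 j (Finset.mem_univ j)
  rw [hej, map_one] at this
  exact one_ne_zero this

variable (hsq : ∀ δ, v δ < 1 → IsSquare (1 + δ))
include hsq

theorem mem_sumSq_of_residue {N : ℕ} {w : v.valuationSubring}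
    (hw : IsLocalRing.residue _ w ≠ 0) (h : IsLocalRing.residue _ w ∈ sumSq _ N) :
    (w : L) ∈ sumSq L N := by
  obtain ⟨f, hf⟩ := h
  choose e he using fun i => IsLocalRing.residue_surjective (f i)
  have h1 : IsLocalRing.residue _ (∑ i, e i ^ 2) = IsLocalRing.residue v.valuationSubring w := by
    rw [map_sum, hf]
    simp only [map_pow, he]
  set s := ∑ i, e i ^ 2 with hs
  have hs1 : v (s : L) = 1 := by
    refine le_antisymm s.2 (not_lt.1 fun hlt => hw ?_)
    rw [← h1, residue_eq_zero_iff_lt]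
    exact hlt
  have hs0 : (s : L) ≠ 0 := by
    intro h0
    rw [h0, map_zero] at hs1
    exact zero_ne_one hs1
  have h2 : v ((w : L) - s) < 1 := by
    have : IsLocalRing.residue v.valuationSubring (w - s) = 0 := by
      rw [map_sub, h1, sub_self]
    rw [residue_eq_zero_iff_lt] at this
    simpa using this
  obtain ⟨z, hz⟩ := hsq (((w : L) - s) / s) (by rwa [map_div₀, hs1, div_one])
  have h3 : (w : L) = z ^ 2 * s := by
    rw [pow_two, ← hz]
    field_simp
    ring
  rw [h3]
  refine sq_mul_mem_sumSq _ ⟨fun i => (e i : L), ?_⟩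
  rw [hs]
  push_cast
  rfl

theorem neg_one_mem_sumSq_of_residue {N : ℕ}
    (h : (-1 : IsLocalRing.ResidueField v.valuationSubring) ∈ sumSq _ N) :
    (-1 : L) ∈ sumSq L N := by
  have := mem_sumSq_of_residue hsq (w := -1) (by simp) (by simpa using h)
  simpa using this

theorem sums_subset_of_residue {N : ℕ} (hr : (-1 : L) ∉ sums L)
    (hκ : sums (IsLocalRing.ResidueField v.valuationSubring) ⊆ sumSq _ N) :
    sums L ⊆ sumSq L N := by
  rintro x hx
  obtain ⟨m, f, rfl⟩ := mem_sums.1 hx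
  by_cases hf : f = 0
  · simpa [hf] using zero_mem_sumSq N
  obtain ⟨j, e, hj, hej, he⟩ := exists_scaling v f hf
  have h1 : ∑ i, f i ^ 2 = f j ^ 2 * (∑ i, e i ^ 2 : v.valuationSubring) := by
    push_cast
    simp only [Finset.mul_sum, ← mul_pow, ← he]
  rw [h1]
  refine sq_mul_mem_sumSq _ (mem_sumSq_of_residue hsq ?_ (hκ ?_))
  · intro h0
    apply hr
    by_contra
    have hrκ : (-1 : IsLocalRing.ResidueField v.valuationSubring) ∉ sums _ := by
      intro h2
      obtain ⟨l, hl⟩ := mem_sums.1 h2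
      exact hr (sumSq_subset_sums _ (neg_one_mem_sumSq_of_residue hsq hl))
    rw [map_sum] at h0
    simp only [map_pow] at h0
    have := eq_zero_of_sum_sq_eq_zero hrκ h0 j (Finset.mem_univ j)
    rw [hej, map_one] at this
    exact one_ne_zero this
  · rw [map_sum]
    exact sum_mem_sums fun i _ => by rw [map_pow]; exact sq_mem_sums _

theorem mem_sumSq_of_nonreal {N : ℕ} (hr : (-1 : L) ∈ sums L) (h2 : v 2 = 1)
    (hκ : sums (IsLocalRing.ResidueField v.valuationSubring) ⊆ sumSq _ N) {w : L}
    (hw : v w = 1) : w ∈ sumSq L N := by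
  have h2' : (2 : IsLocalRing.ResidueField v.valuationSubring) ≠ 0 := by
    have : IsLocalRing.residue v.valuationSubring 2 ≠ 0 := by
      rw [Ne, residue_eq_zero_iff_lt, not_lt]
      exact h2.ge
    rwa [map_ofNat] at this
  refine mem_sumSq_of_residue hsq (w := ⟨w, hw.le⟩) ?_
    (hκ (mem_sums_of_nonreal h2' (neg_one_mem_sums_residue hr) _))
  rw [Ne, residue_eq_zero_iff_lt, not_lt]
  exact hw.ge

end Residue

section Spectral

open scoped NNReal

theorem isSquare_one_add_of_norm_lt {M : Type*} [NormedField M] [CompleteSpace M]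
    [IsUltrametricDist M] (h2 : ‖(2 : M)‖ = 1) {δ : M} (hδ : ‖δ‖ < 1) : IsSquare (1 + δ) := by
  have h20 : (2 : M) ≠ 0 := by
    rw [← norm_ne_zero_iff, h2]; exact one_ne_zero
  let s : Set M := Metric.closedBall 0 ‖δ‖
  let S : M → M := fun e => (δ - e ^ 2) / 2
  have hmaps : Set.MapsTo S s s := by
    intro e he
    rw [mem_closedBall_zero_iff] at he ⊢
    rw [norm_div, h2, div_one]
    rw [sub_eq_add_neg]
    refine (IsUltrametricDist.norm_add_le_max _ _).trans (max_le le_rfl ?_)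
    rw [norm_neg, norm_pow]
    nlinarith [norm_nonneg e]
  have hcontr : ContractingWith ‖δ‖₊ (hmaps.restrict S s s) := by
    refine ⟨by exact_mod_cast hδ, LipschitzWith.of_dist_le_mul ?_⟩
    rintro ⟨a, ha⟩ ⟨b, hb⟩
    rw [mem_closedBall_zero_iff] at ha hb
    rw [Subtype.dist_eq, Subtype.dist_eq, dist_eq_norm, dist_eq_norm]
    change ‖(δ - a ^ 2) / 2 - (δ - b ^ 2) / 2‖ ≤ ‖δ‖ * ‖a - b‖
    have : (δ - a ^ 2) / 2 - (δ - b ^ 2) / 2 = -((a + b) * (a - b)) / 2 := by ring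
    rw [this, norm_div, h2, div_one, norm_neg, norm_mul]
    refine mul_le_mul_of_nonneg_right ?_ (norm_nonneg _)
    exact (IsUltrametricDist.norm_add_le_max _ _).trans (max_le ha hb)
  obtain ⟨e, -, he, -⟩ := hcontr.exists_fixedPoint' Metric.isClosed_closedBall.isComplete hmaps
    (x := 0) (by simp [s]) (edist_ne_top _ _)
  refine ⟨1 + e, ?_⟩
  have he' : (δ - e ^ 2) / 2 = e := he
  rw [div_eq_iff h20] at he'
  linear_combination he'

variable (K : Type*) [NontriviallyNormedField K] [CompleteSpace K] [IsUltrametricDist K]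
variable (L : Type*) [Field L] [Algebra K L] [Algebra.IsAlgebraic K L]

/-- The spectral norm on an algebraic extension of a complete ultrametric field, as a valuation. -/
noncomputable def spectralVal : Valuation L ℝ≥0 where
  toFun x := ⟨spectralNorm K L x, spectralNorm_nonneg x⟩
  map_zero' := NNReal.eq spectralNorm_zero
  map_one' := NNReal.eq spectralNorm_one
  map_mul' x y := NNReal.eq (map_mul (spectralMulAlgNorm (K := K) (L := L)) x y)
  map_add_le_max' x y := by
    exact le_max_iff.2 ((le_max_iff.1 (isNonarchimedean_spectralNorm (K := K) (L := L) x y)).imp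
      id id)

variable {K L}

theorem coe_spectralVal (x : L) : (spectralVal K L x : ℝ) = spectralNorm K L x := rfl

theorem spectralVal_algebraMap (x : K) : spectralVal K L (algebraMap K L x) = ‖x‖₊ :=
  NNReal.eq (spectralNorm_extends x)

theorem spectralVal_algebraMap_eq_one {x : K} (hx : ‖x‖ = 1) :
    spectralVal K L (algebraMap K L x) = 1 := by
  rw [spectralVal_algebraMap]
  exact NNReal.eq hx

theorem spectralVal_algHom {L' : Type*} [Field L'] [Algebra K L'] [Algebra.IsAlgebraic K L']
    (f : L →ₐ[K] L') (x : L) : spectralVal K L' (f x) = spectralVal K L x := by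
  apply NNReal.eq
  rw [coe_spectralVal, coe_spectralVal, spectralNorm, spectralNorm,
    minpoly.algHom_eq f f.injective]

theorem isSquare_one_add_of_spectralVal_lt [FiniteDimensional K L] (h2 : ‖(2 : K)‖ = 1) {δ : L}
    (hδ : spectralVal K L δ < 1) : IsSquare (1 + δ) := by
  let _ := spectralNorm.normedField K L
  have hc : CompleteSpace L := spectralNorm.completeSpace K L
  have hu : IsUltrametricDist L :=
    IsUltrametricDist.isUltrametricDist_of_isNonarchimedean_norm
      (isNonarchimedean_spectralNorm (K := K) (L := L))
  refine isSquare_one_add_of_norm_lt (M := L) ?_ ?_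
  · change spectralNorm K L 2 = 1
    rw [← h2, ← spectralNorm_extends (L := L), map_ofNat]
  · exact_mod_cast hδ

end Spectral

/-! ### Finite extensions of a complete field with coefficient field -/

section CoefficientField

open Polynomial

variable {k : Type u} [Field k] {K : Type u} [NontriviallyNormedField K] [CompleteSpace K]
  [IsUltrametricDist K] (i : k →+* K) (hi : ∀ a, a ≠ 0 → ‖i a‖ = 1)

section Subring

variable (M : Type u) [Field M] [Algebra K M] [Algebra.IsAlgebraic K M]

include hi in
theorem spectralVal_coefficient_le (a : k) : spectralVal K M (algebraMap K M (i a)) ≤ 1 := by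
  by_cases ha : a = 0
  · simp [ha]
  · exact (spectralVal_algebraMap_eq_one (hi a ha)).le

/-- The coefficient field inside the valuation ring of an algebraic extension. -/
noncomputable def coefficientHom : k →+* (spectralVal K M).valuationSubring :=
  ((algebraMap K M).comp i).codRestrict (spectralVal K M).valuationSubring
    fun a => spectralVal_coefficient_le i hi M a

theorem coe_eval₂_coefficientHom (x : (spectralVal K M).valuationSubring) (q : k[X]) :
    ((q.eval₂ (coefficientHom i hi M) x : (spectralVal K M).valuationSubring) : M) =
      q.eval₂ ((algebraMap K M).comp i) x :=
  hom_eval₂ q (coefficientHom i hi M) (spectralVal K M).valuationSubring.subtype x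

end Subring

variable {M : Type u} [Field M] [Algebra K M] [FiniteDimensional K M]

include hi in
theorem sums_residueField_subset (hi2 : ∀ x : K, ‖x‖ ≤ 1 → ∃ a : k, ‖x - i a‖ < 1) {N : ℕ}
    (hp : ∀ (L : Type u) [Field L] [Algebra k L], FiniteDimensional k L → pyth L ≤ (N : ℕ∞)) :
    sums (IsLocalRing.ResidueField (spectralVal K M).valuationSubring) ⊆ sumSq _ N := by
  let _ : Algebra k (IsLocalRing.ResidueField (spectralVal K M).valuationSubring) :=
    ((IsLocalRing.residue _).comp (coefficientHom i hi M)).toAlgebra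
  refine pyth_le_iff.1 (hp _ ?_)
  refine Module.rank_lt_aleph0_iff.1 (lt_of_le_of_lt (rank_le (n := Module.finrank K M) ?_)
    (Cardinal.natCast_lt_aleph0))
  intro s hs
  choose e he using fun x : s => IsLocalRing.residue_surjective
    (R := (spectralVal K M).valuationSubring) x.1
  have hli : LinearIndependent K (fun x : s => (e x : M)) := by
    rw [Fintype.linearIndependent_iff]
    intro g hg
    by_contra! hne
    obtain ⟨j₀, hj₀⟩ := hne
    have : Nonempty s := ⟨j₀⟩
    obtain ⟨j, hj⟩ := Finite.exists_max fun x => ‖g x‖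
    have hj1 : 0 < ‖g j‖ := (norm_pos_iff.2 hj₀).trans_le (hj j₀)
    have ha : ∀ x, ‖g x / g j‖ ≤ 1 := fun x => by
      rw [norm_div]; exact div_le_one_of_le₀ (hj x) hj1.le
    choose b hb using fun x => hi2 _ (ha x)
    have h1 : ∑ x, (g x / g j) • (e x : M) = 0 := by
      simp only [div_eq_inv_mul, mul_smul]
      rw [← Finset.smul_sum, hg, smul_zero]
    have h2 : IsLocalRing.residue _ (∑ x, coefficientHom i hi M (b x) * e x) = 0 := by
      rw [residue_eq_zero_iff_lt]
      have h3 : ((∑ x, coefficientHom i hi M (b x) * e x :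
          (spectralVal K M).valuationSubring) : M) =
          -∑ x, algebraMap K M (g x / g j - i (b x)) * e x := by
        rw [← sub_eq_zero, sub_neg_eq_add]
        rw [AddSubmonoidClass.coe_finsetSum, ← h1, ← Finset.sum_add_distrib]
        refine Finset.sum_congr rfl fun x _ => ?_
        rw [Algebra.smul_def, map_sub, sub_mul]
        exact add_sub_cancel _ _
      rw [h3, Valuation.map_neg]
      refine Valuation.map_sum_lt _ one_ne_zero fun x _ => ?_
      rw [map_mul, spectralVal_algebraMap]
      exact mul_lt_one_of_lt_of_le (hb x) (e x).2
    have h4 : ∑ x, b x • (x : IsLocalRing.ResidueField (spectralVal K M).valuationSubring) = 0 := by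
      rw [← h2, map_sum]
      refine Finset.sum_congr rfl fun x _ => ?_
      rw [map_mul, he, Algebra.smul_def]
      rfl
    have h5 := Fintype.linearIndependent_iff.1 hs b h4 j
    have h6 := hb j
    rw [h5, map_zero, sub_zero, div_self (norm_pos_iff.1 hj1), norm_one] at h6
    exact lt_irrefl _ h6
  simpa using hli.fintype_card_le_finrank

variable (hi2 : ∀ x : K, ‖x‖ ≤ 1 → ∃ a : k, ‖x - i a‖ < 1) (h2 : (2 : k) ≠ 0) {N : ℕ}
  (hp : ∀ (L : Type u) [Field L] [Algebra k L], FiniteDimensional k L → pyth L ≤ (N : ℕ∞))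

omit [CompleteSpace K] [IsUltrametricDist K] in
include hi h2 in
theorem norm_two_eq_one : ‖(2 : K)‖ = 1 := by
  rw [← hi 2 h2, map_ofNat]

include hi hi2 h2 hp

theorem sums_subset_of_finiteDimensional (hr : (-1 : M) ∉ sums M) : sums M ⊆ sumSq M N :=
  sums_subset_of_residue
    (fun _ hδ => isSquare_one_add_of_spectralVal_lt (norm_two_eq_one i hi h2) hδ) hr
    (sums_residueField_subset i hi hi2 hp)

theorem neg_one_mem_sumSq_of_finiteDimensional (hr : (-1 : M) ∈ sums M) :
    (-1 : M) ∈ sumSq M N :=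
  neg_one_mem_sumSq_of_residue
    (fun _ hδ => isSquare_one_add_of_spectralVal_lt (norm_two_eq_one i hi h2) hδ)
    (sums_residueField_subset i hi hi2 hp (neg_one_mem_sums_residue hr))

theorem mem_sumSq_of_spectralVal_eq_one (hr : (-1 : M) ∈ sums M) {w : M}
    (hw : spectralVal K M w = 1) : w ∈ sumSq M N := by
  refine mem_sumSq_of_nonreal
    (fun _ hδ => isSquare_one_add_of_spectralVal_lt (norm_two_eq_one i hi h2) hδ) hr ?_
    (sums_residueField_subset i hi hi2 hp) hw
  rw [← map_ofNat (algebraMap K M), spectralVal_algebraMap_eq_one (norm_two_eq_one i hi h2)]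

omit [FiniteDimensional K M] hi2 h2 hp in
theorem spectralVal_le_one_of_root [Algebra.IsAlgebraic K M] {h : k[X]} (h0 : h ≠ 0) {θ : M}
    (hθ : h.eval₂ ((algebraMap K M).comp i) θ = 0) : spectralVal K M θ ≤ 1 := by
  have hintegral : IsIntegral (spectralVal K M).valuationSubring θ := by
    refine ⟨(h * C h.leadingCoeff⁻¹).map (coefficientHom i hi M),
      (monic_mul_leadingCoeff_inv h0).map _, ?_⟩
    rw [eval₂_map]
    change eval₂ ((algebraMap K M).comp i) θ _ = 0
    rw [eval₂_mul, hθ, zero_mul]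
  obtain ⟨y, rfl⟩ := IsIntegrallyClosed.isIntegral_iff.1 hintegral
  exact y.2

omit hi2 hp in
theorem spectralVal_aeval_eq_one_of_splits {c : K[X]} {x : K} (hx : ‖x‖ ≤ 1)
    (hcx : ‖c.eval x‖ = 1) (hcr : ∀ p, Irreducible p → p ∣ c → (-1 : AdjoinRoot p) ∉ sums _)
    (hc : ∀ i, ‖c.coeff i‖ ≤ 1)
    {h : k[X]} (h0 : h ≠ 0) {m : ℕ} (q : Fin m → k[X]) (hq : h ∣ 1 + ∑ j, q j ^ 2)
    (hs : (c.map (algebraMap K M)).Splits) {θ : M}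
    (hθ : h.eval₂ ((algebraMap K M).comp i) θ = 0) : spectralVal K M (aeval θ c) = 1 := by
  have hθ1 := spectralVal_le_one_of_root i hi h0 hθ
  refine le_antisymm ?_ ?_
  · rw [aeval_eq_sum_range]
    refine Valuation.map_sum_le _ fun j _ => ?_
    rw [Algebra.smul_def, map_mul, spectralVal_algebraMap, map_pow]
    exact mul_le_one' (hc j) (pow_le_one' hθ1 j)
  by_contra! hlt
  have hfac : ∀ z : M, spectralVal K M (aeval z c) =
      spectralVal K M (c.map (algebraMap K M)).leadingCoeff *
        ((c.map (algebraMap K M)).roots.map fun η => spectralVal K M (z - η)).prod := by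
    intro z
    rw [← eval_map_algebraMap, hs.eval_eq_prod_roots, map_mul, map_multiset_prod,
      Multiset.map_map]
    rfl
  have hex : ∃ η ∈ (c.map (algebraMap K M)).roots,
      spectralVal K M (θ - η) < spectralVal K M (algebraMap K M x - η) := by
    by_contra! hall
    refine hlt.not_ge ?_
    have h1 : (1 : NNReal) = spectralVal K M (aeval (algebraMap K M x) c) := by
      rw [aeval_algebraMap_apply, coe_aeval_eq_eval, spectralVal_algebraMap_eq_one hcx]
    rw [h1, hfac, hfac]
    gcongr
    exact Multiset.prod_map_le_prod_map₀ _ _ (fun _ _ => zero_le) hall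
  obtain ⟨η, hη, hlt2⟩ := hex
  have hle : spectralVal K M (algebraMap K M x - η) ≤ 1 := by
    have h1 := (spectralVal K M).map_add (algebraMap K M x - θ) (θ - η)
    rw [sub_add_sub_cancel] at h1
    have h3 := (le_max_iff.1 h1).resolve_right (not_le.2 hlt2)
    refine h3.trans (((spectralVal K M).map_sub _ _).trans (max_le ?_ hθ1))
    rw [spectralVal_algebraMap]
    exact hx
  have hlt3 := hlt2.trans_le hle
  have hη1 : spectralVal K M η ≤ 1 := by
    have := (spectralVal K M).map_sub θ (θ - η)
    rw [sub_sub_cancel] at this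
    exact this.trans (max_le hθ1 hlt3.le)
  have hres : IsLocalRing.residue _ (⟨θ, hθ1⟩ : (spectralVal K M).valuationSubring) =
      IsLocalRing.residue _ (⟨η, hη1⟩ : (spectralVal K M).valuationSubring) := by
    rw [← sub_eq_zero, ← map_sub, residue_eq_zero_iff_lt]
    exact hlt3
  have hη2 : spectralVal K M ((1 + ∑ j, q j ^ 2).eval₂ ((algebraMap K M).comp i) η) < 1 := by
    have h1 := coe_eval₂_coefficientHom i hi M ⟨η, hη1⟩ (1 + ∑ j, q j ^ 2)
    rw [← h1, ← residue_eq_zero_iff_lt, hom_eval₂, ← hres, ← hom_eval₂]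
    obtain ⟨r, hr⟩ := hq
    rw [hr, eval₂_mul]
    have h3 : eval₂ (coefficientHom i hi M) (⟨θ, hθ1⟩ : (spectralVal K M).valuationSubring) h
        = 0 := by
      apply Subtype.ext
      rw [coe_eval₂_coefficientHom]
      exact hθ
    rw [h3, zero_mul, map_zero]
  have hηi : IsIntegral K η := IsIntegral.of_finite K η
  have hirr := minpoly.irreducible hηi
  have := Fact.mk hirr
  have : FiniteDimensional K (AdjoinRoot (minpoly K η)) :=
    (AdjoinRoot.powerBasis hirr.ne_zero).finite
  have hdvd : minpoly K η ∣ c := by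
    refine minpoly.dvd K η ?_
    rw [mem_roots', IsRoot.def, eval_map_algebraMap] at hη
    exact hη.2
  let f : AdjoinRoot (minpoly K η) →ₐ[K] M :=
    AdjoinRoot.liftAlgHom _ (Algebra.ofId K M) η (by exact minpoly.aeval K η)
  have hf : f (AdjoinRoot.root _) = η := AdjoinRoot.liftAlgHom_root ..
  let A := AdjoinRoot (minpoly K η)
  let ev : k[X] →+* A := eval₂RingHom ((algebraMap K A).comp i) (AdjoinRoot.root _)
  have hev : ∀ g, f (ev g) = g.eval₂ ((algebraMap K M).comp i) η := by
    intro g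
    change f.toRingHom (eval₂ _ _ g) = _
    rw [hom_eval₂]
    congr 1
    · ext a; exact f.commutes (i a)
  have hlt4 : spectralVal K A (-ev (1 + ∑ j, q j ^ 2)) < 1 := by
    rw [Valuation.map_neg, ← spectralVal_algHom f, hev]
    exact hη2
  obtain ⟨z, hz⟩ := isSquare_one_add_of_spectralVal_lt (norm_two_eq_one i hi h2) hlt4
  have hA := hcr _ hirr hdvd
  have hsum : z ^ 2 + ∑ j, ev (q j) ^ 2 = 0 := by
    rw [pow_two, ← hz, map_add, map_one, map_sum]
    simp only [map_pow]
    ring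
  have hz0 := eq_zero_of_add_eq_zero hA (sq_mem_sums z)
    (sum_mem_sums fun j _ => sq_mem_sums (ev (q j))) hsum
  rw [← pow_two, hz0] at hz
  rw [← neg_eq_of_add_eq_zero_right hz, Valuation.map_neg, Valuation.map_one] at hlt4
  exact lt_irrefl _ hlt4

omit hi2 hp in
theorem spectralVal_aeval_eq_one {c : K[X]} {x : K} (hx : ‖x‖ ≤ 1)
    (hcx : ‖c.eval x‖ = 1) (hcr : ∀ p, Irreducible p → p ∣ c → (-1 : AdjoinRoot p) ∉ sums _)
    (hc : ∀ i, ‖c.coeff i‖ ≤ 1)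
    {h : k[X]} (h0 : h ≠ 0) {m : ℕ} (q : Fin m → k[X]) (hq : h ∣ 1 + ∑ j, q j ^ 2) {θ : M}
    (hθ : h.eval₂ ((algebraMap K M).comp i) θ = 0) : spectralVal K M (aeval θ c) = 1 := by
  let S := (c.map (algebraMap K M)).SplittingField
  have : FiniteDimensional K S := FiniteDimensional.trans K M S
  rw [← spectralVal_algHom (IsScalarTower.toAlgHom K M S), IsScalarTower.coe_toAlgHom',
    ← aeval_algebraMap_apply]
  refine spectralVal_aeval_eq_one_of_splits i hi h2 hx hcx hcr hc h0 q hq ?_ ?_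
  · rw [IsScalarTower.algebraMap_eq K M S, ← map_map]
    exact SplittingField.splits _
  · rw [IsScalarTower.algebraMap_eq K M S, RingHom.comp_assoc, ← hom_eval₂, hθ, map_zero]

theorem mk_mem_sumSq_of_coefficientField {c : K[X]} {x : K} (hx : ‖x‖ ≤ 1)
    (hcx : ‖c.eval x‖ = 1) (hcr : ∀ p, Irreducible p → p ∣ c → (-1 : AdjoinRoot p) ∉ sums _)
    (hc : ∀ i, ‖c.coeff i‖ ≤ 1)
    {h : k[X]} (h0 : h ≠ 0) (hh : (-1 : AdjoinRoot h) ∈ sums _) {p : K[X]}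
    (hpi : Irreducible p) (hph : p ∣ h.map i) :
    AdjoinRoot.mk p c ∈ sumSq (AdjoinRoot p) N := by
  obtain ⟨m, f, hf⟩ := mem_sums.1 hh
  choose q hq using fun j => AdjoinRoot.mk_surjective (f j)
  have hdvd : h ∣ 1 + ∑ j, q j ^ 2 := by
    rw [← AdjoinRoot.mk_eq_zero]
    simp only [map_add, map_one, map_sum, map_pow, hq]
    rw [← hf]; ring
  have := Fact.mk hpi
  have : FiniteDimensional K (AdjoinRoot p) :=
    (AdjoinRoot.powerBasis hpi.ne_zero).finite
  have hθ : h.eval₂ ((algebraMap K (AdjoinRoot p)).comp i)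
      (AdjoinRoot.root p) = 0 := by
    rw [← eval₂_map, ← aeval_def, AdjoinRoot.aeval_eq, AdjoinRoot.mk_eq_zero]
    exact hph
  have hnr : (-1 : AdjoinRoot p) ∈ sums _ := by
    let ev : k[X] →+* AdjoinRoot p := eval₂RingHom
      ((algebraMap K (AdjoinRoot p)).comp i) (AdjoinRoot.root p)
    have hev : ev (1 + ∑ j, q j ^ 2) = 0 := by
      obtain ⟨r, hr⟩ := hdvd
      rw [hr, map_mul]
      exact mul_eq_zero_of_left hθ _
    have : (-1 : AdjoinRoot p) = ∑ j, ev (q j) ^ 2 := by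
      rw [map_add, map_one, map_sum, add_comm] at hev
      simp only [map_pow] at hev
      exact (eq_neg_of_add_eq_zero_left hev).symm
    rw [this]
    exact sum_mem_sums fun j _ => sq_mem_sums _
  refine mem_sumSq_of_spectralVal_eq_one i hi hi2 h2 hp hnr ?_
  rw [← AdjoinRoot.aeval_eq]
  exact spectralVal_aeval_eq_one i hi h2 hx hcx hcr hc h0 q hdvd hθ

end CoefficientField

/-! ### Finite extensions of a field of Laurent series -/

section Laurent

open Polynomial

variable {k : Type u} [Field k]

/-- A rank one structure on the valuation of the field of Laurent series. -/
@[reducible]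
noncomputable def laurentRankOne :
    (Valued.v : Valuation (LaurentSeries k) (WithZero (Multiplicative ℤ))).RankOne :=
  have : (Valued.v : Valuation (LaurentSeries k) (WithZero (Multiplicative ℤ))).IsNontrivial :=
    ⟨(HahnSeries.single 1 1 : LaurentSeries k), by
      have := LaurentSeries.valuation_single_zpow k 1
      rw [this]
      simp⟩
  (Valuation.nonempty_rankOne_iff_mulArchimedean.2 inferInstance).some

/-- The field of Laurent series as a normed field. -/
@[reducible]
noncomputable def laurentNormedField : NontriviallyNormedField (LaurentSeries k) :=
  let _ := laurentRankOne (k := k)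
  Valued.toNontriviallyNormedField (LaurentSeries k) (WithZero (Multiplicative ℤ))

attribute [local instance] laurentNormedField

theorem isUltrametricDist_laurent : IsUltrametricDist (LaurentSeries k) :=
  let _ := laurentRankOne (k := k)
  Valued.instIsUltrametricDist _ _

theorem norm_le_one_iff_laurent (x : LaurentSeries k) :
    ‖x‖ ≤ 1 ↔ ∃ f : PowerSeries k, (f : LaurentSeries k) = x := by
  let _ := laurentRankOne (k := k)
  exact Valued.toNormedField.norm_le_one_iff.trans (LaurentSeries.val_le_one_iff_eq_coe k x)

theorem norm_lt_one_laurent {f : PowerSeries k} (hf : PowerSeries.constantCoeff f = 0) :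
    ‖(f : LaurentSeries k)‖ < 1 := by
  let _ := laurentRankOne (k := k)
  refine Valued.toNormedField.norm_lt_one_iff.2 ?_
  rw [← PowerSeries.X_dvd_iff] at hf
  obtain ⟨g, rfl⟩ := hf
  rw [PowerSeries.coe_mul, map_mul, PowerSeries.coe_X]
  refine mul_lt_one_of_lt_of_le ?_ ((LaurentSeries.val_le_one_iff_eq_coe k _).2 ⟨g, rfl⟩)
  rw [LaurentSeries.valuation_single_zpow k 1, ← WithZero.exp_zero, WithZero.exp_lt_exp]
  norm_num

theorem norm_eq_one_laurent {f : PowerSeries k} (hf : PowerSeries.constantCoeff f ≠ 0) :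
    ‖(f : LaurentSeries k)‖ = 1 := by
  have h1 := (norm_le_one_iff_laurent (f : LaurentSeries k)).2 ⟨f, rfl⟩
  have h2 := (norm_le_one_iff_laurent ((f⁻¹ : PowerSeries k) : LaurentSeries k)).2 ⟨f⁻¹, rfl⟩
  have h3 : (f : LaurentSeries k) * (f⁻¹ : PowerSeries k) = 1 := by
    rw [← PowerSeries.coe_mul, PowerSeries.mul_inv_cancel f hf, PowerSeries.coe_one]
  have h4 := congrArg norm h3
  rw [norm_mul, norm_one] at h4
  refine le_antisymm h1 ?_
  rw [← h4]
  exact mul_le_of_le_one_right (norm_nonneg _) h2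

theorem norm_C_laurent (a : k) (ha : a ≠ 0) : ‖(HahnSeries.C a : LaurentSeries k)‖ = 1 := by
  rw [← PowerSeries.coe_C]
  exact norm_eq_one_laurent (by simpa using ha)

theorem exists_norm_sub_C_laurent (x : LaurentSeries k) (hx : ‖x‖ ≤ 1) :
    ∃ a : k, ‖x - (HahnSeries.C a : LaurentSeries k)‖ < 1 := by
  obtain ⟨f, rfl⟩ := (norm_le_one_iff_laurent x).1 hx
  refine ⟨PowerSeries.constantCoeff f, ?_⟩
  rw [← PowerSeries.coe_C, ← PowerSeries.coe_sub]
  exact norm_lt_one_laurent (by simp)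

variable (h2 : (2 : k) ≠ 0) {N : ℕ}
  (hp : ∀ (L : Type u) [Field L] [Algebra k L], FiniteDimensional k L → pyth L ≤ (N : ℕ∞))

include h2 hp

theorem sums_laurent_subset {M : Type u} [Field M] [Algebra (LaurentSeries k) M]
    [FiniteDimensional (LaurentSeries k) M] (hr : (-1 : M) ∉ sums M) : sums M ⊆ sumSq M N :=
  have := isUltrametricDist_laurent (k := k)
  sums_subset_of_finiteDimensional _ norm_C_laurent exists_norm_sub_C_laurent h2 hp hr

theorem neg_one_mem_sumSq_laurent {M : Type u} [Field M] [Algebra (LaurentSeries k) M]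
    [FiniteDimensional (LaurentSeries k) M] (hr : (-1 : M) ∈ sums M) : (-1 : M) ∈ sumSq M N :=
  have := isUltrametricDist_laurent (k := k)
  neg_one_mem_sumSq_of_finiteDimensional _ norm_C_laurent exists_norm_sub_C_laurent h2 hp hr

theorem mk_mem_sumSq_laurent [Infinite k] {c : (PowerSeries k)[X]}
    (hc : c.map PowerSeries.constantCoeff ≠ 0)
    (hcr : ∀ p : (LaurentSeries k)[X], Irreducible p → p ∣ c.map (HahnSeries.ofPowerSeries ℤ k) →
      (-1 : AdjoinRoot p) ∉ sums _)
    {h : k[X]} (h0 : h ≠ 0) (hh : (-1 : AdjoinRoot h) ∈ sums _) {p : (LaurentSeries k)[X]}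
    (hpi : Irreducible p) (hph : p ∣ h.map HahnSeries.C) :
    AdjoinRoot.mk p (c.map (HahnSeries.ofPowerSeries ℤ k)) ∈ sumSq (AdjoinRoot p) N := by
  have := isUltrametricDist_laurent (k := k)
  obtain ⟨x, hx⟩ := exists_eval_ne_zero_of_natDegree_lt_card _ hc
    ((Cardinal.natCast_lt_aleph0).trans_le (Cardinal.infinite_iff.1 ‹_›))
  have h3 : ‖(HahnSeries.C x : LaurentSeries k)‖ ≤ 1 :=
    (norm_le_one_iff_laurent _).2 ⟨PowerSeries.C x, PowerSeries.coe_C x⟩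
  have h4 : ‖(c.map (HahnSeries.ofPowerSeries ℤ k)).eval (HahnSeries.C x)‖ = 1 := by
    rw [← PowerSeries.coe_C, eval_map_apply]
    refine norm_eq_one_laurent ?_
    rw [← eval_map_apply]
    simpa using hx
  have h5 : ∀ i, ‖(c.map (HahnSeries.ofPowerSeries ℤ k)).coeff i‖ ≤ 1 := fun i => by
    rw [coeff_map]
    exact (norm_le_one_iff_laurent _).2 ⟨_, rfl⟩
  have h6 := mk_mem_sumSq_of_coefficientField (K := LaurentSeries k) HahnSeries.C norm_C_laurent
    exists_norm_sub_C_laurent h2 hp h3 h4 hcr h5 h0 hh hpi hph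
  with_reducible_and_instances exact h6

end Laurent

/-! ### Orders of sums of squares of Laurent series -/

section Order

variable {B : Type*} [Field B]

theorem single_mul_ne_zero (m : ℤ) {g : PowerSeries B} (hg : PowerSeries.constantCoeff g ≠ 0) :
    (HahnSeries.single m 1 * (g : LaurentSeries B)) ≠ 0 := by
  refine mul_ne_zero (HahnSeries.single_ne_zero one_ne_zero) ?_
  rw [map_ne_zero_iff _ HahnSeries.ofPowerSeries_injective]
  rintro rfl
  exact hg (map_zero _)

theorem order_single_mul (m : ℤ) {g : PowerSeries B} (hg : PowerSeries.constantCoeff g ≠ 0) :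
    (HahnSeries.single m 1 * (g : LaurentSeries B)).order = m := by
  have h0 := single_mul_ne_zero m hg
  rw [HahnSeries.order_mul (left_ne_zero_of_mul h0) (right_ne_zero_of_mul h0),
    HahnSeries.order_single one_ne_zero]
  suffices h : (g : LaurentSeries B).order = 0 by rw [h, add_zero]
  apply le_antisymm
  · refine HahnSeries.order_le_of_coeff_ne_zero ?_
    have := LaurentSeries.coeff_coe_powerSeries g 0
    rw [Nat.cast_zero] at this
    rwa [this, PowerSeries.coeff_zero_eq_constantCoeff]
  · by_contra! hlt
    refine right_ne_zero_of_mul h0 (HahnSeries.coeff_order_eq_zero.1 ?_)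
    rw [PowerSeries.coeff_coe, if_pos hlt]

theorem exists_single_scaling {ι : Type*} [Finite ι] (x : ι → LaurentSeries B) (hx : x ≠ 0) :
    ∃ (m : ℤ) (j : ι) (e : ι → PowerSeries B), PowerSeries.constantCoeff (e j) ≠ 0 ∧
      ∀ i, x i = HahnSeries.single m 1 * (e i : LaurentSeries B) := by
  obtain ⟨j, e, hj, hej, he⟩ := exists_scaling
    (Valued.v : Valuation (LaurentSeries B) (WithZero (Multiplicative ℤ))) x hx
  choose f hf using fun i => (LaurentSeries.val_le_one_iff_eq_coe B (e i : LaurentSeries B)).1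
    (e i).2
  refine ⟨(x j).order, j, fun i => (x j).powerSeriesPart * f i, ?_, fun i => ?_⟩
  · have h1 : f j = 1 := by
      apply HahnSeries.ofPowerSeries_injective (Γ := ℤ)
      rw [hf, hej, map_one]
      rfl
    simp only [h1]
    rw [mul_one, ← PowerSeries.coeff_zero_eq_constantCoeff_apply,
      LaurentSeries.powerSeriesPart_coeff, Nat.cast_zero, add_zero]
    exact HahnSeries.coeff_order_eq_zero.not.2 hj
  · rw [PowerSeries.coe_mul, ← mul_assoc, LaurentSeries.single_order_mul_powerSeriesPart, hf]
    exact he i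

theorem sum_sq_single_mul {ι : Type*} (s : Finset ι) (m : ℤ) (e : ι → PowerSeries B) :
    ∑ i ∈ s, (HahnSeries.single m 1 * (e i : LaurentSeries B)) ^ 2 =
      HahnSeries.single (2 * m) 1 * ((∑ i ∈ s, e i ^ 2 : PowerSeries B) : LaurentSeries B) := by
  simp only [mul_pow, HahnSeries.single_pow, one_pow, map_sum, map_pow, Finset.mul_sum]
  simp

theorem even_order_of_mem_sumSq {M : ℕ} (hB : ∀ f : Fin M → B, ∑ i, f i ^ 2 = 0 → f = 0)
    {u : LaurentSeries B} (hu : u ∈ sumSq _ M) : Even u.order := by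
  obtain ⟨f, rfl⟩ := hu
  by_cases hf : f = 0
  · simp [hf]
  obtain ⟨m, j, e, hj, he⟩ := exists_single_scaling f hf
  simp only [he]
  rw [sum_sq_single_mul, order_single_mul]
  · exact even_two_mul m
  · rw [map_sum]
    simp only [map_pow]
    intro h0
    exact hj (congrFun (hB _ h0) j)

theorem exists_even_order_sub {m : ℕ} (f : Fin m → LaurentSeries B)
    (hf : ¬ Even (∑ i, f i ^ 2).order) :
    ∃ j, Even (∑ i, f i ^ 2 - f j ^ 2).order ∧ ∑ i, f i ^ 2 - f j ^ 2 ≠ 0 := by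
  have hf0 : f ≠ 0 := by
    rintro rfl
    simp at hf
  obtain ⟨m, j, e, hj, he⟩ := exists_single_scaling f hf0
  have h1 : PowerSeries.constantCoeff (∑ i, e i ^ 2) = 0 := by
    by_contra h0
    apply hf
    simp only [he]
    rw [sum_sq_single_mul, order_single_mul _ h0]
    exact even_two_mul m
  have h2 : ∑ i, f i ^ 2 - f j ^ 2 = HahnSeries.single (2 * m) 1 *
      ((∑ i, e i ^ 2 - e j ^ 2 : PowerSeries B) : LaurentSeries B) := by
    simp only [he]
    have := sum_sq_single_mul {j} m e
    rw [Finset.sum_singleton, Finset.sum_singleton] at this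
    rw [sum_sq_single_mul, this, PowerSeries.coe_sub, mul_sub]
  have h3 : PowerSeries.constantCoeff (∑ i, e i ^ 2 - e j ^ 2) ≠ 0 := by
    rw [map_sub, h1, zero_sub, map_pow]
    exact neg_ne_zero.2 (pow_ne_zero 2 hj)
  refine ⟨j, ?_, ?_⟩
  · rw [h2, order_single_mul _ h3]
    exact even_two_mul m
  · rw [h2]
    exact single_mul_ne_zero _ h3

theorem isSquare_one_add_laurent {B : Type u} [Field B] (h2 : (2 : B) ≠ 0) {g : PowerSeries B}
    (hg : PowerSeries.constantCoeff g = 0) : IsSquare (1 + (g : LaurentSeries B)) := by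
  let _ := laurentNormedField (k := B)
  have := isUltrametricDist_laurent (k := B)
  refine isSquare_one_add_of_norm_lt ?_ (norm_lt_one_laurent hg)
  have := norm_C_laurent (2 : B) h2
  rwa [map_ofNat] at this

end Order

/-! ### Embedding a quadratic extension of `k((t))(X)` in a field of Laurent series -/

section Embedding

open Polynomial

variable {k : Type u} [Field k] {B : Type u} [Field B]

/-- The map of Laurent series fields induced by a map of the coefficient fields. -/
noncomputable def laurentMap (j : k →+* B) : LaurentSeries k →+* LaurentSeries B :=
  IsFractionRing.lift (A := PowerSeries k)
    (g := (HahnSeries.ofPowerSeries ℤ B).comp (PowerSeries.map j))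
    (by
      rw [RingHom.coe_comp]
      exact HahnSeries.ofPowerSeries_injective.comp (PowerSeries.map_injective j j.injective))

theorem laurentMap_coe (j : k →+* B) (f : PowerSeries k) :
    laurentMap j (f : LaurentSeries k) = (PowerSeries.map j f : PowerSeries B) :=
  IsFractionRing.lift_algebraMap _ f

theorem laurentMap_single (j : k →+* B) (m : ℤ) :
    laurentMap j (HahnSeries.single m 1) = HahnSeries.single m 1 := by
  rw [RatFunc.single_zpow, map_zpow₀, ← PowerSeries.coe_X, laurentMap_coe,
    PowerSeries.map_X, PowerSeries.coe_X, ← RatFunc.single_zpow]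

theorem laurentMap_C (j : k →+* B) (a : k) :
    laurentMap j (HahnSeries.C a) = HahnSeries.C (j a) := by
  rw [← PowerSeries.coe_C, laurentMap_coe, PowerSeries.map_C, PowerSeries.coe_C]

/-- The map `k((t))[X] → B((t))` which sends `X` to a constant `ξ`. -/
noncomputable def laurentEval (j : k →+* B) (ξ : B) :
    (LaurentSeries k)[X] →+* LaurentSeries B :=
  eval₂RingHom (laurentMap j) (HahnSeries.C ξ)

theorem exists_primitive_mul {c : (LaurentSeries k)[X]} (hc : c ≠ 0) :
    ∃ (m : ℤ) (e : (PowerSeries k)[X]), e.map PowerSeries.constantCoeff ≠ 0 ∧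
      c = C (HahnSeries.single m 1) * e.map (HahnSeries.ofPowerSeries ℤ k) := by
  obtain ⟨m, j, e, hj, he⟩ := exists_single_scaling (fun i : Fin (c.natDegree + 1) => c.coeff i)
    (fun h0 => hc (leadingCoeff_eq_zero.1 (congrFun h0 (Fin.last _))))
  let e' : (PowerSeries k)[X] := ∑ i : Fin (c.natDegree + 1), monomial i (e i)
  have he' : ∀ i : Fin (c.natDegree + 1), e'.coeff i = e i := by
    intro i
    simp [e', finsetSum_coeff, coeff_monomial, Fin.val_inj]
  refine ⟨m, e', fun h0 => hj ?_, ?_⟩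
  · rw [← he', ← coeff_map, h0, coeff_zero]
  · conv_lhs => rw [c.as_sum_range, Finset.sum_range]
    simp only [e', Polynomial.map_sum, map_monomial, Finset.mul_sum, C_mul_monomial, ← he]

theorem laurentEval_primitive_mul {j : k →+* B} {ξ : B}
    (m : ℤ) (e : (PowerSeries k)[X]) :
    ∃ g : PowerSeries B, PowerSeries.constantCoeff g =
        (e.map PowerSeries.constantCoeff).eval₂ j ξ ∧
      laurentEval j ξ (C (HahnSeries.single m 1) * e.map (HahnSeries.ofPowerSeries ℤ k)) =
        HahnSeries.single m 1 * (g : LaurentSeries B) := by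
  refine ⟨e.eval₂ (PowerSeries.map j) (PowerSeries.C ξ), ?_, ?_⟩
  · rw [hom_eval₂, eval₂_map, PowerSeries.constantCoeff_C]
    congr 1
  · rw [map_mul]
    congr 1
    · change eval₂ _ _ (C _) = _
      rw [eval₂_C, laurentMap_single]
    · change eval₂ _ _ (map _ e) = _
      rw [eval₂_map, hom_eval₂, PowerSeries.coe_C]
      congr 1
      ext1 f
      exact laurentMap_coe j f

theorem laurentEval_injective {j : k →+* B} {ξ : B} (hξ : ∀ q : k[X], q.eval₂ j ξ = 0 → q = 0) :
    Function.Injective (laurentEval j ξ) := by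
  rw [injective_iff_map_eq_zero]
  intro c hc
  by_contra h0
  obtain ⟨m, e, he, rfl⟩ := exists_primitive_mul h0
  obtain ⟨g, hg, hg'⟩ := laurentEval_primitive_mul (j := j) (ξ := ξ) m e
  rw [hg'] at hc
  exact single_mul_ne_zero m (fun h => he (hξ _ (hg.symm.trans h))) hc

end Embedding

/-! ### Quadratic extensions -/

section Quadratic

variable {E L : Type*} [Field E] [Field L] [Algebra E L] {d : E} {y : L}

theorem isIntegral_of_sq_eq (hy : y ^ 2 = algebraMap E L d) : IsIntegral E y :=
  IsIntegral.of_pow two_pos (hy ▸ isIntegral_algebraMap)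

theorem exists_eq_add_mul (hy : y ^ 2 = algebraMap E L d)
    (hgen : IntermediateField.adjoin E {y} = ⊤) (u : L) :
    ∃ a b : E, u = algebraMap E L a + algebraMap E L b * y := by
  have hu : u ∈ Algebra.adjoin E {y} := by
    rw [← IntermediateField.adjoin_simple_toSubalgebra_of_isAlgebraic
      (isIntegral_of_sq_eq hy).isAlgebraic, hgen]
    trivial
  induction hu using Algebra.adjoin_induction with
  | mem x hx => exact ⟨0, 1, by simpa using hx⟩
  | algebraMap r => exact ⟨r, 0, by simp⟩
  | add x z _ _ hx hz =>
    obtain ⟨a, b, rfl⟩ := hx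
    obtain ⟨a', b', rfl⟩ := hz
    exact ⟨a + a', b + b', by simp only [map_add]; ring⟩
  | mul x z _ _ hx hz =>
    obtain ⟨a, b, rfl⟩ := hx
    obtain ⟨a', b', rfl⟩ := hz
    refine ⟨a * a' + b * b' * d, a * b' + b * a', ?_⟩
    simp only [map_add, map_mul, ← hy]
    ring

theorem eq_zero_of_add_mul_eq_zero (hy : y ^ 2 = algebraMap E L d) (hd : ¬ IsSquare d) {a b : E}
    (h : algebraMap E L a + algebraMap E L b * y = 0) : a = 0 ∧ b = 0 := by
  have hb : b = 0 := by
    by_contra hb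
    apply hd
    refine ⟨a / b, ?_⟩
    apply (algebraMap E L).injective
    have hb' : algebraMap E L b ≠ 0 := by simpa using hb
    rw [map_mul, map_div₀, ← hy]
    field_simp
    have h1 : algebraMap E L b * y = - algebraMap E L a := by linear_combination h
    rw [← mul_pow, mul_comm, h1, neg_sq]
  subst hb
  exact ⟨by simpa using h, rfl⟩

theorem sum_add_mul_sq (hy : y ^ 2 = algebraMap E L d) {ι : Type*} (s : Finset ι) (a b : ι → E) :
    ∑ i ∈ s, (algebraMap E L (a i) + algebraMap E L (b i) * y) ^ 2 =
      algebraMap E L (∑ i ∈ s, a i ^ 2 + d * ∑ i ∈ s, b i ^ 2) +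
        algebraMap E L (2 * ∑ i ∈ s, a i * b i) * y := by
  simp only [map_add, map_mul, map_sum, map_pow, ← hy, Finset.mul_sum, Finset.sum_mul,
    ← Finset.sum_add_distrib, map_ofNat]
  exact Finset.sum_congr rfl fun i _ => by ring

theorem anisotropic_of_quadratic (hr : (-1 : E) ∉ sums E) {m : ℕ} {a : E} (ha : a ∈ sums E)
    (ha' : a ∉ sumSq E (2 ^ m - 1)) (hy : y ^ 2 = algebraMap E L (-a))
    (hgen : IntermediateField.adjoin E {y} = ⊤) (f : Fin (2 ^ m) → L) (hf : ∑ i, f i ^ 2 = 0) :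
    f = 0 := by
  have := charZero_of_real hr
  have ha0 : a ≠ 0 := fun h0 => ha' (h0 ▸ zero_mem_sumSq _)
  have hsq : ¬ IsSquare (-a) := by
    rintro ⟨z, hz⟩
    refine ha0 (eq_zero_of_add_eq_zero hr ha (sq_mem_sums z) ?_)
    linear_combination -hz
  choose p q hpq using fun i => exists_eq_add_mul hy hgen (f i)
  simp only [hpq] at hf
  rw [sum_add_mul_sq hy] at hf
  obtain ⟨h1, h2⟩ := eq_zero_of_add_mul_eq_zero hy hsq hf
  have h2' : p ⬝ᵥ q = 0 := by simpa [dotProduct] using h2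
  have hq : q = 0 := by
    by_contra hq
    have h3 := dotProduct_div_mem_sumSq hr m h2' hq
    have h4 : q ⬝ᵥ q ≠ 0 := fun h0 => hq (dotProduct_self_eq_zero_of_real hr h0)
    apply ha'
    convert h3 using 1
    rw [eq_div_iff h4]
    simp only [dotProduct, ← sq]
    linear_combination -h1
  have hp : p = 0 := by
    apply dotProduct_self_eq_zero_of_real hr
    simp only [dotProduct, ← sq]
    simpa [hq] using h1
  funext i
  simp [hpq, hp, hq]

end Quadratic

section Embedding

open Polynomial

variable {k : Type u} [Field k]

theorem exists_coefficient_field {m : ℕ} (hr : (-1 : k) ∉ sums k) {h : k[X]}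
    (hsos : algebraMap k[X] (RatFunc k) h ∈ sums (RatFunc k))
    (hnot : algebraMap k[X] (RatFunc k) h ∉ sumSq (RatFunc k) (2 ^ m - 1)) :
    ∃ (B : Type u) (_ : Field B) (j : k →+* B) (ξ σ : B), σ ^ 2 = - h.eval₂ j ξ ∧
      (∀ q : k[X], q.eval₂ j ξ = 0 → q = 0) ∧
      ∀ f : Fin (2 ^ m) → B, ∑ i, f i ^ 2 = 0 → f = 0 := by
  have hr' := real_ratFunc hr
  set a := algebraMap k[X] (RatFunc k) h with ha
  have ha0 : a ≠ 0 := fun h0 => hnot (h0 ▸ zero_mem_sumSq _)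
  have hirr : Irreducible (X ^ 2 - C (-a)) := by
    refine X_pow_sub_C_irreducible_of_prime Nat.prime_two fun z hz => ?_
    refine ha0 (eq_zero_of_add_eq_zero hr' hsos (sq_mem_sums z) ?_)
    linear_combination hz
  have := Fact.mk hirr
  let B := AdjoinRoot (X ^ 2 - C (-a))
  let σ : B := AdjoinRoot.root _
  have hσ : σ ^ 2 = algebraMap (RatFunc k) B (-a) := by
    have := AdjoinRoot.eval₂_root (X ^ 2 - C (-a))
    rw [eval₂_sub, eval₂_pow, eval₂_X, eval₂_C, sub_eq_zero] at this
    exact this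
  let j : k →+* B := (algebraMap (RatFunc k) B).comp ((algebraMap k[X] (RatFunc k)).comp C)
  have hj : ∀ q : k[X], q.eval₂ j (algebraMap (RatFunc k) B (algebraMap k[X] (RatFunc k) X)) =
      algebraMap (RatFunc k) B (algebraMap k[X] (RatFunc k) q) := by
    intro q
    rw [← hom_eval₂, ← hom_eval₂, eval₂_C_X]
  refine ⟨B, inferInstance, j, algebraMap (RatFunc k) B (algebraMap k[X] (RatFunc k) X), σ, ?_, fun q hq => ?_, ?_⟩
  · rw [hj, hσ, map_neg]
  · rw [hj] at hq
    simpa using hq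
  · refine anisotropic_of_quadratic hr' hsos hnot hσ ?_
    have := AdjoinRoot.adjoinRoot_eq_top (f := X ^ 2 - C (-a))
    refine top_unique fun x _ => ?_
    exact IntermediateField.algebra_adjoin_le_adjoin _ _ (this.symm ▸ trivial : x ∈ _)

theorem exists_embedding {B : Type u} [Field B] (h2 : (2 : B) ≠ 0) {j : k →+* B} {ξ σ : B}
    {h : k[X]} (hσ : σ ^ 2 = - h.eval₂ j ξ) (hξ : ∀ q : k[X], q.eval₂ j ξ = 0 → q = 0)
    {F : Type u} [Field F] [Algebra (RatFunc (LaurentSeries k)) F] {y : F}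
    (hy : y ^ 2 = algebraMap (RatFunc (LaurentSeries k)) F
      (algebraMap (LaurentSeries k)[X] (RatFunc (LaurentSeries k))
        ((C (HahnSeries.single (1 : ℤ) (1 : k)) * X - 1) * h.map HahnSeries.C)))
    (hgen : IntermediateField.adjoin (RatFunc (LaurentSeries k)) {y} = ⊤) :
    ∃ ι : F →+* LaurentSeries B, ∀ c, ι (algebraMap (RatFunc (LaurentSeries k)) F
      (algebraMap (LaurentSeries k)[X] (RatFunc (LaurentSeries k)) c)) = laurentEval j ξ c := by
  set E := RatFunc (LaurentSeries k)
  set f : (LaurentSeries k)[X] := (C (HahnSeries.single (1 : ℤ) (1 : k)) * X - 1) * h.map HahnSeries.C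
  let φ : E →+* LaurentSeries B := IsFractionRing.lift (laurentEval_injective hξ)
  have hφ : ∀ c, φ (algebraMap _ _ c) = laurentEval j ξ c := IsFractionRing.lift_algebraMap _
  let _ : Algebra E (LaurentSeries B) := φ.toAlgebra
  obtain ⟨r, hr⟩ : IsSquare (laurentEval j ξ f) := by
    have h3 : laurentEval j ξ f =
        (1 + ((- (PowerSeries.X * PowerSeries.C ξ) : PowerSeries B) : LaurentSeries B)) *
          (HahnSeries.C σ) ^ 2 := by
      have h4 : laurentEval j ξ (h.map HahnSeries.C) = - HahnSeries.C (σ ^ 2) := by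
        change eval₂ _ _ _ = _
        rw [eval₂_map, hσ, map_neg, neg_neg, hom_eval₂]
        congr 1
        ext1 a
        exact laurentMap_C j a
      have h5 : laurentEval j ξ (C (HahnSeries.single (1 : ℤ) (1 : k)) * X - 1) =
          HahnSeries.single 1 1 * HahnSeries.C ξ - 1 := by
        change eval₂ _ _ _ = _
        rw [eval₂_sub, eval₂_mul, eval₂_C, eval₂_X, eval₂_one, laurentMap_single]
      rw [map_mul, h4, h5, map_neg, map_mul, PowerSeries.coe_X, PowerSeries.coe_C, map_pow]
      ring
    rw [h3]
    exact (isSquare_one_add_laurent h2 (by simp)).mul ⟨_, sq _⟩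
  have hs : ∀ s ∈ ({y} : Set F), IsIntegral E s ∧
      ((minpoly E s).map (algebraMap E (LaurentSeries B))).Splits := by
    rintro s rfl
    refine ⟨isIntegral_of_sq_eq hy, ?_⟩
    have h6 : minpoly E s ∣ X ^ 2 - C (algebraMap _ E f) := by
      apply minpoly.dvd
      rw [map_sub, map_pow, aeval_X, aeval_C, hy, sub_self]
    refine Splits.of_dvd ?_ ?_ (Polynomial.map_dvd _ h6)
    · have h7 : (X ^ 2 - C (algebraMap _ E f)).map (algebraMap E (LaurentSeries B)) =
          (X - C r) * (X - C (-r)) := by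
        have : algebraMap E (LaurentSeries B) (algebraMap _ E f) = r * r := (hφ f).trans hr
        rw [Polynomial.map_sub, Polynomial.map_pow, map_X, map_C, this, C_mul, C_neg]
        ring
      rw [h7]
      exact (Splits.X_sub_C _).mul (Splits.X_sub_C _)
    · exact ((monic_X_pow_sub_C _ two_ne_zero).map _).ne_zero
  obtain ⟨ψ⟩ := IntermediateField.nonempty_algHom_of_adjoin_splits hs hgen
  refine ⟨ψ, fun c => ?_⟩
  rw [← hφ]
  exact ψ.commutes _

end Embedding

/-! ### Sums of squares in quadratic extensions of rational function fields -/

section Reduction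

variable {E L : Type*} [Field E] [Field L] [Algebra E L] {d : E} {y : L}

theorem sum_sq_mul_sum_sq_sub_mem_sums (hr : (-1 : E) ∉ sums E) {ι : Type*} (s : Finset ι)
    (a b : ι → E) :
    (∑ i ∈ s, a i ^ 2) * (∑ i ∈ s, b i ^ 2) - (∑ i ∈ s, a i * b i) ^ 2 ∈ sums E := by
  by_cases hb : ∑ i ∈ s, b i ^ 2 = 0
  · have h0 := eq_zero_of_sum_sq_eq_zero hr hb
    have : ∑ i ∈ s, a i * b i = 0 := Finset.sum_eq_zero fun i hi => by rw [h0 i hi, mul_zero]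
    rw [hb, this]
    simpa using zero_mem_sums
  · have hB : ∑ i ∈ s, b i ^ 2 ∈ sums E := sum_mem_sums fun i _ => sq_mem_sums _
    have hA : ∑ i ∈ s, (a i - (∑ i ∈ s, a i * b i) / (∑ i ∈ s, b i ^ 2) * b i) ^ 2 ∈ sums E :=
      sum_mem_sums fun i _ => sq_mem_sums _
    convert mul_mem_sums hA hB using 1
    generalize hC : (∑ i ∈ s, a i * b i) / (∑ i ∈ s, b i ^ 2) = e
    rw [div_eq_iff hb] at hC
    have h1 : ∑ i ∈ s, (a i - e * b i) ^ 2 =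
        ∑ i ∈ s, a i ^ 2 - 2 * e * (∑ i ∈ s, a i * b i) + e ^ 2 * ∑ i ∈ s, b i ^ 2 := by
      simp only [Finset.mul_sum, ← Finset.sum_sub_distrib, ← Finset.sum_add_distrib]
      exact Finset.sum_congr rfl fun i _ => by ring
    rw [h1, hC]
    ring

theorem norm_mem_sums (hr : (-1 : E) ∉ sums E) {ι : Type*} (s : Finset ι) (a b : ι → E)
    (hab : 2 * ∑ i ∈ s, a i * b i ≠ 0) :
    (∑ i ∈ s, a i ^ 2 + d * ∑ i ∈ s, b i ^ 2) ^ 2 - d * (2 * ∑ i ∈ s, a i * b i) ^ 2 ∈ sums E := by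
  have h1 := sum_sq_mul_sum_sq_sub_mem_sums hr s a b
  set A := ∑ i ∈ s, a i ^ 2
  set B := ∑ i ∈ s, b i ^ 2
  set C := ∑ i ∈ s, a i * b i
  have h2 : 2 ^ 2 * (A * B - C ^ 2) ∈ sums E := mul_mem_sums (sq_mem_sums 2) h1
  have h3 : (2 * C) ^ 2 + 2 ^ 2 * (A * B - C ^ 2) ≠ 0 := fun h0 =>
    pow_ne_zero 2 hab (eq_zero_of_add_eq_zero hr (sq_mem_sums _) h2 h0)
  have h4 : (A + d * B) ^ 2 - d * (2 * C) ^ 2 =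
      ((A - d * B) ^ 2 * (2 * C) ^ 2 + (A + d * B) ^ 2 * (2 ^ 2 * (A * B - C ^ 2))) /
        ((2 * C) ^ 2 + 2 ^ 2 * (A * B - C ^ 2)) := by
    rw [eq_div_iff h3]
    ring
  rw [h4]
  exact div_mem_sums (add_mem_sums (mul_mem_sums (sq_mem_sums _) (sq_mem_sums _))
    (mul_mem_sums (sq_mem_sums _) h2)) (add_mem_sums (sq_mem_sums _) h2)

theorem exists_algebraMap_mul_mem_sumSq (hr : (-1 : E) ∉ sums E) {m : ℕ} (hm : 1 ≤ m)
    (hE : sums E ⊆ sumSq E m) (hy : y ^ 2 = algebraMap E L d) (hd : ¬ IsSquare d)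
    (hgen : IntermediateField.adjoin E {y} = ⊤) {u : L} (hu : u ∈ sums L) (hu0 : u ≠ 0) :
    ∃ c : E, c ≠ 0 ∧ algebraMap E L c ∈ sums L ∧ u * algebraMap E L c ∈ sumSq L m := by
  have := charZero_of_real hr
  suffices h : ∃ c : E, c ≠ 0 ∧ u * algebraMap E L c ∈ sumSq L m by
    obtain ⟨c, hc0, hc⟩ := h
    refine ⟨c, hc0, ?_, hc⟩
    have := div_mem_sums (sumSq_subset_sums _ hc) hu
    rwa [mul_div_cancel_left₀ _ hu0] at this
  obtain ⟨l, v, rfl⟩ := mem_sums.1 hu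
  choose p q hpq using fun i => exists_eq_add_mul hy hgen (v i)
  simp only [hpq, sum_add_mul_sq hy] at hu0 ⊢
  have hN := norm_mem_sums (d := d) hr Finset.univ p q
  set a := ∑ i, p i ^ 2 + d * ∑ i, q i ^ 2
  set b := 2 * ∑ i, p i * q i
  by_cases hb : b = 0
  · refine ⟨a, fun ha => hu0 (by simp [ha, hb]), ?_⟩
    simp only [hb, map_zero, zero_mul, add_zero, ← sq]
    exact sq_mem_sumSq _ hm
  obtain ⟨w, hw⟩ := hE (hN hb)
  have hw0 : ∃ i, w i ≠ 0 := by
    by_contra! h0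
    apply hd
    simp only [h0, ne_eq, OfNat.ofNat_ne_zero, not_false_eq_true, zero_pow,
      Finset.sum_const_zero] at hw
    refine ⟨a / b, ?_⟩
    field_simp
    linear_combination -hw
  obtain ⟨i, hi⟩ := hw0
  obtain ⟨z, hz, hz0⟩ : ∃ z, z ^ 2 = w i ^ 2 ∧ a + z ≠ 0 := by
    by_cases h0 : a + w i = 0
    · refine ⟨-w i, neg_sq _, fun h1 => hi ?_⟩
      have : 2 * w i = 0 := by linear_combination h0 - h1
      simpa using this
    · exact ⟨w i, rfl, h0⟩
  refine ⟨2 * (a + z), mul_ne_zero two_ne_zero hz0,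
    Function.update (fun i => algebraMap E L (w i))
      i (algebraMap E L a + algebraMap E L b * y + algebraMap E L z), ?_⟩
  rw [Fintype.sum_eq_add_sum_compl i]
  rw [Fintype.sum_eq_add_sum_compl i, ← hz] at hw
  have h5 : ∑ j ∈ {i}ᶜ, Function.update (fun i => algebraMap E L (w i))
      i (algebraMap E L a + algebraMap E L b * y + algebraMap E L z) j ^ 2 =
      algebraMap E L (∑ j ∈ {i}ᶜ, w j ^ 2) := by
    rw [map_sum]
    refine Finset.sum_congr rfl fun j hj => ?_
    rw [Function.update_of_ne (by simpa using hj), map_pow]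
  rw [h5, Function.update_self]
  have h6 := congrArg (algebraMap E L) hw
  simp only [map_sub, map_mul, map_add, map_pow, ← hy, map_ofNat] at h6 ⊢
  linear_combination h6

end Reduction

section RatFunc

open Polynomial

variable {K : Type*} [Field K] {L : Type*} [Field L] [Algebra (RatFunc K) L] {f : K[X]} {y : L}

theorem exists_mul_sq_eq_of_mem_sums
    (hy : y ^ 2 = algebraMap (RatFunc K) L (algebraMap K[X] (RatFunc K) f))
    (hf : ¬ IsSquare (algebraMap K[X] (RatFunc K) f))
    (hgen : IntermediateField.adjoin (RatFunc K) {y} = ⊤) {c : K[X]}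
    (hc : algebraMap (RatFunc K) L (algebraMap K[X] (RatFunc K) c) ∈ sums L) :
    ∃ w α β : K[X], w ≠ 0 ∧ α ∈ sums K[X] ∧ β ∈ sums K[X] ∧ c * w ^ 2 = α + f * β := by
  obtain ⟨l, v, hv⟩ := mem_sums.1 hc
  choose p q hpq using fun i => exists_eq_add_mul hy hgen (v i)
  simp only [hpq, sum_add_mul_sq hy] at hv
  have h1 := (eq_zero_of_add_mul_eq_zero (a := ∑ i, p i ^ 2 +
    algebraMap K[X] (RatFunc K) f * ∑ i, q i ^ 2 - algebraMap K[X] (RatFunc K) c)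
    (b := 2 * ∑ i, p i * q i) hy hf (by rw [map_sub, hv]; ring)).1
  obtain ⟨w₁, hw₁, α, hα, h2⟩ := ratFunc_exists_sq_mul
    (sumSq_subset_sums l ⟨p, rfl⟩ : ∑ i, p i ^ 2 ∈ sums (RatFunc K))
  obtain ⟨w₂, hw₂, β, hβ, h3⟩ := ratFunc_exists_sq_mul
    (sumSq_subset_sums l ⟨q, rfl⟩ : ∑ i, q i ^ 2 ∈ sums (RatFunc K))
  refine ⟨w₁ * w₂, w₂ ^ 2 * α, w₁ ^ 2 * β, mul_ne_zero hw₁ hw₂, mul_mem_sums (sq_mem_sums _) hα,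
    mul_mem_sums (sq_mem_sums _) hβ, ?_⟩
  apply RatFunc.algebraMap_injective K
  simp only [map_add, map_mul, map_pow, ← h2, ← h3]
  linear_combination -(algebraMap K[X] (RatFunc K) w₁ * algebraMap K[X] (RatFunc K) w₂) ^ 2 * h1

theorem mem_sumSq_of_representation {m : ℕ}
    (hy : y ^ 2 = algebraMap (RatFunc K) L (algebraMap K[X] (RatFunc K) f))
    {c α β γ : K[X]} (hα : α ∈ sumSq K[X] (2 ^ m)) (hβ : β ∈ sumSq K[X] (2 ^ m))
    (hγ : γ ∈ sumSq K[X] (2 ^ m)) (h : α + f * β = c * γ) (hγ0 : γ ≠ 0) :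
    algebraMap (RatFunc K) L (algebraMap K[X] (RatFunc K) c) ∈ sumSq L (2 ^ (m + 1)) := by
  have hpow : 2 ^ m + 2 ^ m = 2 ^ (m + 1) := by ring
  let ψ : K[X] →+* L := (algebraMap (RatFunc K) L).comp (algebraMap K[X] (RatFunc K))
  have hψ : ψ γ ≠ 0 := by simpa [ψ] using hγ0
  have h1 : ψ c = (ψ α + y ^ 2 * ψ β) / ψ γ := by
    rw [eq_div_iff hψ, ← map_mul, ← h, map_add, map_mul, hy]
    rfl
  change ψ c ∈ _
  rw [h1]
  exact div_mem_sumSq _ (add_mem_sumSq (map_mem_sumSq_s18 ψ hα)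
    (sq_mul_mem_sumSq y (map_mem_sumSq_s18 ψ hβ)) hpow.le)
    (sumSq_mono_s18 (Nat.pow_le_pow_right two_pos m.le_succ) (map_mem_sumSq_s18 ψ hγ))

theorem even_natDegree_of_mem_sums (hr : (-1 : K) ∉ sums K) {h : K[X]}
    (hh : algebraMap K[X] (RatFunc K) h ∈ sums (RatFunc K)) : Even h.natDegree := by
  by_cases h0 : h = 0
  · simp [h0]
  obtain ⟨w, hw, α, hα, h1⟩ := ratFunc_exists_sq_mul hh
  have h2 : w ^ 2 * h = α := by
    apply RatFunc.algebraMap_injective K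
    rw [← h1, map_mul, map_pow]
  obtain ⟨m, q, rfl⟩ := mem_sums.1 hα
  have hq : ∃ i ∈ Finset.univ, q i ≠ 0 := by
    by_contra! hq
    apply mul_ne_zero (pow_ne_zero 2 hw) h0
    rw [h2]
    exact Finset.sum_eq_zero fun i hi => by rw [hq i hi]; simp
  obtain ⟨d, hd, -, -⟩ := natDegree_sum_sq hr Finset.univ q hq
  rw [← h2, natDegree_mul (pow_ne_zero 2 hw) h0, natDegree_pow] at hd
  exact ⟨d - w.natDegree, by omega⟩

theorem neg_one_mem_sums_adjoinRoot {h : K[X]} (hirr : Irreducible h)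
    (hh : algebraMap K[X] (RatFunc K) h ∈ sums (RatFunc K)) :
    (-1 : AdjoinRoot h) ∈ sums (AdjoinRoot h) := by
  by_contra hr
  obtain ⟨w, hw, α, hα, h1⟩ := ratFunc_exists_sq_mul hh
  have h2 : h * w ^ 2 = α + 1 * 0 := by
    apply RatFunc.algebraMap_injective K
    rw [mul_zero, add_zero, ← h1, map_mul, map_pow, mul_comm]
  have := neg_mem_sums_adjoinRoot hirr hr dvd_rfl
    (not_sq_dvd_of_squarefree hirr hirr.squarefree) hw hα zero_mem_sums h2
  rw [map_one] at this
  exact hr this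

theorem exists_ringHom_adjoinRoot_of_dvd {p q : K[X]} (h : p ∣ q) :
    Nonempty (AdjoinRoot q →+* AdjoinRoot p) :=
  ⟨AdjoinRoot.lift (AdjoinRoot.of p) (AdjoinRoot.root p) (by
    obtain ⟨r, rfl⟩ := h
    rw [eval₂_mul, AdjoinRoot.eval₂_root, zero_mul])⟩

theorem not_isSquare_of_odd_natDegree (hodd : Odd f.natDegree) :
    ¬ IsSquare (algebraMap K[X] (RatFunc K) f) := by
  rintro ⟨r, hr⟩
  have hf : f ≠ 0 := by
    rintro rfl
    simp at hodd
  have hr0 : r ≠ 0 := by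
    rintro rfl
    exact hf (by simpa using hr)
  have h1 := congrArg RatFunc.intDegree hr
  rw [RatFunc.intDegree_polynomial, RatFunc.intDegree_mul hr0 hr0] at h1
  obtain ⟨l, hl⟩ := hodd
  omega

end RatFunc

/-! ### The polynomial `(tX - 1) h` -/

section Discriminant

open Polynomial

variable {k : Type u} [Field k]

theorem real_laurent (hr : (-1 : k) ∉ sums k) : (-1 : LaurentSeries k) ∉ sums (LaurentSeries k) := by
  intro h
  obtain ⟨m, f, hf⟩ := mem_sums.1 h
  have h1 : ∑ i : Option (Fin m), (i.elim 1 f) ^ 2 = (0 : LaurentSeries k) := by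
    rw [Fintype.sum_option]
    simp only [Option.elim_none, Option.elim_some, ← hf]
    ring
  obtain ⟨l, j, e, hj, he⟩ := exists_single_scaling (fun i : Option (Fin m) => i.elim 1 f)
    (fun h0 => one_ne_zero (congrFun h0 none))
  simp only [he] at h1
  rw [sum_sq_single_mul] at h1
  refine single_mul_ne_zero (2 * l) (fun h0 => hj ?_) h1
  rw [map_sum] at h0
  simp only [map_pow] at h0
  exact eq_zero_of_sum_sq_eq_zero hr h0 j (Finset.mem_univ _)

variable (k) in
/-- The polynomial `tX - 1` over `k((t))`. -/
noncomputable def tXSubOne : (LaurentSeries k)[X] := C (HahnSeries.single (1 : ℤ) (1 : k)) * X - 1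

theorem natDegree_tXSubOne : (tXSubOne k).natDegree = 1 := by
  rw [tXSubOne, ← C_1, sub_eq_add_neg, ← C_neg]
  exact natDegree_linear (HahnSeries.single_ne_zero one_ne_zero)

theorem irreducible_tXSubOne : Irreducible (tXSubOne k) := by
  refine irreducible_of_degree_eq_one ?_
  exact (degree_eq_iff_natDegree_eq_of_pos one_pos).2 natDegree_tXSubOne

theorem real_adjoinRoot_of_dvd_tXSubOne (hr : (-1 : k) ∉ sums k) {p : (LaurentSeries k)[X]}
    (hp : Irreducible p) (h : p ∣ tXSubOne k) : (-1 : AdjoinRoot p) ∉ sums (AdjoinRoot p) := by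
  obtain ⟨ψ⟩ := exists_ringHom_adjoinRoot_of_dvd
    (hp.associated_of_dvd irreducible_tXSubOne h).symm.dvd
  have h1 : (tXSubOne k).eval₂ (RingHom.id _) (HahnSeries.single (-1 : ℤ) (1 : k)) = 0 := by
    simp [tXSubOne]
  intro h2
  have h3 := map_mem_sums ((AdjoinRoot.lift _ _ h1).comp ψ) h2
  rw [map_neg, map_one] at h3
  exact real_laurent hr h3

theorem nonreal_adjoinRoot_of_dvd_map {h : k[X]} (hh : (-1 : AdjoinRoot h) ∈ sums (AdjoinRoot h))
    {p : (LaurentSeries k)[X]} (hp : p ∣ h.map HahnSeries.C) :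
    (-1 : AdjoinRoot p) ∈ sums (AdjoinRoot p) := by
  obtain ⟨ψ⟩ := exists_ringHom_adjoinRoot_of_dvd hp
  have h1 : h.eval₂ ((AdjoinRoot.of (h.map (HahnSeries.C : k →+* LaurentSeries k))).comp
      HahnSeries.C) (AdjoinRoot.root _) = 0 := by
    rw [← eval₂_map, AdjoinRoot.eval₂_root]
  have h2 := map_mem_sums (ψ.comp (AdjoinRoot.lift _ _ h1)) hh
  rwa [map_neg, map_one] at h2

theorem isCoprime_of_real_of_nonreal {K : Type*} [Field K] {c f : K[X]} (hc0 : c ≠ 0)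
    (hc : ∀ p, Irreducible p → p ∣ c → (-1 : AdjoinRoot p) ∉ sums (AdjoinRoot p))
    (hf : ∀ p, Irreducible p → p ∣ f → (-1 : AdjoinRoot p) ∈ sums (AdjoinRoot p)) :
    IsCoprime c f :=
  isCoprime_of_irreducible_dvd (fun h => hc0 h.1) fun p hp hpc hpf => hc p hp hpc (hf p hp hpf)

theorem squarefree_map_laurent (hr : (-1 : k) ∉ sums k) {h : k[X]} (hirr : Irreducible h) :
    Squarefree (h.map (HahnSeries.C : k →+* LaurentSeries k)) := by
  have := charZero_of_real hr
  exact (hirr.separable.map).squarefree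

theorem isCoprime_tXSubOne_map (hr : (-1 : k) ∉ sums k) {h : k[X]}
    (hh : (-1 : AdjoinRoot h) ∈ sums (AdjoinRoot h)) :
    IsCoprime (tXSubOne k) (h.map HahnSeries.C) :=
  isCoprime_of_real_of_nonreal irreducible_tXSubOne.ne_zero
    (fun _ => real_adjoinRoot_of_dvd_tXSubOne hr) fun _ _ => nonreal_adjoinRoot_of_dvd_map hh

theorem squarefree_tXSubOne_mul (hr : (-1 : k) ∉ sums k) {h : k[X]} (hirr : Irreducible h)
    (hh : (-1 : AdjoinRoot h) ∈ sums (AdjoinRoot h)) :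
    Squarefree (tXSubOne k * h.map HahnSeries.C) :=
  (squarefree_mul_iff.2 ⟨(isCoprime_tXSubOne_map hr hh).isRelPrime,
    irreducible_tXSubOne.squarefree, squarefree_map_laurent hr hirr⟩)

theorem odd_natDegree_tXSubOne_mul {h : k[X]} (h0 : h ≠ 0) (he : Even h.natDegree) :
    Odd (tXSubOne k * h.map HahnSeries.C).natDegree := by
  rw [natDegree_mul irreducible_tXSubOne.ne_zero
    ((Polynomial.map_ne_zero_iff HahnSeries.C_injective).2 h0), natDegree_tXSubOne, natDegree_map]
  exact he.one_add

end Discriminant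

/-! ### Sums of squares in `k((t))(X)(√((tX - 1) h))` -/

section Main

open Polynomial

variable {k : Type u} [Field k] (hreal : (-1 : k) ∉ sums k) {n : ℕ}
  (hp : ∀ (L : Type u) [Field L] [Algebra k L],
    FiniteDimensional k L → pyth L ≤ ((2 ^ n : ℕ) : ℕ∞))
  {h : k[X]}

include hreal hp

theorem sums_adjoinRoot_laurent_subset {p : (LaurentSeries k)[X]} (hpi : Irreducible p)
    (hr : (-1 : AdjoinRoot p) ∉ sums (AdjoinRoot p)) :
    sums (AdjoinRoot p) ⊆ sumSq (AdjoinRoot p) (2 ^ n) := by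
  have := charZero_of_real hreal
  have := Fact.mk hpi
  have := (AdjoinRoot.powerBasis hpi.ne_zero).finite
  have h6 := sums_laurent_subset two_ne_zero hp (M := AdjoinRoot p) hr
  with_reducible_and_instances exact h6

theorem neg_one_mem_sumSq_adjoinRoot_laurent {p : (LaurentSeries k)[X]} (hpi : Irreducible p)
    (hr : (-1 : AdjoinRoot p) ∈ sums (AdjoinRoot p)) :
    (-1 : AdjoinRoot p) ∈ sumSq (AdjoinRoot p) (2 ^ n) := by
  have := charZero_of_real hreal
  have := Fact.mk hpi
  have := (AdjoinRoot.powerBasis hpi.ne_zero).finite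
  have h6 := neg_one_mem_sumSq_laurent two_ne_zero hp (M := AdjoinRoot p) hr
  with_reducible_and_instances exact h6

theorem sums_ratFunc_laurent_subset :
    sums (RatFunc (LaurentSeries k)) ⊆ sumSq (RatFunc (LaurentSeries k)) (2 ^ (n + 1)) := by
  have := charZero_of_real hreal
  exact sums_ratFunc_subset (real_laurent hreal) n
    (fun p hpi hr => neg_one_mem_sumSq_adjoinRoot_laurent hreal hp hpi hr)
    ((sums_laurent_subset two_ne_zero hp (real_laurent hreal)).trans
      (sumSq_mono_s18 (Nat.pow_le_pow_right two_pos n.le_succ)))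

theorem mk_mem_sumSq_of_even_order {B : Type u} [Field B] {j : k →+* B} {ξ : B}
    (hξ : ∀ q : k[X], q.eval₂ j ξ = 0 → q = 0) {c : (LaurentSeries k)[X]} (hc : c ≠ 0)
    (hcr : ∀ p, Irreducible p → p ∣ c → (-1 : AdjoinRoot p) ∉ sums (AdjoinRoot p))
    (heven : Even (laurentEval j ξ c).order) (h0 : h ≠ 0)
    (hh : (-1 : AdjoinRoot h) ∈ sums (AdjoinRoot h)) {p : (LaurentSeries k)[X]}
    (hpi : Irreducible p) (hph : p ∣ h.map HahnSeries.C) :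
    AdjoinRoot.mk p c ∈ sumSq (AdjoinRoot p) (2 ^ n) := by
  have := charZero_of_real hreal
  obtain ⟨m, e, he, rfl⟩ := exists_primitive_mul hc
  obtain ⟨g, hg, hg'⟩ := laurentEval_primitive_mul (j := j) (ξ := ξ) m e
  rw [hg', order_single_mul _ (fun h1 => he (hξ _ (hg.symm.trans h1)))] at heven
  obtain ⟨l, rfl⟩ := heven
  have h1 : C (HahnSeries.single (l + l) (1 : k)) = C (HahnSeries.single l 1) ^ 2 := by
    rw [← C_pow, HahnSeries.single_pow, one_pow, two_smul]
  rw [h1, map_mul, map_pow]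
  exact sq_mul_mem_sumSq _ (mk_mem_sumSq_laurent two_ne_zero hp he
    (fun q hq hqe => hcr q hq (hqe.mul_left _)) h0 hh hpi hph)

variable (hirr : Irreducible h) (hsos : algebraMap k[X] (RatFunc k) h ∈ sums (RatFunc k))

include hirr hsos

omit hp in
theorem not_isSquare_discriminant :
    ¬ IsSquare (algebraMap (LaurentSeries k)[X] (RatFunc (LaurentSeries k))
      (tXSubOne k * h.map HahnSeries.C)) :=
  not_isSquare_of_odd_natDegree (odd_natDegree_tXSubOne_mul hirr.ne_zero
    (even_natDegree_of_mem_sums hreal hsos))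

variable {F : Type u} [Field F] [Algebra (RatFunc (LaurentSeries k)) F] {y : F}
  (hy : y ^ 2 = algebraMap (RatFunc (LaurentSeries k)) F
    (algebraMap (LaurentSeries k)[X] (RatFunc (LaurentSeries k))
      (tXSubOne k * h.map HahnSeries.C)))

include hy

theorem tXSubOne_mem_sumSq : algebraMap (RatFunc (LaurentSeries k)) F
    (algebraMap (LaurentSeries k)[X] (RatFunc (LaurentSeries k)) (tXSubOne k)) ∈
      sumSq F (2 ^ (n + 1)) := by
  obtain ⟨w, hw, α, hα, h1⟩ := ratFunc_exists_sq_mul hsos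
  have h2 : w ^ 2 * h = α := by
    apply RatFunc.algebraMap_injective k
    rw [← h1, map_mul, map_pow]
  let ψ : k[X] →+* RatFunc (LaurentSeries k) :=
    (algebraMap (LaurentSeries k)[X] (RatFunc (LaurentSeries k))).comp
      (mapRingHom HahnSeries.C)
  have hψ : Function.Injective ψ :=
    (RatFunc.algebraMap_injective _).comp (map_injective _ HahnSeries.C_injective)
  have h3 : ψ h ∈ sumSq (RatFunc (LaurentSeries k)) (2 ^ (n + 1)) := by
    apply sums_ratFunc_laurent_subset hreal hp
    have h4 := div_mem_sums (map_mem_sums ψ hα) (sq_mem_sums (ψ w))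
    rwa [← h2, map_mul, map_pow, mul_div_cancel_left₀] at h4
    exact pow_ne_zero 2 ((map_ne_zero_iff ψ hψ).2 hw)
  have h5 : algebraMap (RatFunc (LaurentSeries k)) F (ψ h) ≠ 0 := by
    simpa using (map_ne_zero_iff ψ hψ).2 hirr.ne_zero
  convert div_mem_sumSq (n + 1) (sq_mul_mem_sumSq y (sumSq_mono_s18 (Nat.one_le_two_pow)
    ⟨fun _ => (1 : F), by simp⟩ : (1 : F) ∈ sumSq F (2 ^ (n + 1)))) 
    (map_mem_sumSq_s18 (algebraMap (RatFunc (LaurentSeries k)) F) h3) using 1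
  rw [mul_one, eq_div_iff h5, hy, map_mul, map_mul]
  rfl


variable (hgen : IntermediateField.adjoin (RatFunc (LaurentSeries k)) {y} = ⊤)
  {B : Type u} [Field B] {j : k →+* B} {ξ : B} (hξ : ∀ q : k[X], q.eval₂ j ξ = 0 → q = 0)

include hgen hξ

theorem mem_sumSq_of_squarefree {c : (LaurentSeries k)[X]} (hc : Squarefree c)
    (hcr : ∀ p, Irreducible p → p ∣ c → (-1 : AdjoinRoot p) ∉ sums (AdjoinRoot p))
    (hcg : ¬ tXSubOne k ∣ c) (heven : Even (laurentEval j ξ c).order)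
    (hcs : algebraMap (RatFunc (LaurentSeries k)) F
      (algebraMap (LaurentSeries k)[X] (RatFunc (LaurentSeries k)) c) ∈ sums F) :
    algebraMap (RatFunc (LaurentSeries k)) F
      (algebraMap (LaurentSeries k)[X] (RatFunc (LaurentSeries k)) c) ∈ sumSq F (2 ^ (n + 1)) := by
  obtain ⟨w, α, β, hw, hα, hβ, hrep⟩ := exists_mul_sq_eq_of_mem_sums hy
    (not_isSquare_discriminant hreal hirr hsos) hgen hcs
  have hh := neg_one_mem_sums_adjoinRoot hirr hsos
  have hf := squarefree_tXSubOne_mul hreal hirr hh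
  have hcf : IsCoprime c (tXSubOne k * h.map HahnSeries.C) :=
    (irreducible_tXSubOne.coprime_iff_not_dvd.2 hcg).symm.mul_right
      (isCoprime_of_real_of_nonreal hc.ne_zero hcr fun _ _ => nonreal_adjoinRoot_of_dvd_map hh)
  obtain ⟨α', β', γ, hα', hβ', hγ, hrep', hγ0⟩ := legendre (real_laurent hreal) n hc hf hcf
    (odd_natDegree_tXSubOne_mul hirr.ne_zero (even_natDegree_of_mem_sums hreal hsos))
    (fun p hpi hpc => sums_adjoinRoot_laurent_subset hreal hp hpi (hcr p hpi hpc)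
      (neg_mem_sums_adjoinRoot hpi (hcr p hpi hpc) hpc (not_sq_dvd_of_squarefree hpi hc)
        hw hα hβ hrep))
    (fun p hpi hpf => by
      rcases hpi.prime.dvd_or_dvd hpf with hpg | hph
      · have hr := real_adjoinRoot_of_dvd_tXSubOne hreal hpi hpg
        exact sums_adjoinRoot_laurent_subset hreal hp hpi hr
          (mem_sums_adjoinRoot hpi hr hpf (not_sq_dvd_of_squarefree hpi hf) hw hα hβ hrep)
      · exact mk_mem_sumSq_of_even_order hreal hp hξ hc.ne_zero hcr heven hirr.ne_zero hh hpi hph)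
  exact mem_sumSq_of_representation hy hα' hβ' hγ hrep' hγ0

variable (hB : ∀ f : Fin (2 ^ (n + 1)) → B, ∑ i, f i ^ 2 = 0 → f = 0) {ι : F →+* LaurentSeries B}
  (hι : ∀ c, ι (algebraMap (RatFunc (LaurentSeries k)) F
    (algebraMap (LaurentSeries k)[X] (RatFunc (LaurentSeries k)) c)) = laurentEval j ξ c)

omit hreal hp hirr hsos hy hgen hξ in
theorem even_order_map_mul_iff {a b : F} (ha : a ≠ 0) (hb : b ≠ 0) (hbe : Even (ι b).order) :
    Even (ι (a * b)).order ↔ Even (ι a).order := by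
  rw [map_mul, HahnSeries.order_mul ((map_ne_zero ι).2 ha) ((map_ne_zero ι).2 hb), Int.even_add]
  simp [hbe]

include hB hι

theorem mem_sumSq_of_even_order {c : (LaurentSeries k)[X]} (hc : c ≠ 0)
    (heven : Even (laurentEval j ξ c).order)
    (hcs : algebraMap (RatFunc (LaurentSeries k)) F
      (algebraMap (LaurentSeries k)[X] (RatFunc (LaurentSeries k)) c) ∈ sums F) :
    algebraMap (RatFunc (LaurentSeries k)) F
      (algebraMap (LaurentSeries k)[X] (RatFunc (LaurentSeries k)) c) ∈ sumSq F (2 ^ (n + 1)) := by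
  let ψ : (LaurentSeries k)[X] →+* F := (algebraMap (RatFunc (LaurentSeries k)) F).comp
    (algebraMap (LaurentSeries k)[X] (RatFunc (LaurentSeries k)))
  have hψ : Function.Injective ψ :=
    (algebraMap (RatFunc (LaurentSeries k)) F).injective.comp (RatFunc.algebraMap_injective _)
  have hιψ : ∀ c, ι (ψ c) = laurentEval j ξ c := hι
  change ψ c ∈ sums F at hcs
  change ψ c ∈ _
  obtain ⟨c', d, hc', hcr, hd, hd0, hcd⟩ := exists_real_squarefree (real_laurent hreal) n
    (fun p hpi hr => neg_one_mem_sumSq_adjoinRoot_laurent hreal hp hpi hr) c hc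
  have hψd : ψ c = ψ c' * algebraMap (RatFunc (LaurentSeries k)) F d := by
    have := congrArg (algebraMap (RatFunc (LaurentSeries k)) F) hcd
    rwa [map_mul] at this
  have hd' := map_mem_sumSq_s18 (algebraMap (RatFunc (LaurentSeries k)) F) hd
  have hd0' : algebraMap (RatFunc (LaurentSeries k)) F d ≠ 0 := by simpa using hd0
  have hde := even_order_of_mem_sumSq hB (map_mem_sumSq_s18 ι hd')
  have hc0' : ψ c' ≠ 0 := (map_ne_zero_iff ψ hψ).2 hc'.ne_zero
  have heven' : Even (ι (ψ c')).order := by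
    rw [← even_order_map_mul_iff hc0' hd0' hde, ← hψd]
    rwa [hιψ]
  have hcs' : ψ c' ∈ sums F := by
    rw [eq_div_of_mul_eq hd0' hψd.symm]
    exact div_mem_sums hcs (sumSq_subset_sums _ hd')
  rw [hψd]
  refine mul_mem_sumSq _ ?_ hd'
  by_cases hg : tXSubOne k ∣ c'
  · obtain ⟨e, rfl⟩ := hg
    have hgm := tXSubOne_mem_sumSq hreal hp hirr hsos hy
    change ψ _ ∈ _ at hgm
    have hg0 : ψ (tXSubOne k) ≠ 0 := (map_ne_zero_iff ψ hψ).2 irreducible_tXSubOne.ne_zero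
    have he0 : ψ e ≠ 0 := (map_ne_zero_iff ψ hψ).2 hc'.of_mul_right.ne_zero
    have hmul : ψ (tXSubOne k * e) = ψ e * ψ (tXSubOne k) := by rw [map_mul, mul_comm]
    rw [hmul] at heven' hcs' ⊢
    refine mul_mem_sumSq _ ?_ hgm
    rw [even_order_map_mul_iff he0 hg0
      (even_order_of_mem_sumSq hB (map_mem_sumSq_s18 ι hgm)), hιψ] at heven'
    refine mem_sumSq_of_squarefree hreal hp hirr hsos hy hgen hξ hc'.of_mul_right
      (fun p hpi hpe => hcr p hpi (hpe.mul_left _)) (fun hge => ?_) heven' ?_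
    · exact irreducible_tXSubOne.not_isUnit (hc' _ (mul_dvd_mul_left _ hge))
    · have := div_mem_sums hcs' (sumSq_subset_sums _ hgm)
      rwa [mul_div_cancel_right₀ _ hg0] at this
  · rw [hιψ] at heven'
    exact mem_sumSq_of_squarefree hreal hp hirr hsos hy hgen hξ hc' hcr hg heven' hcs'

theorem mem_sumSq_of_mem_sums_of_even_order {u : F} (hu : u ∈ sums F) (hu0 : u ≠ 0)
    (heven : Even (ι u).order) : u ∈ sumSq F (2 ^ (n + 1)) := by
  have hr := real_ratFunc (real_laurent hreal)
  have hE := sums_ratFunc_laurent_subset hreal hp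
  have hd := not_isSquare_discriminant hreal hirr hsos
  obtain ⟨c, hc0, hc, huc⟩ := exists_algebraMap_mul_mem_sumSq hr Nat.one_le_two_pow hE hy hd hgen
    hu hu0
  set φ := algebraMap (RatFunc (LaurentSeries k)) F
  have h1 : algebraMap (LaurentSeries k)[X] (RatFunc (LaurentSeries k)) (c.num * c.denom) =
      (algebraMap (LaurentSeries k)[X] (RatFunc (LaurentSeries k)) c.denom) ^ 2 * c := by
    have h2 := (div_eq_iff (RatFunc.algebraMap_ne_zero c.denom_ne_zero)).1 c.num_div_denom
    rw [map_mul, h2]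
    ring
  set P := c.num * c.denom
  have hP0 : P ≠ 0 := mul_ne_zero (RatFunc.num_ne_zero hc0) c.denom_ne_zero
  have hP : φ (algebraMap _ _ P) ∈ sums F := by
    rw [h1, map_mul, map_pow]
    exact mul_mem_sums (sq_mem_sums _) hc
  have huP : u * φ (algebraMap _ _ P) ∈ sumSq F (2 ^ (n + 1)) := by
    rw [h1, map_mul, map_pow, mul_left_comm]
    exact sq_mul_mem_sumSq _ huc
  have hP0' : φ (algebraMap _ _ P) ≠ 0 := by simpa using hP0
  have h3 := even_order_of_mem_sumSq hB (map_mem_sumSq_s18 ι huP)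
  rw [mul_comm, even_order_map_mul_iff hP0' hu0 heven, hι] at h3
  have h4 := div_mem_sumSq (n + 1) huP
    (mem_sumSq_of_even_order hreal hp hirr hsos hy hgen hξ hB hι hP0 h3 hP)
  rwa [mul_div_cancel_right₀ _ hP0'] at h4

theorem sums_subset_sumSq : sums F ⊆ sumSq F (2 ^ (n + 1) + 1) := by
  intro u hu
  have key := fun {v : F} => mem_sumSq_of_mem_sums_of_even_order hreal hp hirr hsos hy hgen hξ hB hι
    (u := v)
  by_cases hu0 : u = 0
  · exact hu0 ▸ zero_mem_sumSq _
  by_cases heven : Even (ι u).order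
  · exact sumSq_mono_s18 (Nat.le_succ _) (key hu hu0 heven)
  obtain ⟨m, f, rfl⟩ := mem_sums.1 hu
  rw [map_sum] at heven
  simp only [map_pow] at heven
  obtain ⟨i, hi, hi0⟩ := exists_even_order_sub (fun i => ι (f i)) heven
  have h1 : ι (∑ i, f i ^ 2 - f i ^ 2) = ∑ i, ι (f i) ^ 2 - ι (f i) ^ 2 := by
    simp only [map_sub, map_sum, map_pow]
  rw [← h1] at hi hi0
  have h2 : ∑ i, f i ^ 2 - f i ^ 2 ∈ sums F := by
    rw [Fintype.sum_eq_add_sum_compl i, add_sub_cancel_left]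
    exact sum_mem_sums fun _ _ => sq_mem_sums _
  have h3 := add_mem_sumSq (key h2 (fun h0 => hi0 (by rw [h0, map_zero])) hi)
    (sq_mem_sumSq (f i) le_rfl) le_rfl
  rwa [sub_add_cancel] at h3

omit hgen in
theorem exists_mem_sums_notMem_sumSq : ∃ u ∈ sums F, u ∉ sumSq F (2 ^ (n + 1)) := by
  refine ⟨algebraMap (RatFunc (LaurentSeries k)) F
    (algebraMap (LaurentSeries k)[X] (RatFunc (LaurentSeries k)) (tXSubOne k + 1)), ?_, ?_⟩
  · rw [map_add, map_add, map_one, map_one]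
    refine add_mem_sums (sumSq_subset_sums _ (tXSubOne_mem_sumSq hreal hp hirr hsos hy)) ?_
    simpa using sq_mem_sums (1 : F)
  · intro hu
    have h1 := even_order_of_mem_sumSq hB (map_mem_sumSq_s18 ι hu)
    have h2 : laurentEval j ξ (tXSubOne k + 1) =
        HahnSeries.single 1 1 * ((PowerSeries.C ξ : PowerSeries B) : LaurentSeries B) := by
      change eval₂ _ _ _ = _
      rw [tXSubOne, sub_add_cancel, eval₂_mul, eval₂_C, eval₂_X, laurentMap_single,
        PowerSeries.coe_C]
    rw [hι, h2, order_single_mul] at h1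
    · exact absurd h1 (by decide)
    · rw [PowerSeries.constantCoeff_C]
      rintro h0
      exact X_ne_zero (hξ X (by rw [eval₂_X, h0]))

end Main

theorem statement18 (n : ℕ) (k : Type u) [Field k]
    (hreal : (-1 : k) ∉ sums k)
    (hp : ∀ (L : Type u) [Field L] [Algebra k L],
      FiniteDimensional k L → pyth L ≤ ((2 ^ n : ℕ) : ℕ∞))
    (h : Polynomial k) (hirr : Irreducible h)
    (hsos : algebraMap (Polynomial k) (RatFunc k) h ∈ sums (RatFunc k))
    (hnot : algebraMap (Polynomial k) (RatFunc k) h ∉ sumSq (RatFunc k) (2 ^ (n + 1) - 1))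
    (F : Type u) [Field F] [Algebra (RatFunc (LaurentSeries k)) F]
    (y : F)
    (hy : y ^ 2 = algebraMap (RatFunc (LaurentSeries k)) F
      ((RatFunc.C (HahnSeries.single (1 : ℤ) (1 : k)) * RatFunc.X - 1) *
        algebraMap (Polynomial (LaurentSeries k)) (RatFunc (LaurentSeries k))
          (Polynomial.map (algebraMap k (LaurentSeries k)) h)))
    (hgen : IntermediateField.adjoin (RatFunc (LaurentSeries k)) {y} = ⊤) :
    pyth F = ((2 ^ (n + 1) + 1 : ℕ) : ℕ∞) := by
  have hC : algebraMap k (LaurentSeries k) = HahnSeries.C :=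
    RingHom.ext (LaurentSeries.algebraMap_apply k)
  have hg : algebraMap (Polynomial (LaurentSeries k)) (RatFunc (LaurentSeries k)) (tXSubOne k) =
      RatFunc.C (HahnSeries.single (1 : ℤ) (1 : k)) * RatFunc.X - 1 := by
    rw [tXSubOne, map_sub,
      map_one (algebraMap (Polynomial (LaurentSeries k)) (RatFunc (LaurentSeries k))),
      map_mul (algebraMap (Polynomial (LaurentSeries k)) (RatFunc (LaurentSeries k))),
      RatFunc.algebraMap_C, RatFunc.algebraMap_X]
  have hy' : y ^ 2 = algebraMap (RatFunc (LaurentSeries k)) F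
      (algebraMap (Polynomial (LaurentSeries k)) (RatFunc (LaurentSeries k))
        (tXSubOne k * h.map HahnSeries.C)) := by
    rw [hy, hC, map_mul (algebraMap (Polynomial (LaurentSeries k)) _), hg]
  obtain ⟨B, _, j, ξ, σ, hσ, hξ, hB⟩ := exists_coefficient_field hreal hsos hnot
  have := charZero_of_real hreal
  have := charZero_of_injective_ringHom j.injective
  obtain ⟨ι, hι⟩ := exists_embedding two_ne_zero hσ hξ hy' hgen
  obtain ⟨u, hu, hu'⟩ := exists_mem_sums_notMem_sumSq hreal hp hirr hsos hy' hξ hB hι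
  exact pyth_eq_of_subset (sums_subset_sumSq hreal hp hirr hsos hy' hgen hξ hB hι) hu hu'

end SosPaper
end
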